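/- (Theorem 2) Assume σ = 0, φ'' ∈ WLSC(α−2, c, x₀) for some c ∈ (0,1], x₀ ≥ 0 and α > 0 (with x₀ ≤ θ₁ whenever θ₁ > 0), unbounded variation, and that ν(dx) has an almost monotone density ν(x). Then μ_t is absolutely continuous with density p(t,·), and there is C > 0 such that for all t ∈ (0, 1/Φ(x₀)) (with 1/Φ(x₀) = ∞ if x₀ = 0) and all x ∈ ℝ, p(t, x + t·b_{1/ψ^{−1}(1/t)}) ≤ C · min{Φ^{−1}(1/t), t·η(|x|)}. -/

import Mathlib

open MeasureTheory Real Set Filter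

noncomputable section

/-- Weak lower scaling property at infinity: `f(l*x) ≥ c * l^τ * f(x)` for `l ≥ 1`, `x > x₁`. -/
def WLSC (f : ℝ → ℝ) (τ c x₁ : ℝ) : Prop :=
  ∀ l : ℝ, 1 ≤ l → ∀ x : ℝ, x₁ < x → c * l ^ τ * f x ≤ f (l * x)

/-- Weak upper scaling property at infinity: `f(l*x) ≤ C * l^τ * f(x)` for `l ≥ 1`, `x > x₁`. -/
def WUSC (f : ℝ → ℝ) (τ C x₁ : ℝ) : Prop :=
  ∀ l : ℝ, 1 ≤ l → ∀ x : ℝ, x₁ < x → f (l * x) ≤ C * l ^ τ * f x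

/-- The Pruitt function `K(r) = σ²/r² + r⁻² ∫_{(0,r)} s² ν(ds)`. -/
def pruittK (σ : ℝ) (ν : Measure ℝ) (r : ℝ) : ℝ :=
  σ ^ 2 / r ^ 2 + (∫ s in Ioo (0:ℝ) r, s ^ 2 ∂ν) / r ^ 2

/-- The Pruitt function `h(r) = σ²/r² + ∫_{(0,∞)} min(1, s²/r²) ν(ds)`. -/
def pruittH (σ : ℝ) (ν : Measure ℝ) (r : ℝ) : ℝ :=
  σ ^ 2 / r ^ 2 + ∫ s in Ioi (0:ℝ), min 1 (s ^ 2 / r ^ 2) ∂ν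

/-- The real part of the characteristic exponent:
`Re ψ(ξ) = σ²ξ² + ∫_{(0,∞)} (1 − cos(ξx)) ν(dx)`. -/
def rePsi (σ : ℝ) (ν : Measure ℝ) (ξ : ℝ) : ℝ :=
  σ ^ 2 * ξ ^ 2 + ∫ x in Ioi (0:ℝ), (1 - Real.cos (ξ * x)) ∂ν

/-- `ψ*(r) = sup_{|z| ≤ r} Re ψ(z)`. -/
def psiStar (σ : ℝ) (ν : Measure ℝ) (r : ℝ) : ℝ :=
  sSup (rePsi σ ν '' {z : ℝ | |z| ≤ r})

/-- `ψ⁻¹(s) = sup{r > 0 : ψ*(r) = s}`. -/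
def psiInv (σ : ℝ) (ν : Measure ℝ) (s : ℝ) : ℝ :=
  sSup {r : ℝ | 0 < r ∧ psiStar σ ν r = s}

/-- `Φ(x) = x² φ''(x)`. -/
def bigPhi (φ'' : ℝ → ℝ) (x : ℝ) : ℝ := x ^ 2 * φ'' x

/-- `Φ*(r) = sup_{0 < s ≤ r} Φ(s)`. -/
def bigPhiStar (φ'' : ℝ → ℝ) (r : ℝ) : ℝ := sSup (bigPhi φ'' '' Ioc (0:ℝ) r)

/-- `Φ⁻¹(s) = sup{r > 0 : Φ*(r) = s}`. -/
def bigPhiInv (φ'' : ℝ → ℝ) (s : ℝ) : ℝ := sSup {r : ℝ | 0 < r ∧ bigPhiStar φ'' r = s}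

/-- The characteristic (Lévy–Khintchine) exponent
`ψ(ξ) = σ²ξ² − ibξ − ∫_{(0,∞)} (e^{iξx} − 1 − iξx 1_{x<1}) ν(dx)`. -/
def charExp (σ b : ℝ) (ν : Measure ℝ) (ξ : ℝ) : ℂ :=
  (σ : ℂ) ^ 2 * (ξ : ℂ) ^ 2 - Complex.I * (b : ℂ) * (ξ : ℂ) -
    ∫ x in Ioi (0:ℝ), (Complex.exp (Complex.I * (ξ : ℂ) * (x : ℂ)) - 1 -
      Complex.I * (ξ : ℂ) * (x : ℂ) * (if x < 1 then (1:ℂ) else 0)) ∂ν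

/-- The holomorphic extension of the Laplace exponent to `{Re z > 0}`. -/
def laplaceC (σ b : ℝ) (ν : Measure ℝ) (z : ℂ) : ℂ :=
  (σ : ℂ) ^ 2 * z ^ 2 - (b : ℂ) * z +
    ∫ x in Ioi (0:ℝ), (Complex.exp (-(z * (x : ℂ))) - 1 +
      z * (x : ℂ) * (if x < 1 then (1:ℂ) else 0)) ∂ν

/-- `b_r = b + ∫_{(0,∞)} s (1_{s<r} − 1_{s<1}) ν(ds)`. -/
def brFn (b : ℝ) (ν : Measure ℝ) (r : ℝ) : ℝ :=
  b + ∫ s in Ioi (0:ℝ), s * ((if s < r then (1:ℝ) else 0) - (if s < 1 then (1:ℝ) else 0)) ∂ν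

/-- The majorant `η`: `η(0) = ∞`, `η(s) = s⁻¹ Φ*(1/s)` for `0 < s < 1/x₀`,
and `η(s) = A s⁻¹ |φ(1/s)|` for `s ≥ 1/x₀`, where `A = Φ*(x₀)/|φ(x₀)|`. -/
def etaFn (φ φ'' : ℝ → ℝ) (x₀ : ℝ) (s : ℝ) : ENNReal :=
  if s ≤ 0 then ⊤
  else if x₀ * s < 1 then ENNReal.ofReal (s⁻¹ * bigPhiStar φ'' s⁻¹)
  else ENNReal.ofReal ((bigPhiStar φ'' x₀ / |φ x₀|) * s⁻¹ * |φ s⁻¹|)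

lemma integrable_of_cubic_decay {g : ℝ → ℝ} (hg : Continuous g) {B : ℝ}
    (h0 : ∀ y, |g y| ≤ B) (h3 : ∀ y, |y| ^ 3 * |g y| ≤ B) :
    Integrable g ∧ ∫ y, |g y| ≤ 3 * B * π := by
  have key : ∀ y, |g y| ≤ 3 * B * (1 + y ^ 2)⁻¹ := by
    intro y
    have h1 := h0 y
    have h2 := h3 y
    have hy := abs_nonneg y
    have hg' := abs_nonneg (g y)
    rw [← div_eq_mul_inv, le_div_iff₀ (by positivity), ← sq_abs y]
    have h4 : |y| ^ 2 ≤ 1 + |y| ^ 3 := by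
      rcases le_total |y| 1 with h | h
      · nlinarith [pow_nonneg hy 3]
      · nlinarith [pow_nonneg hy 2, mul_le_mul_of_nonneg_left h (pow_nonneg hy 2)]
    nlinarith [mul_le_mul_of_nonneg_left h4 hg']
  have hi : Integrable (fun y : ℝ => 3 * B * (1 + y ^ 2)⁻¹) :=
    integrable_inv_one_add_sq.const_mul _
  have hg1 : Integrable g := hi.mono' hg.aestronglyMeasurable (ae_of_all _ key)
  refine ⟨hg1, ?_⟩
  calc ∫ y, |g y| ≤ ∫ y : ℝ, 3 * B * (1 + y ^ 2)⁻¹ :=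
        integral_mono hg1.abs hi key
    _ = 3 * B * π := by rw [integral_const_mul, integral_univ_inv_one_add_sq]

open FourierTransform in
lemma exists_real_fourier_inverse (f f1 f2 f3 : ℝ → ℂ)
    (h1 : ∀ x, HasDerivAt f (f1 x) x) (h2 : ∀ x, HasDerivAt f1 (f2 x) x)
    (h3 : ∀ x, HasDerivAt f2 (f3 x) x)
    (i0 : Integrable f) (i1 : Integrable f1) (i2 : Integrable f2) (i3 : Integrable f3)
    {B : ℝ} (hB0 : ∫ x, ‖f x‖ ≤ B) (hB3 : ∫ x, ‖f3 x‖ ≤ B)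
    (hsymm : ∀ x, f (-x) = (starRingEnd ℂ) (f x)) :
    ∃ q : ℝ → ℝ, Continuous q ∧ (∀ y, |q y| ≤ B) ∧ (∀ y, |y| ^ 3 * |q y| ≤ B) ∧
      Integrable q ∧ ∫ y, |q y| ≤ 3 * B * π ∧
      ∀ ζ : ℝ, ∫ y : ℝ, (q y : ℂ) * Complex.exp (ζ * y * Complex.I) = f ζ := by
  have d1 : deriv f = f1 := funext fun x => (h1 x).deriv
  have d2 : deriv f1 = f2 := funext fun x => (h2 x).deriv
  have d3 : deriv f2 = f3 := funext fun x => (h3 x).deriv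
  have hcont : Continuous f :=
    (Differentiable.continuous (𝕜 := ℝ) fun x => (h1 x).differentiableAt)
  have e1 : 𝓕 f1 = fun (x : ℝ) ↦ (2 * π * Complex.I * x) • (𝓕 f x) := by
    rw [← d1]; exact Real.fourier_deriv i0 (fun x => (h1 x).differentiableAt) (d1 ▸ i1)
  have e2 : 𝓕 f2 = fun (x : ℝ) ↦ (2 * π * Complex.I * x) • (𝓕 f1 x) := by
    rw [← d2]; exact Real.fourier_deriv i1 (fun x => (h2 x).differentiableAt) (d2 ▸ i2)
  have e3 : 𝓕 f3 = fun (x : ℝ) ↦ (2 * π * Complex.I * x) • (𝓕 f2 x) := by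
    rw [← d3]; exact Real.fourier_deriv i2 (fun x => (h3 x).differentiableAt) (d3 ▸ i3)
  have e : ∀ w : ℝ, (2 * π * |w|) ^ 3 * ‖𝓕 f w‖ ≤ B := by
    intro w
    have hw : 𝓕 f3 w = (2 * π * Complex.I * w) ^ 3 * 𝓕 f w := by
      rw [e3, e2, e1]; simp only [smul_eq_mul]; ring
    have hn : ‖𝓕 f3 w‖ ≤ ∫ x, ‖f3 x‖ :=
      VectorFourier.norm_fourierIntegral_le_integral_norm _ _ _ _ _
    have hp : ‖𝓕 f3 w‖ = (2 * π * |w|) ^ 3 * ‖𝓕 f w‖ := by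
      rw [hw, norm_mul, norm_pow]; simp [abs_of_pos Real.pi_pos]
    linarith
  have b0 : ∀ w : ℝ, ‖𝓕 f w‖ ≤ B := fun w =>
    le_trans (VectorFourier.norm_fourierIntegral_le_integral_norm _ _ _ _ _) hB0
  have hFcont : Continuous (𝓕 f) := by
    simpa using! VectorFourier.fourierIntegral_continuous Real.continuous_fourierChar
      (by exact continuous_inner) i0
  have hreal : ∀ w : ℝ, (starRingEnd ℂ) (𝓕 f w) = 𝓕 f w := by
    intro w
    rw [Real.fourier_real_eq_integral_exp_smul, ← integral_conj,
      ← integral_neg_eq_self (fun v : ℝ =>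
        Complex.exp (↑(-2 * π * v * w) * Complex.I) • f v)]
    refine integral_congr_ae (ae_of_all _ fun v => ?_)
    simp only [smul_eq_mul, map_mul, hsymm, ← Complex.exp_conj, Complex.conj_I,
      Complex.conj_ofReal]
    congr 2
    push_cast; ring
  have hre : ∀ w : ℝ, ((𝓕 f w).re : ℂ) = 𝓕 f w := fun w =>
    (Complex.conj_eq_iff_re.1 (hreal w))
  have hpi : (1:ℝ) ≤ 2 * π := by linarith [Real.pi_gt_three]
  have hpi0 : (0:ℝ) < 2 * π := by linarith
  have hB : 0 ≤ B := le_trans (norm_nonneg _) (b0 0)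
  set q : ℝ → ℝ := fun y => (2 * π)⁻¹ * (𝓕 f (y * (2 * π)⁻¹)).re with hq
  have hqn : ∀ y, |q y| ≤ ‖𝓕 f (y * (2 * π)⁻¹)‖ := by
    intro y
    rw [hq]; simp only [abs_mul, abs_of_pos (inv_pos.2 hpi0)]
    calc _ ≤ 1 * ‖𝓕 f (y * (2 * π)⁻¹)‖ := by
          gcongr
          · exact inv_le_one_of_one_le₀ hpi
          · exact Complex.abs_re_le_norm _
      _ = _ := one_mul _
  have hqc : Continuous q := by
    rw [hq]; fun_prop
  have hq0 : ∀ y, |q y| ≤ B := fun y => (hqn y).trans (b0 _)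
  have hq3 : ∀ y, |y| ^ 3 * |q y| ≤ B := by
    intro y
    have h := e (y * (2 * π)⁻¹)
    have h' : 2 * π * |y * (2 * π)⁻¹| = |y| := by
      rw [abs_mul, abs_of_pos (inv_pos.2 hpi0)]; field_simp
    rw [h'] at h
    exact (mul_le_mul_of_nonneg_left (hqn y) (by positivity)).trans h
  obtain ⟨hqi, hqB⟩ := integrable_of_cubic_decay hqc hq0 hq3
  refine ⟨q, hqc, hq0, hq3, hqi, hqB, fun ζ => ?_⟩
  have hFi : Integrable (𝓕 f) := by
    have h4 := (hqi.comp_mul_right' hpi0.ne').const_mul (2 * π)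
    have h5 : (fun x => 2 * π * q (x * (2 * π))) = fun x => (𝓕 f x).re := by
      funext x
      simp only [hq]
      rw [mul_assoc x, mul_inv_cancel₀ hpi0.ne', mul_one, ← mul_assoc,
        mul_inv_cancel₀ hpi0.ne', one_mul]
    rw [h5] at h4
    have h6 := h4.ofReal (𝕜 := ℂ)
    exact h6.congr (ae_of_all _ fun x => hre x)
  have hinv := congrFun (hcont.fourierInv_fourier_eq i0 hFi) ζ
  rw [Real.fourierInv_eq_fourier_neg, Real.fourier_real_eq_integral_exp_smul] at hinv
  rw [← hinv]
  have hs := Measure.integral_comp_mul_right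
    (fun y : ℝ => (q y : ℂ) * Complex.exp (ζ * y * Complex.I)) (2 * π)
  rw [abs_of_pos (inv_pos.2 hpi0)] at hs
  have hs' : ∫ y : ℝ, (q y : ℂ) * Complex.exp (ζ * y * Complex.I) = (2 * π) •
      ∫ (x : ℝ), (fun y : ℝ => (q y : ℂ) * Complex.exp (ζ * y * Complex.I)) (x * (2 * π)) := by
    rw [hs, smul_smul, mul_inv_cancel₀ hpi0.ne', one_smul]
  rw [hs', ← integral_smul]
  refine integral_congr_ae (ae_of_all _ fun x => ?_)
  simp only [hq, smul_eq_mul, Complex.real_smul]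
  rw [mul_assoc x, mul_inv_cancel₀ hpi0.ne', mul_one]
  push_cast
  rw [hre x]
  have : (2 * (π:ℂ)) ≠ 0 := by exact_mod_cast hpi0.ne'
  have he : Complex.exp (ζ * (x * (2 * π)) * Complex.I)
      = Complex.exp (-2 * π * x * -ζ * Complex.I) := by
    congr 1; ring
  rw [he]
  field_simp

lemma cube_mul_exp_neg_rpow_le {α c : ℝ} (hα : 0 < α) (hc : 0 < c) :
    ∃ K : ℝ, 0 < K ∧ ∀ u : ℝ, 0 ≤ u →
      (1 + u) ^ 3 * Real.exp (-(c * u ^ α)) ≤ K * (1 + u ^ 2)⁻¹ := by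
  obtain ⟨n, hn⟩ := exists_nat_gt (5 / α)
  have hn' : 5 ≤ α * n := by
    rw [div_lt_iff₀ hα] at hn; linarith
  have hfac : (0:ℝ) < (n.factorial : ℝ) := by exact_mod_cast n.factorial_pos
  have hcn : 0 < c ^ n := pow_pos hc n
  refine ⟨16 + 16 * (n.factorial / c ^ n), by positivity, fun u hu => ?_⟩
  rw [← div_eq_mul_inv, le_div_iff₀ (by positivity)]
  rcases le_total u 1 with h | h
  · have h1 : Real.exp (-(c * u ^ α)) ≤ 1 := by
      rw [Real.exp_le_one_iff]; have := rpow_nonneg hu α; nlinarith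
    have h2 : (1 + u) ^ 3 ≤ 8 := by
      calc (1 + u) ^ 3 ≤ (2:ℝ) ^ 3 := by gcongr; linarith
        _ = 8 := by norm_num
    have h3 : 1 + u ^ 2 ≤ 2 := by nlinarith
    calc (1 + u) ^ 3 * Real.exp (-(c * u ^ α)) * (1 + u ^ 2) ≤ 8 * 1 * 2 := by gcongr
      _ ≤ _ := by nlinarith [div_pos hfac hcn]
  · have h1 : (c * u ^ α) ^ n / n.factorial ≤ Real.exp (c * u ^ α) :=
      pow_div_factorial_le_exp _ (by positivity) n
    have h2 : u ^ 5 ≤ (u ^ α) ^ n := by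
      rw [← rpow_natCast (u ^ α), ← rpow_mul hu, ← rpow_natCast u 5]
      exact rpow_le_rpow_of_exponent_le h (by exact_mod_cast hn')
    have h3 : u ^ 5 * c ^ n / n.factorial ≤ Real.exp (c * u ^ α) := by
      refine le_trans ?_ h1
      rw [mul_pow, mul_comm (c ^ n)]
      gcongr
    have h4 : (1 + u) ^ 3 * (1 + u ^ 2) ≤ 16 * u ^ 5 := by
      calc (1 + u) ^ 3 * (1 + u ^ 2) ≤ (2 * u) ^ 3 * (2 * u ^ 2) := by
            gcongr
            · linarith
            · nlinarith
        _ = 16 * u ^ 5 := by ring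
    rw [Real.exp_neg]
    have h5 : u ^ 5 * (Real.exp (c * u ^ α))⁻¹ ≤ n.factorial / c ^ n := by
      rw [← div_eq_mul_inv, div_le_div_iff₀ (Real.exp_pos _) hcn]
      rw [div_le_iff₀ hfac] at h3
      linarith
    have h6 : 0 < (Real.exp (c * u ^ α))⁻¹ := inv_pos.2 (Real.exp_pos _)
    nlinarith [mul_le_mul_of_nonneg_right h4 h6.le]

lemma norm_cexp_sub_one_sub_le (u : ℝ) :
    ‖Complex.exp (Complex.I * u) - 1 - Complex.I * u‖ ≤ 3 * u ^ 2 := by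
  rcases le_total |u| 1 with h | h
  · have := Complex.norm_exp_sub_one_sub_id_le (x := Complex.I * u) (by simpa using h)
    have h2 : ‖Complex.I * (u:ℂ)‖ ^ 2 = u ^ 2 := by simp
    rw [h2] at this
    nlinarith [sq_nonneg u]
  · have h1 := norm_sub_le (Complex.exp (Complex.I * u) - 1) (Complex.I * u)
    have h2 : ‖Complex.exp (Complex.I * u) - 1‖ ≤ ‖u‖ := Real.norm_exp_I_mul_ofReal_sub_one_le
    have h3 : ‖Complex.I * (u:ℂ)‖ = |u| := by simp
    rw [h3] at h1
    rw [Real.norm_eq_abs] at h2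
    nlinarith [sq_abs u]

lemma hasDerivAt_cexp_I_mul (x ζ : ℝ) :
    HasDerivAt (fun ζ : ℝ => Complex.exp (Complex.I * ζ * x))
      (Complex.I * x * Complex.exp (Complex.I * ζ * x)) ζ := by
  have h := ((((hasDerivAt_id ζ).ofReal_comp).const_mul Complex.I).mul_const (x:ℂ)).cexp
  simp only [id] at h
  convert h using 1
  push_cast; ring

lemma norm_cexp_I_mul (ζ x : ℝ) : ‖Complex.exp (Complex.I * ζ * x)‖ = 1 := by
  have : Complex.I * (ζ:ℂ) * (x:ℂ) = ((ζ * x : ℝ) : ℂ) * Complex.I := by push_cast; ring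
  rw [this, Complex.norm_exp_ofReal_mul_I]

/-- The centred exponent of a Lévy measure with bounded support. -/
def centredExp (M : Measure ℝ) (ζ : ℝ) : ℂ :=
  ∫ x, (Complex.exp (Complex.I * ζ * x) - 1 - Complex.I * ζ * x) ∂M

def centredExp1 (M : Measure ℝ) (ζ : ℝ) : ℂ :=
  ∫ x, (Complex.I * x * (Complex.exp (Complex.I * ζ * x) - 1)) ∂M

def centredExp2 (M : Measure ℝ) (ζ : ℝ) : ℂ :=
  ∫ x, (-(x:ℂ) ^ 2 * Complex.exp (Complex.I * ζ * x)) ∂M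

def centredExp3 (M : Measure ℝ) (ζ : ℝ) : ℂ :=
  ∫ x, (-Complex.I * (x:ℂ) ^ 3 * Complex.exp (Complex.I * ζ * x)) ∂M

lemma norm_centred1_le (ζ x : ℝ) :
    ‖Complex.I * x * (Complex.exp (Complex.I * ζ * x) - 1)‖ ≤ |ζ| * x ^ 2 := by
  have h : ‖Complex.exp (Complex.I * ((ζ * x : ℝ) : ℂ)) - 1‖ ≤ ‖ζ * x‖ :=
    Real.norm_exp_I_mul_ofReal_sub_one_le
  push_cast at h
  rw [← mul_assoc, norm_mul, Real.norm_eq_abs, Real.norm_eq_abs] at h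
  rw [norm_mul, norm_mul, Complex.norm_I, one_mul, Complex.norm_real, Real.norm_eq_abs]
  calc |x| * ‖Complex.exp (Complex.I * ζ * x) - 1‖ ≤ |x| * (|ζ| * |x|) := by
        rw [← abs_mul]
        exact mul_le_mul_of_nonneg_left (by simpa [mul_assoc] using h) (abs_nonneg x)
    _ = |ζ| * x ^ 2 := by rw [← sq_abs x]; ring

section
variable {M : Measure ℝ} (hi : Integrable (fun x : ℝ => x ^ 2) M)
include hi

lemma integrable_centred (ζ : ℝ) :
    Integrable (fun x : ℝ => Complex.exp (Complex.I * ζ * x) - 1 - Complex.I * ζ * x) M := by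
  refine (hi.const_mul (3 * ζ ^ 2)).mono' (by fun_prop) (ae_of_all _ fun x => ?_)
  have h := norm_cexp_sub_one_sub_le (ζ * x)
  push_cast at h
  rw [← mul_assoc] at h
  linarith [h, mul_pow ζ x 2]

lemma hasDerivAt_centredExp (ζ : ℝ) : HasDerivAt (centredExp M) (centredExp1 M ζ) ζ := by
  refine (hasDerivAt_integral_of_dominated_loc_of_deriv_le
    (F := fun (ζ x : ℝ) => Complex.exp (Complex.I * ζ * x) - 1 - Complex.I * ζ * x)
    (F' := fun (ζ x : ℝ) => Complex.I * x * (Complex.exp (Complex.I * ζ * x) - 1))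
    (bound := fun x => (|ζ| + 1) * x ^ 2) (Metric.ball_mem_nhds ζ one_pos)
    (Eventually.of_forall fun z => (by fun_prop)) (integrable_centred hi ζ) (by fun_prop)
    (ae_of_all _ fun x z hz => ?_) (hi.const_mul _) (ae_of_all _ fun x z hz => ?_)).2
  · refine (norm_centred1_le z x).trans ?_
    have : |z| ≤ |ζ| + 1 := by
      rw [Metric.mem_ball, Real.dist_eq] at hz
      have := abs_sub_abs_le_abs_sub z ζ
      linarith
    gcongr
  · have h := ((hasDerivAt_cexp_I_mul x z).sub_const 1).sub
      ((((hasDerivAt_id z).ofReal_comp).const_mul Complex.I).mul_const (x:ℂ))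
    exact h.congr_deriv (by push_cast; ring)

lemma hasDerivAt_centredExp1 (ζ : ℝ) : HasDerivAt (centredExp1 M) (centredExp2 M ζ) ζ := by
  refine (hasDerivAt_integral_of_dominated_loc_of_deriv_le
    (F := fun (ζ x : ℝ) => Complex.I * x * (Complex.exp (Complex.I * ζ * x) - 1))
    (F' := fun (ζ x : ℝ) => -(x:ℂ) ^ 2 * Complex.exp (Complex.I * ζ * x))
    (bound := fun x => x ^ 2) (Metric.ball_mem_nhds ζ one_pos)
    (Eventually.of_forall fun z => (by fun_prop))
    ((hi.const_mul |ζ|).mono' (by fun_prop) (ae_of_all _ fun x => norm_centred1_le ζ x))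
    (by fun_prop)
    (ae_of_all _ fun x z hz => ?_) hi (ae_of_all _ fun x z hz => ?_)).2
  · rw [norm_mul, norm_cexp_I_mul]; simp
  · have h := ((hasDerivAt_cexp_I_mul x z).sub_const 1).const_mul (Complex.I * x)
    exact h.congr_deriv (by
      linear_combination ((x:ℂ) ^ 2 * Complex.exp (Complex.I * z * x)) * Complex.I_sq)

variable (hs : ∀ᵐ x ∂M, x ∈ Ioo (0:ℝ) 1)
include hs

lemma hasDerivAt_centredExp2 (ζ : ℝ) : HasDerivAt (centredExp2 M) (centredExp3 M ζ) ζ := by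
  refine (hasDerivAt_integral_of_dominated_loc_of_deriv_le
    (F := fun (ζ x : ℝ) => -(x:ℂ) ^ 2 * Complex.exp (Complex.I * ζ * x))
    (F' := fun (ζ x : ℝ) => -Complex.I * (x:ℂ) ^ 3 * Complex.exp (Complex.I * ζ * x))
    (bound := fun x => x ^ 2) (Metric.ball_mem_nhds ζ one_pos)
    (Eventually.of_forall fun z => (by fun_prop))
    (hi.mono' (by fun_prop) (ae_of_all _ fun x => ?_))
    (by fun_prop)
    (hs.mono fun x hx z hz => ?_) hi (ae_of_all _ fun x z hz => ?_)).2
  · rw [norm_mul, norm_cexp_I_mul]; simp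
  · rw [norm_mul, norm_cexp_I_mul]
    simp only [neg_mul, norm_neg, norm_mul, Complex.norm_I, norm_pow, Complex.norm_real,
      Real.norm_eq_abs, abs_of_pos hx.1, one_mul, mul_one]
    nlinarith [hx.1, hx.2, pow_pos hx.1 2]
  · have h := (hasDerivAt_cexp_I_mul x z).const_mul (-(x:ℂ) ^ 2)
    exact h.congr_deriv (by ring)

omit hs in
lemma norm_centredExp1_le {C : ℝ} (hC : ∫ x, x ^ 2 ∂M ≤ C) (ζ : ℝ) :
    ‖centredExp1 M ζ‖ ≤ C * |ζ| := by
  refine (norm_integral_le_of_norm_le (hi.const_mul |ζ|)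
    (ae_of_all _ fun x => norm_centred1_le ζ x)).trans ?_
  rw [integral_const_mul, mul_comm]
  gcongr

omit hs in
lemma norm_centredExp2_le {C : ℝ} (hC : ∫ x, x ^ 2 ∂M ≤ C) (ζ : ℝ) :
    ‖centredExp2 M ζ‖ ≤ C := by
  refine (norm_integral_le_of_norm_le hi (ae_of_all _ fun x => ?_)).trans hC
  rw [norm_mul, norm_cexp_I_mul]; simp

lemma norm_centredExp3_le {C : ℝ} (hC : ∫ x, x ^ 2 ∂M ≤ C) (ζ : ℝ) :
    ‖centredExp3 M ζ‖ ≤ C := by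
  refine (norm_integral_le_of_norm_le hi (hs.mono fun x hx => ?_)).trans hC
  rw [norm_mul, norm_cexp_I_mul]
  simp only [neg_mul, norm_neg, norm_mul, Complex.norm_I, norm_pow, Complex.norm_real,
    Real.norm_eq_abs, abs_of_pos hx.1, one_mul, mul_one]
  nlinarith [hx.1, hx.2, pow_pos hx.1 2]

omit hs in
lemma re_centredExp (ζ : ℝ) : (centredExp M ζ).re = -∫ x, (1 - Real.cos (ζ * x)) ∂M := by
  rw [centredExp, ← integral_neg]
  have := integral_re (integrable_centred hi ζ)
  simp only [RCLike.re_eq_complex_re] at this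
  rw [← this]
  refine integral_congr_ae (ae_of_all _ fun x => ?_)
  have e : Complex.I * (ζ:ℂ) * (x:ℂ) = ((ζ * x : ℝ) : ℂ) * Complex.I := by push_cast; ring
  simp only [e, Complex.sub_re, Complex.exp_ofReal_mul_I_re, Complex.one_re,
    Complex.re_ofReal_mul, Complex.I_re]
  ring

omit hi hs in
lemma centredExp_neg (ζ : ℝ) :
    centredExp M (-ζ) = (starRingEnd ℂ) (centredExp M ζ) := by
  rw [centredExp, centredExp, ← integral_conj]
  refine integral_congr_ae (ae_of_all _ fun x => ?_)
  simp [← Complex.exp_conj]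

lemma exists_small_jump_density {α c C K : ℝ} (hc : 0 < c) (hα : 0 < α) (hC1 : 1 ≤ C)
    (hC : ∫ x, x ^ 2 ∂M ≤ C)
    (hcos : ∀ ζ : ℝ, 1 ≤ |ζ| → c * |ζ| ^ α ≤ ∫ x, (1 - Real.cos (ζ * x)) ∂M)
    (hK : ∀ u : ℝ, 0 ≤ u → (1 + u) ^ 3 * Real.exp (-(c * u ^ α)) ≤ K * (1 + u ^ 2)⁻¹) :
    ∃ q : ℝ → ℝ, Continuous q ∧ (∀ y, |q y| ≤ 5 * C ^ 3 * Real.exp c * K * π) ∧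
      (∀ y, |y| ^ 3 * |q y| ≤ 5 * C ^ 3 * Real.exp c * K * π) ∧
      Integrable q ∧ ∫ y, |q y| ≤ 3 * (5 * C ^ 3 * Real.exp c * K * π) * π ∧
      ∀ ζ : ℝ, ∫ y : ℝ, (q y : ℂ) * Complex.exp (ζ * y * Complex.I) =
        Complex.exp (centredExp M ζ) := by
  have hC0 : 0 < C := by linarith
  set E := centredExp M
  set E1 := centredExp1 M
  set E2 := centredExp2 M
  set E3 := centredExp3 M
  have dE := hasDerivAt_centredExp hi
  have dE1 := hasDerivAt_centredExp1 hi
  have dE2 := hasDerivAt_centredExp2 hi hs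
  have h1 : ∀ x, HasDerivAt (fun ζ => Complex.exp (E ζ)) (E1 x * Complex.exp (E x)) x := by
    exact fun x => (dE x).cexp.congr_deriv (by ring)
  have h2 : ∀ x, HasDerivAt (fun ζ => E1 ζ * Complex.exp (E ζ))
      ((E2 x + E1 x ^ 2) * Complex.exp (E x)) x := by
    exact fun x => ((dE1 x).mul (h1 x)).congr_deriv (by ring)
  have h3 : ∀ x, HasDerivAt (fun ζ => (E2 ζ + E1 ζ ^ 2) * Complex.exp (E ζ))
      ((E3 x + 3 * E1 x * E2 x + E1 x ^ 3) * Complex.exp (E x)) x := by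
    intro x
    exact (((dE2 x).add ((dE1 x).pow 2)).mul (h1 x)).congr_deriv (by
      simp only [Pi.add_apply, Pi.pow_apply]
      push_cast; ring)
  have hE3m : Measurable E3 := by
    have : E3 = fun x => deriv E2 x := funext fun x => (dE2 x).deriv.symm
    rw [this]; exact measurable_deriv E2
  have cE : Continuous E := (Differentiable.continuous (𝕜 := ℝ) fun x => (dE x).differentiableAt)
  have cE1 : Continuous E1 :=
    (Differentiable.continuous (𝕜 := ℝ) fun x => (dE1 x).differentiableAt)
  have cE2 : Continuous E2 :=
    (Differentiable.continuous (𝕜 := ℝ) fun x => (dE2 x).differentiableAt)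
  have hf : ∀ x, ‖Complex.exp (E x)‖ ≤ Real.exp c * Real.exp (-(c * |x| ^ α)) := by
    intro x
    rw [Complex.norm_exp, re_centredExp hi, ← Real.exp_add]
    refine Real.exp_le_exp.2 ?_
    rcases le_total 1 |x| with h | h
    · linarith [hcos x h]
    · have h4 : 0 ≤ ∫ y, (1 - Real.cos (x * y)) ∂M :=
        integral_nonneg fun y => sub_nonneg.2 (Real.cos_le_one _)
      have h5 : |x| ^ α ≤ 1 := rpow_le_one (abs_nonneg x) h hα.le
      nlinarith
  have hG : ∀ x, (1 + |x|) ^ 3 * ‖Complex.exp (E x)‖ ≤ Real.exp c * K * (1 + x ^ 2)⁻¹ := by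
    intro x
    have h4 := hK |x| (abs_nonneg x)
    rw [sq_abs] at h4
    calc (1 + |x|) ^ 3 * ‖Complex.exp (E x)‖
        ≤ (1 + |x|) ^ 3 * (Real.exp c * Real.exp (-(c * |x| ^ α))) := by gcongr; exact hf x
      _ = Real.exp c * ((1 + |x|) ^ 3 * Real.exp (-(c * |x| ^ α))) := by ring
      _ ≤ Real.exp c * (K * (1 + x ^ 2)⁻¹) := by gcongr
      _ = _ := by ring
  have n1 := norm_centredExp1_le hi hC
  have n2 := norm_centredExp2_le hi hC
  have n3 := norm_centredExp3_le hi hs hC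
  have gen : ∀ (k : ℝ → ℂ), (∀ x, ‖k x‖ ≤ 5 * C ^ 3 * (1 + |x|) ^ 3) →
      ∀ x, ‖k x * Complex.exp (E x)‖ ≤ 5 * C ^ 3 * Real.exp c * K * (1 + x ^ 2)⁻¹ := by
    intro k hk x
    rw [norm_mul]
    calc _ ≤ 5 * C ^ 3 * (1 + |x|) ^ 3 * ‖Complex.exp (E x)‖ := by gcongr; exact hk x
      _ = 5 * C ^ 3 * ((1 + |x|) ^ 3 * ‖Complex.exp (E x)‖) := by ring
      _ ≤ 5 * C ^ 3 * (Real.exp c * K * (1 + x ^ 2)⁻¹) :=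
        mul_le_mul_of_nonneg_left (hG x) (by positivity)
      _ = _ := by ring
  have hint : Integrable fun x : ℝ => 5 * C ^ 3 * Real.exp c * K * (1 + x ^ 2)⁻¹ :=
    integrable_inv_one_add_sq.const_mul _
  have hintv : ∫ x : ℝ, 5 * C ^ 3 * Real.exp c * K * (1 + x ^ 2)⁻¹ =
      5 * C ^ 3 * Real.exp c * K * π := by
    rw [integral_const_mul, integral_univ_inv_one_add_sq]
  have hC2 : C ≤ C ^ 2 := by nlinarith
  have hC3 : C ^ 2 ≤ C ^ 3 := by nlinarith [sq_nonneg C]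
  have hC13 : 1 ≤ C ^ 3 := by linarith
  have k0 : ∀ x, ‖(1:ℂ)‖ ≤ 5 * C ^ 3 * (1 + |x|) ^ 3 := by
    intro x
    have h4 : 1 ≤ (1 + |x|) ^ 3 := one_le_pow₀ (by linarith [abs_nonneg x])
    rw [norm_one]; nlinarith
  have k1 : ∀ x, ‖E1 x‖ ≤ 5 * C ^ 3 * (1 + |x|) ^ 3 := by
    intro x
    have h4 : |x| ≤ (1 + |x|) ^ 3 := by
      nlinarith [abs_nonneg x, pow_nonneg (abs_nonneg x) 2, pow_nonneg (abs_nonneg x) 3]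
    have h5 : C * |x| ≤ C ^ 3 * (1 + |x|) ^ 3 := by
      gcongr
      linarith
    have h6 : 0 ≤ C ^ 3 * (1 + |x|) ^ 3 := by positivity
    linarith [n1 x]
  have k2 : ∀ x, ‖E2 x + E1 x ^ 2‖ ≤ 5 * C ^ 3 * (1 + |x|) ^ 3 := by
    intro x
    have h4 : ‖E2 x + E1 x ^ 2‖ ≤ C + (C * |x|) ^ 2 := by
      refine (norm_add_le _ _).trans ?_
      rw [norm_pow]
      gcongr
      · exact n2 x
      · exact n1 x
    have h7 : |x| ^ 2 + 1 ≤ (1 + |x|) ^ 3 := by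
      nlinarith [abs_nonneg x, pow_nonneg (abs_nonneg x) 2, pow_nonneg (abs_nonneg x) 3]
    have h5 : C + (C * |x|) ^ 2 ≤ C ^ 3 * (|x| ^ 2 + 1) := by
      nlinarith [mul_le_mul_of_nonneg_right hC3 (pow_nonneg (abs_nonneg x) 2)]
    have h6 : C ^ 3 * (|x| ^ 2 + 1) ≤ C ^ 3 * (1 + |x|) ^ 3 := by gcongr
    have h8 : 0 ≤ C ^ 3 * (1 + |x|) ^ 3 := by positivity
    linarith
  have k3 : ∀ x, ‖E3 x + 3 * E1 x * E2 x + E1 x ^ 3‖ ≤ 5 * C ^ 3 * (1 + |x|) ^ 3 := by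
    intro x
    have h4 : ‖E3 x + 3 * E1 x * E2 x + E1 x ^ 3‖ ≤ C + 3 * (C * |x|) * C + (C * |x|) ^ 3 := by
      refine (norm_add₃_le).trans ?_
      rw [norm_pow, norm_mul, norm_mul]
      have : ‖(3:ℂ)‖ = 3 := by simp
      rw [this]
      gcongr
      · exact n3 x
      · exact n1 x
      · exact n2 x
      · exact n1 x
    have h7 : 1 + 3 * |x| + |x| ^ 3 ≤ (1 + |x|) ^ 3 := by
      nlinarith [abs_nonneg x, pow_nonneg (abs_nonneg x) 2, pow_nonneg (abs_nonneg x) 3]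
    have h5 : C + 3 * (C * |x|) * C + (C * |x|) ^ 3 ≤ C ^ 3 * (1 + 3 * |x| + |x| ^ 3) := by
      nlinarith [mul_le_mul_of_nonneg_right hC3 (abs_nonneg x)]
    have h6 : C ^ 3 * (1 + 3 * |x| + |x| ^ 3) ≤ C ^ 3 * (1 + |x|) ^ 3 := by gcongr
    have h8 : 0 ≤ C ^ 3 * (1 + |x|) ^ 3 := by positivity
    linarith
  have g0 := gen (fun _ => 1) k0
  simp only [one_mul] at g0
  have i0 : Integrable fun x => Complex.exp (E x) :=
    hint.mono' (by fun_prop) (ae_of_all _ g0)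
  have i1 : Integrable fun x => E1 x * Complex.exp (E x) :=
    hint.mono' (by fun_prop) (ae_of_all _ (gen _ k1))
  have i2 : Integrable fun x => (E2 x + E1 x ^ 2) * Complex.exp (E x) :=
    hint.mono' (by fun_prop) (ae_of_all _ (gen _ k2))
  have i3 : Integrable fun x => (E3 x + 3 * E1 x * E2 x + E1 x ^ 3) * Complex.exp (E x) :=
    hint.mono' (by
      have := cE.measurable
      have := cE1.measurable
      have := cE2.measurable
      refine Measurable.aestronglyMeasurable ?_
      fun_prop) (ae_of_all _ (gen _ k3))
  refine exists_real_fourier_inverse _ _ _ _ h1 h2 h3 i0 i1 i2 i3 ?_ ?_ ?_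
  · rw [← hintv]
    exact integral_mono i0.norm hint g0
  · rw [← hintv]
    exact integral_mono i3.norm hint (gen _ k3)
  · intro x
    rw [← Complex.exp_conj]
    exact congrArg _ (centredExp_neg x)

end

/-- Iterated convolution powers of a measure. -/
def convPow (m : Measure ℝ) : ℕ → Measure ℝ
  | 0 => Measure.dirac 0
  | n + 1 => Measure.conv m (convPow m n)

instance isFiniteMeasure_convPow (m : Measure ℝ) [IsFiniteMeasure m] (n : ℕ) :
    IsFiniteMeasure (convPow m n) := by
  induction n with
  | zero => exact inferInstanceAs (IsFiniteMeasure (Measure.dirac (0:ℝ)))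
  | succ n ih => exact inferInstanceAs (IsFiniteMeasure (Measure.conv m (convPow m n)))

lemma conv_apply_eq (m P : Measure ℝ) [SFinite P] {A : Set ℝ} (hA : MeasurableSet A) :
    Measure.conv m P A = ∫⁻ z, P ((fun w => z + w) ⁻¹' A) ∂m := by
  rw [← lintegral_indicator_one hA, Measure.lintegral_conv (measurable_one.indicator hA)]
  refine lintegral_congr fun z => ?_
  rw [← lintegral_indicator_one (hA.preimage (measurable_const_add z))]
  rfl

lemma convPow_univ (m : Measure ℝ) [IsFiniteMeasure m] (n : ℕ) :
    convPow m n univ = m univ ^ n := by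
  induction n with
  | zero => simp [convPow]
  | succ n ih =>
    rw [convPow, conv_apply_eq _ _ MeasurableSet.univ]
    simp [ih, pow_succ]

lemma convPow_Iio {m : Measure ℝ} [IsFiniteMeasure m] (hm : m (Iio 0) = 0) (n : ℕ) :
    convPow m n (Iio 0) = 0 := by
  induction n with
  | zero => simp [convPow]
  | succ n ih =>
    rw [convPow, conv_apply_eq _ _ measurableSet_Iio]
    refine (lintegral_congr_ae ?_).trans lintegral_zero
    have h : ∀ᵐ z ∂m, z ∉ Iio (0:ℝ) := measure_eq_zero_iff_ae_notMem.1 hm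
    filter_upwards [h] with z hz
    refine measure_mono_null (fun w hw => ?_) ih
    simp only [mem_Iio, not_lt, mem_preimage] at *
    linarith

lemma charFun_convPow (m : Measure ℝ) [IsFiniteMeasure m] (n : ℕ) (ζ : ℝ) :
    charFun (convPow m n) ζ = charFun m ζ ^ n := by
  induction n with
  | zero => simp [convPow, charFun_dirac]
  | succ n ih => rw [convPow, charFun_conv, ih, pow_succ']

lemma conv_le_of_tail_le {m P : Measure ℝ} [IsFiniteMeasure m] [IsFiniteMeasure P]
    {s₁ s₂ : ℝ} {a b : ENNReal}
    (hm : ∀ A, MeasurableSet A → A ⊆ Ici s₁ → m A ≤ a * volume A)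
    (hP : ∀ A, MeasurableSet A → A ⊆ Ici s₂ → P A ≤ b * volume A)
    {A : Set ℝ} (hA : MeasurableSet A) (hs : A ⊆ Ici (s₁ + s₂)) :
    Measure.conv m P A ≤ (a * P univ + b * m univ) * volume A := by
  have hle : ∀ z : ℝ, P ((fun w => z + w) ⁻¹' A) ≤
      P ((fun w => z + w) ⁻¹' (A ∩ {y | s₁ ≤ z})) + b * volume A := by
    intro z
    by_cases hz : s₁ ≤ z
    · have : A ∩ {y : ℝ | s₁ ≤ z} = A := by ext; simp [hz]
      rw [this]; exact le_self_add
    · refine le_add_left ?_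
      have h1 := hP _ (hA.preimage (measurable_const_add z)) (fun w hw => by
        have := hs hw
        simp only [mem_Ici] at this ⊢
        push Not at hz
        linarith)
      rwa [measure_preimage_add volume] at h1
  have hset : MeasurableSet {p : ℝ × ℝ | p.1 + p.2 ∈ A ∧ s₁ ≤ p.1} :=
    ((measurable_fst.add measurable_snd) hA).inter (measurableSet_le measurable_const measurable_fst)
  have e1 : ∫⁻ z, P ((fun w => z + w) ⁻¹' (A ∩ {y | s₁ ≤ z})) ∂m =
      ∫⁻ w, m {z | z + w ∈ A ∧ s₁ ≤ z} ∂P := by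
    have h1 := Measure.prod_apply (μ := m) (ν := P) hset
    have h2 := Measure.prod_apply_symm (μ := m) (ν := P) hset
    exact h1.symm.trans h2
  have e2 : ∀ w, m {z | z + w ∈ A ∧ s₁ ≤ z} ≤ a * volume A := by
    intro w
    have hmeas : MeasurableSet {z | z + w ∈ A ∧ s₁ ≤ z} :=
      ((measurable_add_const w) hA).inter measurableSet_Ici
    refine (hm _ hmeas fun z hz => hz.2).trans ?_
    refine mul_le_mul_right ?_ a
    calc volume {z | z + w ∈ A ∧ s₁ ≤ z} ≤ volume ((fun z => z + w) ⁻¹' A) :=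
          measure_mono fun z hz => hz.1
      _ = volume A := measure_preimage_add_right _ _ _
  rw [conv_apply_eq _ _ hA]
  calc ∫⁻ z, P ((fun w => z + w) ⁻¹' A) ∂m
      ≤ ∫⁻ z, (P ((fun w => z + w) ⁻¹' (A ∩ {y | s₁ ≤ z})) + b * volume A) ∂m :=
        lintegral_mono hle
    _ = ∫⁻ w, m {z | z + w ∈ A ∧ s₁ ≤ z} ∂P + b * volume A * m univ := by
        rw [lintegral_add_right _ measurable_const, e1, lintegral_const]
    _ ≤ ∫⁻ _, a * volume A ∂P + b * volume A * m univ := by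
        gcongr with w; exact e2 w
    _ = _ := by rw [lintegral_const]; ring

lemma convPow_tail_le {m : Measure ℝ} [IsFiniteMeasure m] {L : ℝ → ENNReal}
    (hm : ∀ s, 0 < s → ∀ A, MeasurableSet A → A ⊆ Ici s → m A ≤ L s * volume A)
    (n : ℕ) {s : ℝ} (hs : 0 < s) {A : Set ℝ} (hA : MeasurableSet A) (hAs : A ⊆ Ici s) :
    convPow m (n + 1) A ≤ (n + 1 : ℕ) * m univ ^ n * L (s / (n + 1 : ℕ)) * volume A := by
  induction n generalizing s A with
  | zero =>
    have : convPow m 1 = m := by simp [convPow, Measure.conv_dirac_zero]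
    simpa [this] using hm s hs A hA hAs
  | succ n ih =>
    have hn : (0:ℝ) < (n + 1 + 1 : ℕ) := by positivity
    have hn1 : (0:ℝ) < (n + 1 : ℕ) := by positivity
    have h2 : 0 < s * (n + 1 : ℕ) / (n + 1 + 1 : ℕ) := by positivity
    have hsum : s / (n + 1 + 1 : ℕ) + s * (n + 1 : ℕ) / (n + 1 + 1 : ℕ) = s := by
      push_cast; field_simp; ring
    have hdiv : s * (n + 1 : ℕ) / (n + 1 + 1 : ℕ) / (n + 1 : ℕ) = s / (n + 1 + 1 : ℕ) := by
      push_cast; field_simp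
    have h3 := conv_le_of_tail_le (P := convPow m (n + 1)) (hm _ (div_pos hs hn))
      (fun B hB hBs => ih h2 hB hBs) hA (by rwa [hsum])
    rw [convPow]
    refine h3.trans (le_of_eq ?_)
    rw [hdiv, convPow_univ]
    push_cast
    ring

/-- The compound Poisson law with (finite) Lévy measure `m`. -/
def compoundPoissonLaw (m : Measure ℝ) : Measure ℝ :=
  Measure.sum fun n : ℕ => ENNReal.ofReal (Real.exp (-m.real univ) / n.factorial) • convPow m n

lemma tsum_poisson_weights {a : ℝ} (ha : 0 ≤ a) :
    ∑' n : ℕ, ENNReal.ofReal (Real.exp (-a) / n.factorial) * ENNReal.ofReal a ^ n = 1 := by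
  have h : HasSum (fun n : ℕ => Real.exp (-a) / n.factorial * a ^ n) 1 := by
    have h1 := (NormedSpace.expSeries_div_hasSum_exp (𝔸 := ℝ) a).mul_left (Real.exp (-a))
    rw [← Real.exp_eq_exp_ℝ, ← Real.exp_add, neg_add_cancel, Real.exp_zero] at h1
    refine h1.congr_fun ?_
    intro n; ring
  have h0 : ∀ n : ℕ, 0 ≤ Real.exp (-a) / n.factorial * a ^ n := fun n => by positivity
  rw [← ENNReal.ofReal_one, ← h.tsum_eq, ENNReal.ofReal_tsum_of_nonneg h0 h.summable]
  refine tsum_congr fun n => ?_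
  rw [ENNReal.ofReal_mul (by positivity), ENNReal.ofReal_pow ha]

instance isProbabilityMeasure_compoundPoissonLaw (m : Measure ℝ) [IsFiniteMeasure m] :
    IsProbabilityMeasure (compoundPoissonLaw m) := by
  refine ⟨?_⟩
  rw [compoundPoissonLaw, Measure.sum_apply _ MeasurableSet.univ]
  rw [← tsum_poisson_weights (a := m.real univ) measureReal_nonneg]
  refine tsum_congr fun n => ?_
  rw [Measure.smul_apply, convPow_univ, smul_eq_mul, ofReal_measureReal]

lemma compoundPoissonLaw_Iio {m : Measure ℝ} [IsFiniteMeasure m] (hm : m (Iio 0) = 0) :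
    compoundPoissonLaw m (Iio 0) = 0 := by
  rw [compoundPoissonLaw, Measure.sum_apply _ measurableSet_Iio]
  simp [convPow_Iio hm]

lemma charFun_compoundPoissonLaw (m : Measure ℝ) [IsFiniteMeasure m] (ζ : ℝ) :
    charFun (compoundPoissonLaw m) ζ = Complex.exp (charFun m ζ - m.real univ) := by
  have hint : Integrable (fun x : ℝ => Complex.exp (((inner ℝ x ζ : ℝ) : ℂ) * Complex.I))
      (compoundPoissonLaw m) := by
    refine Integrable.mono' (integrable_const (1:ℝ)) (by fun_prop) (ae_of_all _ fun x => ?_)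
    rw [Complex.norm_exp_ofReal_mul_I]
  have h1 := hasSum_integral_measure (X := ℝ) hint
  have h2 : HasSum (fun n : ℕ => Complex.exp (-(m.real univ : ℂ)) * (charFun m ζ ^ n / n.factorial))
      (Complex.exp (-(m.real univ : ℂ)) * Complex.exp (charFun m ζ)) := by
    have := (NormedSpace.expSeries_div_hasSum_exp (𝔸 := ℂ) (charFun m ζ))
    rw [← Complex.exp_eq_exp_ℂ] at this
    exact this.mul_left _
  rw [← Complex.exp_add] at h2
  rw [show charFun m ζ - m.real univ = -(m.real univ : ℂ) + charFun m ζ by ring]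
  refine HasSum.unique (h1.congr_fun fun n => ?_) h2
  rw [integral_smul_measure, ENNReal.toReal_ofReal (by positivity)]
  change _ = _ • charFun (convPow m n) ζ
  rw [charFun_convPow, Complex.real_smul]
  push_cast
  ring

lemma exists_compoundPoisson_tail_const (C₁ : ℝ) (hC₁ : 0 < C₁) :
    ∃ K : ℝ, 0 < K ∧ ∀ (m : Measure ℝ) [IsFiniteMeasure m], m univ ≤ ENNReal.ofReal C₁ →
      ∀ L : ℝ → ENNReal,
      (∀ s, 0 < s → ∀ A, MeasurableSet A → A ⊆ Ici s → m A ≤ L s * volume A) →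
      (∀ s, 0 < s → ∀ n : ℕ, L (s / (n + 1 : ℕ)) ≤ ((n + 1 : ℕ) : ENNReal) ^ 3 * L s) →
      ∀ s, 0 < s → ∀ A, MeasurableSet A → A ⊆ Ici s →
        compoundPoissonLaw m A ≤ ENNReal.ofReal K * L s * volume A := by
  have hsum : Summable fun n : ℕ => ((n + 1 : ℕ) : ℝ) ^ 4 * C₁ ^ n / (n + 1).factorial := by
    refine Summable.of_nonneg_of_le (fun n => by positivity) (fun n => ?_)
      ((Real.summable_pow_div_factorial (Real.exp 1 * C₁)).mul_left (24 * Real.exp 1))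
    have h1 : ((n + 1 : ℕ) : ℝ) ^ 4 / (Nat.factorial 4) ≤ Real.exp ((n + 1 : ℕ) : ℝ) :=
      pow_div_factorial_le_exp _ (by positivity) 4
    have h2 : Real.exp ((n + 1 : ℕ) : ℝ) = Real.exp 1 * Real.exp 1 ^ n := by
      rw [← Real.exp_nat_mul, ← Real.exp_add]; push_cast; congr 1; ring
    rw [h2, div_le_iff₀ (by positivity)] at h1
    have h3 : (n.factorial : ℝ) ≤ (n + 1).factorial := by
      exact_mod_cast Nat.factorial_le (Nat.le_succ n)
    have h4 : (Nat.factorial 4 : ℝ) = 24 := by norm_num [Nat.factorial]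
    rw [h4] at h1
    calc ((n + 1 : ℕ) : ℝ) ^ 4 * C₁ ^ n / (n + 1).factorial
        ≤ (Real.exp 1 * Real.exp 1 ^ n * 24) * C₁ ^ n / n.factorial := by gcongr
      _ = _ := by rw [mul_pow]; ring
  have hnn : ∀ n : ℕ, 0 ≤ ((n + 1 : ℕ) : ℝ) ^ 4 * C₁ ^ n / (n + 1).factorial :=
    fun n => by positivity
  refine ⟨∑' n : ℕ, ((n + 1 : ℕ) : ℝ) ^ 4 * C₁ ^ n / (n + 1).factorial,
    hsum.tsum_pos hnn 0 (by norm_num), ?_⟩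
  intro m _ hm L hL hL3 s hs A hA hAs
  rw [compoundPoissonLaw, Measure.sum_apply _ hA, tsum_eq_zero_add' ENNReal.summable]
  have h0 : convPow m 0 A = 0 := by
    have : (0:ℝ) ∉ A := fun h => by
      have := hAs h
      simp only [mem_Ici] at this
      linarith
    simp [convPow, Measure.dirac_apply' _ hA, this]
  rw [Measure.smul_apply, h0, smul_zero, zero_add, ENNReal.ofReal_tsum_of_nonneg hnn hsum,
    mul_assoc, ← ENNReal.tsum_mul_right]
  refine ENNReal.tsum_le_tsum fun n => ?_
  rw [Measure.smul_apply, smul_eq_mul]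
  have h1 := convPow_tail_le hL n hs hA hAs
  have h2 : Real.exp (-m.real univ) / (n + 1).factorial ≤ 1 / (n + 1).factorial := by
    gcongr
    rw [Real.exp_le_one_iff]; simp [measureReal_nonneg]
  calc ENNReal.ofReal (Real.exp (-m.real univ) / (n + 1).factorial) * convPow m (n + 1) A
      ≤ ENNReal.ofReal (1 / (n + 1).factorial) *
        ((n + 1 : ℕ) * ENNReal.ofReal C₁ ^ n * (((n + 1 : ℕ) : ENNReal) ^ 3 * L s) * volume A) := by
        refine mul_le_mul' (ENNReal.ofReal_le_ofReal h2) (h1.trans ?_)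
        gcongr
        exact hL3 s hs n
    _ = _ := by
        rw [← ENNReal.ofReal_pow hC₁.le, ← ENNReal.ofReal_natCast (n + 1)]
        have e : ((n + 1 : ℕ) : ℝ) ^ 4 * C₁ ^ n / (n + 1).factorial =
          1 / (n + 1).factorial * ((n + 1 : ℕ) * (C₁ ^ n * ((n + 1 : ℕ) : ℝ) ^ 3)) := by ring
        rw [e, ENNReal.ofReal_mul (by positivity), ENNReal.ofReal_mul (by positivity),
          ENNReal.ofReal_mul (by positivity), ENNReal.ofReal_pow (p := ((n + 1 : ℕ) : ℝ)) (by positivity)]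
        ring

/-- The concentration function `r ↦ ∫ min(1, x²/r²) M(dx)`. -/
def levyH (M : Measure ℝ) (r : ℝ) : ENNReal :=
  ∫⁻ x, ENNReal.ofReal (min 1 (x ^ 2 / r ^ 2)) ∂M

lemma levyH_le_of_forall {M : Measure ℝ} {r s k : ℝ} (hk : 0 ≤ k)
    (h : ∀ x : ℝ, min 1 (x ^ 2 / r ^ 2) ≤ k * min 1 (x ^ 2 / s ^ 2)) :
    levyH M r ≤ ENNReal.ofReal k * levyH M s := by
  rw [levyH, levyH, ← lintegral_const_mul' _ _ ENNReal.ofReal_ne_top]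
  refine lintegral_mono fun x => ?_
  rw [← ENNReal.ofReal_mul hk]
  exact ENNReal.ofReal_le_ofReal (h x)

lemma levyH_div_le (M : Measure ℝ) {s k : ℝ} (hk : 1 ≤ k) :
    levyH M (s / k) ≤ ENNReal.ofReal (k ^ 2) * levyH M s := by
  refine levyH_le_of_forall (by positivity) fun x => ?_
  have h1 : x ^ 2 / (s / k) ^ 2 = k ^ 2 * (x ^ 2 / s ^ 2) := by
    rw [div_pow, div_div_eq_mul_div]; ring
  rw [h1, mul_min_of_nonneg _ _ (by positivity)]
  refine min_le_min ?_ le_rfl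
  nlinarith

lemma levyH_one_le (M : Measure ℝ) {s : ℝ} (hs : 1 ≤ s) :
    levyH M 1 ≤ ENNReal.ofReal (s ^ 2) * levyH M s := by
  have h := levyH_div_le M (s := s) hs
  rwa [div_self (by positivity)] at h

lemma levyH_anti (M : Measure ℝ) {r s : ℝ} (hr : 0 < r) (hrs : r ≤ s) :
    levyH M s ≤ levyH M r := by
  refine lintegral_mono fun x => ENNReal.ofReal_le_ofReal ?_
  refine min_le_min le_rfl ?_
  gcongr

section
variable {M : Measure ℝ} {C₁ : ℝ}

lemma measure_Ici_one_le (hM : levyH M 1 ≤ ENNReal.ofReal C₁) : M (Ici 1) ≤ ENNReal.ofReal C₁ := by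
  refine le_trans ?_ hM
  rw [← setLIntegral_one, levyH]
  refine (setLIntegral_mono' measurableSet_Ici fun x hx => ?_).trans (setLIntegral_le_lintegral _ _)
  have : (1:ℝ) ≤ min 1 (x ^ 2 / 1 ^ 2) := by
    simp only [mem_Ici] at hx
    refine le_min le_rfl ?_
    nlinarith
  rw [← ENNReal.ofReal_one]
  exact ENNReal.ofReal_le_ofReal this

lemma lintegral_sq_small_le (hM : levyH M 1 ≤ ENNReal.ofReal C₁) :
    ∫⁻ x in Ioo (0:ℝ) 1, ENNReal.ofReal (x ^ 2) ∂M ≤ ENNReal.ofReal C₁ := by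
  refine le_trans ?_ hM
  rw [levyH]
  refine (setLIntegral_mono' measurableSet_Ioo fun x hx => ?_).trans (setLIntegral_le_lintegral _ _)
  refine ENNReal.ofReal_le_ofReal (le_min ?_ (by simp))
  nlinarith [hx.1, hx.2]

lemma integrable_sq_small (hM : levyH M 1 ≤ ENNReal.ofReal C₁) :
    Integrable (fun x : ℝ => x ^ 2) (M.restrict (Ioo 0 1)) := by
  refine ⟨by fun_prop, ?_⟩
  rw [hasFiniteIntegral_iff_ofReal (ae_of_all _ fun x => sq_nonneg x)]
  exact (lintegral_sq_small_le hM).trans_lt ENNReal.ofReal_lt_top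

lemma integral_sq_small_le (hC₁ : 0 ≤ C₁) (hM : levyH M 1 ≤ ENNReal.ofReal C₁) :
    ∫ x in Ioo (0:ℝ) 1, x ^ 2 ∂M ≤ C₁ := by
  rw [integral_eq_lintegral_of_nonneg_ae (ae_of_all _ fun x => sq_nonneg x) (by fun_prop)]
  exact ENNReal.toReal_le_of_le_ofReal hC₁ (lintegral_sq_small_le hM)

lemma lk_integral_split (hsupp : M (Iic 0) = 0) (hM : levyH M 1 ≤ ENNReal.ofReal C₁) (ζ : ℝ) :
    ∫ x : ℝ, (Complex.exp (Complex.I * ζ * x) - 1 -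
        Complex.I * ζ * x * (if x < 1 then (1:ℂ) else 0)) ∂M =
      centredExp (M.restrict (Ioo 0 1)) ζ +
        (charFun (M.restrict (Ici 1)) ζ - (M.restrict (Ici 1)).real univ) := by
  have hfin : IsFiniteMeasure (M.restrict (Ici (1:ℝ))) := ⟨by
    rw [Measure.restrict_apply_univ]
    exact (measure_Ici_one_le hM).trans_lt ENNReal.ofReal_lt_top⟩
  set F : ℝ → ℂ := fun x => Complex.exp (Complex.I * ζ * x) - 1 -
        Complex.I * ζ * x * (if x < 1 then (1:ℂ) else 0)
  have hF1 : EqOn F (fun x : ℝ => Complex.exp (Complex.I * ζ * x) - 1 - Complex.I * ζ * x)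
      (Ioo (0:ℝ) 1) := fun x hx => by simp [F, hx.2]
  have hF2 : EqOn F (fun x : ℝ => Complex.exp (Complex.I * ζ * x) - 1)
      (Ici (1:ℝ)) := fun x hx => by
    simp only [mem_Ici] at hx
    simp [F, not_lt.2 hx]
  have hexp : Integrable (fun x : ℝ => Complex.exp (Complex.I * ζ * x)) (M.restrict (Ici 1)) := by
    refine Integrable.mono' (integrable_const (1:ℝ)) (by fun_prop) (ae_of_all _ fun x => ?_)
    rw [norm_cexp_I_mul]
  have hi1 : IntegrableOn F (Ioo 0 1) M := by
    refine (integrableOn_congr_fun hF1 measurableSet_Ioo).2 ?_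
    exact integrable_centred (integrable_sq_small hM) ζ
  have hi2 : IntegrableOn F (Ici 1) M := by
    refine (integrableOn_congr_fun hF2 measurableSet_Ici).2 ?_
    exact hexp.sub (integrable_const _)
  have hae : M = M.restrict (Ioo 0 1 ∪ Ici 1) := by
    rw [Ioo_union_Ici_eq_Ioi one_pos]
    refine (Measure.restrict_eq_self_of_ae_mem ?_).symm
    rw [measure_eq_zero_iff_ae_notMem] at hsupp
    filter_upwards [hsupp] with x hx
    simpa using hx
  have h3 : ∫ x, F x ∂M = ∫ x in Ioo 0 1, F x ∂M + ∫ x in Ici 1, F x ∂M := by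
    rw [← setIntegral_union ?_ measurableSet_Ici hi1 hi2, ← hae]
    exact Set.disjoint_left.2 fun x hx hx' => by
      simp only [mem_Ici] at hx'
      linarith [hx.2]
  rw [h3, setIntegral_congr_fun measurableSet_Ioo hF1, setIntegral_congr_fun measurableSet_Ici hF2]
  congr 1
  rw [integral_sub hexp (integrable_const _), charFun_apply_real, integral_const]
  congr 1
  · refine integral_congr_ae (ae_of_all _ fun x => ?_)
    dsimp only
    congr 1; ring
  · simp

end

/-- A probability measure whose characteristic function factors through an integrable kernel is
dominated by the corresponding convolution. -/
lemma le_lintegral_of_charFun_eq {P Q : Measure ℝ} [IsProbabilityMeasure P]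
    [IsProbabilityMeasure Q] {q : ℝ → ℝ} (hq : Continuous q) (hqi : Integrable q)
    (h : ∀ ζ : ℝ, charFun P ζ =
      (∫ y : ℝ, (q y : ℂ) * Complex.exp (ζ * y * Complex.I)) * charFun Q ζ)
    {A : Set ℝ} (hA : MeasurableSet A) :
    P A ≤ ∫⁻ y in A, ∫⁻ z, ENNReal.ofReal (q (y - z)) ∂Q := by
  set qp : Measure ℝ := volume.withDensity fun y => ENNReal.ofReal (q y)
  set qm : Measure ℝ := volume.withDensity fun y => ENNReal.ofReal (-q y)
  have : IsFiniteMeasure qp := isFiniteMeasure_withDensity_ofReal hqi.2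
  have : IsFiniteMeasure qm := isFiniteMeasure_withDensity_ofReal hqi.neg.2
  have hexp : ∀ ζ : ℝ, Integrable
      (fun y : ℝ => (q y : ℂ) * Complex.exp (ζ * y * Complex.I)) := fun ζ => by
    refine hqi.norm.mono' (by fun_prop) (ae_of_all _ fun y => ?_)
    rw [norm_mul, ← Complex.ofReal_mul, Complex.norm_exp_ofReal_mul_I]
    simp
  have hpm : ∀ (r : ℝ → ℝ) (_ : Continuous r) (ζ : ℝ),
      charFun (volume.withDensity fun y => ENNReal.ofReal (r y)) ζ =
      ∫ y : ℝ, ((max (r y) 0 : ℝ) : ℂ) * Complex.exp (ζ * y * Complex.I) := by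
    intro r hr ζ
    rw [charFun_apply_real, integral_withDensity_eq_integral_toReal_smul (by fun_prop)
      (ae_of_all _ fun _ => ENNReal.ofReal_lt_top)]
    refine integral_congr_ae (ae_of_all _ fun y => ?_)
    simp [ENNReal.toReal_ofReal', Complex.real_smul]
  have hint : ∀ (r : ℝ → ℝ) (_ : Continuous r) (_ : Integrable r) (ζ : ℝ),
      Integrable fun y : ℝ => ((max (r y) 0 : ℝ) : ℂ) * Complex.exp (ζ * y * Complex.I) := by
    intro r hr hri ζ
    refine hri.norm.mono' (by fun_prop) (ae_of_all _ fun y => ?_)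
    rw [norm_mul, ← Complex.ofReal_mul, Complex.norm_exp_ofReal_mul_I, mul_one, Complex.norm_real,
      Real.norm_eq_abs, Real.norm_eq_abs, abs_of_nonneg (le_max_right _ _)]
    exact max_le (le_abs_self _) (abs_nonneg _)
  have hdiff : ∀ ζ : ℝ, charFun qp ζ =
      (∫ y : ℝ, (q y : ℂ) * Complex.exp (ζ * y * Complex.I)) + charFun qm ζ := by
    intro ζ
    rw [hpm q hq ζ, hpm (fun y => -q y) hq.neg ζ, ← integral_add (hexp ζ)
      (hint (fun y => -q y) hq.neg hqi.neg ζ)]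
    refine integral_congr_ae (ae_of_all _ fun y => ?_)
    dsimp only
    rw [← add_mul, ← Complex.ofReal_add]
    congr 2
    rcases le_total (q y) 0 with h' | h'
    · rw [max_eq_right h', max_eq_left (by linarith)]; ring
    · rw [max_eq_left h', max_eq_right (by linarith)]; ring
  have key : P + Measure.conv Q qm = Measure.conv Q qp := by
    refine Measure.ext_of_charFun (funext fun ζ => ?_)
    rw [charFun_conv, hdiff, mul_add, ← charFun_conv, mul_comm, ← h]
    rw [charFun_apply_real, charFun_apply_real, charFun_apply_real, integral_add_measure] <;>
    · refine Integrable.mono' (integrable_const (1:ℝ)) (by fun_prop) (ae_of_all _ fun x => ?_)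
      rw [← Complex.ofReal_mul, Complex.norm_exp_ofReal_mul_I]
  have hle : P A ≤ Measure.conv Q qp A := by
    rw [← key]; simp
  refine hle.trans (le_of_eq ?_)
  rw [conv_apply_eq _ _ hA]
  have hmeas : Measurable fun p : ℝ × ℝ => ENNReal.ofReal (q (p.1 - p.2)) := by fun_prop
  calc ∫⁻ z, qp ((fun w => z + w) ⁻¹' A) ∂Q
      = ∫⁻ z, (∫⁻ y in A, ENNReal.ofReal (q (y - z))) ∂Q := by
        refine lintegral_congr fun z => ?_
        rw [withDensity_apply _ (hA.preimage (measurable_const_add z)),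
          ← lintegral_indicator (hA.preimage (measurable_const_add z)),
          ← lintegral_indicator hA,
          ← lintegral_add_left_eq_self (μ := volume)
            (A.indicator fun y => ENNReal.ofReal (q (y - z))) z]
        refine lintegral_congr fun y => ?_
        simp only [indicator, add_sub_cancel_left]
        rfl
    _ = ∫⁻ y in A, ∫⁻ z, ENNReal.ofReal (q (y - z)) ∂Q := by
        rw [lintegral_lintegral_swap]
        exact (hmeas.comp measurable_swap).aemeasurable

lemma lintegral_kernel_le {Q : Measure ℝ} [IsProbabilityMeasure Q] (hQ : Q (Iio 0) = 0)
    {q : ℝ → ℝ} (hqi : Integrable q) {B J : ℝ} (h3 : ∀ y, |y| ^ 3 * |q y| ≤ B)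
    (hJ : ∫ y, |q y| ≤ J) {y : ℝ} (hy : y ≠ 0) {a : ENNReal}
    (ha : ∀ A, MeasurableSet A → A ⊆ Ici (|y| / 2) → Q A ≤ a * volume A) :
    ∫⁻ z, ENNReal.ofReal (q (y - z)) ∂Q ≤
      ENNReal.ofReal (8 * B / |y| ^ 3) + a * ENNReal.ofReal J := by
  have hy0 : 0 < |y| := abs_pos.2 hy
  have hQ' : ∀ᵐ z ∂Q, z ∉ Iio (0:ℝ) := measure_eq_zero_iff_ae_notMem.1 hQ
  have hres : Q.restrict (Ici (|y| / 2)) ≤ a • volume := by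
    refine Measure.le_iff.2 fun A hA => ?_
    rw [Measure.restrict_apply hA, Measure.smul_apply, smul_eq_mul]
    refine (ha _ (hA.inter measurableSet_Ici) inter_subset_right).trans ?_
    gcongr
    exact inter_subset_left
  have hbd : ∀ᵐ z ∂Q, ENNReal.ofReal (q (y - z)) ≤ ENNReal.ofReal (8 * B / |y| ^ 3) +
      (Ici (|y| / 2)).indicator (fun z => ENNReal.ofReal |q (y - z)|) z := by
    filter_upwards [hQ'] with z hz
    simp only [mem_Iio, not_lt] at hz
    by_cases hzy : |y| / 2 ≤ z
    · refine le_add_left ?_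
      rw [indicator_of_mem (by exact hzy)]
      exact ENNReal.ofReal_le_ofReal (le_abs_self _)
    · refine le_add_right (ENNReal.ofReal_le_ofReal ?_)
      push Not at hzy
      have h1 : |y| / 2 ≤ |y - z| := by
        have := abs_sub_abs_le_abs_sub y z
        rw [abs_of_nonneg hz] at this
        linarith
      rw [le_div_iff₀ (by positivity)]
      have h2 : (|y| / 2) ^ 3 ≤ |y - z| ^ 3 := by gcongr
      have h4 := h3 (y - z)
      have h5 := mul_le_mul_of_nonneg_right h2 (abs_nonneg (q (y - z)))
      have h6 : q (y - z) * |y| ^ 3 ≤ |q (y - z)| * |y| ^ 3 := by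
        gcongr; exact le_abs_self _
      nlinarith
  calc ∫⁻ z, ENNReal.ofReal (q (y - z)) ∂Q
      ≤ ∫⁻ z, (ENNReal.ofReal (8 * B / |y| ^ 3) +
        (Ici (|y| / 2)).indicator (fun z => ENNReal.ofReal |q (y - z)|) z) ∂Q :=
        lintegral_mono_ae hbd
    _ = ENNReal.ofReal (8 * B / |y| ^ 3) +
        ∫⁻ z, ENNReal.ofReal |q (y - z)| ∂(Q.restrict (Ici (|y| / 2))) := by
        rw [lintegral_add_left measurable_const, lintegral_const, measure_univ, mul_one,
          lintegral_indicator measurableSet_Ici]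
    _ ≤ ENNReal.ofReal (8 * B / |y| ^ 3) + ∫⁻ z, ENNReal.ofReal |q (y - z)| ∂(a • volume) := by
        gcongr
    _ ≤ _ := by
        gcongr
        rw [lintegral_smul_measure, smul_eq_mul]
        gcongr
        rw [lintegral_sub_left_eq_self (fun z => ENNReal.ofReal |q z|) y,
          ← ofReal_integral_eq_lintegral_ofReal hqi.abs (ae_of_all _ fun _ => abs_nonneg _)]
        exact ENNReal.ofReal_le_ofReal hJ

/-- Uniform density bound for a normalised infinitely divisible law. -/
lemma exists_density_const {α c₁ C₁ D : ℝ} (hα : 0 < α) (hc₁ : 0 < c₁) (hC₁ : 1 ≤ C₁)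
    (hD : 0 < D) :
    ∃ C : ℝ, 0 < C ∧ ∀ (M : Measure ℝ), M (Iic 0) = 0 → levyH M 1 ≤ ENNReal.ofReal C₁ →
      (∀ s, 0 < s → ∀ A, MeasurableSet A → A ⊆ Ici s →
        M A ≤ ENNReal.ofReal (D / s) * levyH M s * volume A) →
      (∀ ζ : ℝ, 1 ≤ |ζ| → c₁ * |ζ| ^ α ≤ ∫ x in Ioo (0:ℝ) 1, (1 - Real.cos (ζ * x)) ∂M) →
      ∀ (P : Measure ℝ) [IsProbabilityMeasure P],
      (∀ ζ : ℝ, charFun P ζ = Complex.exp (∫ x : ℝ, (Complex.exp (Complex.I * ζ * x) - 1 -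
        Complex.I * ζ * x * (if x < 1 then (1:ℂ) else 0)) ∂M)) →
      P ≤ volume.withDensity fun y => min (ENNReal.ofReal C)
        (ENNReal.ofReal C * (ENNReal.ofReal |y|⁻¹ * levyH M |y|)) := by
  obtain ⟨K, hK0, hK⟩ := cube_mul_exp_neg_rpow_le hα hc₁
  obtain ⟨K', hK'0, hK'⟩ := exists_compoundPoisson_tail_const C₁ (by linarith)
  set B := 5 * C₁ ^ 3 * Real.exp c₁ * K * π with hB
  have hB0 : 0 < B := by positivity
  set C := B + 8 * B / c₁ + K' * (8 * D) * (3 * B * π) with hC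
  refine ⟨C, by positivity, ?_⟩
  intro M hsupp hM htail hcos P _ hP
  have hfin : IsFiniteMeasure (M.restrict (Ici (1:ℝ))) := ⟨by
    rw [Measure.restrict_apply_univ]
    exact (measure_Ici_one_le hM).trans_lt ENNReal.ofReal_lt_top⟩
  set M₁ := M.restrict (Ioo 0 1)
  set M₂ := M.restrict (Ici 1)
  obtain ⟨q, hqc, hqB, hq3, hqi, hqI, hqF⟩ := exists_small_jump_density (M := M₁)
    (integrable_sq_small hM) (ae_restrict_mem measurableSet_Ioo) hc₁ hα hC₁
    (integral_sq_small_le (by linarith) hM) hcos hK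
  rw [← hB] at hqB hq3 hqI
  set Q := compoundPoissonLaw M₂
  have hQ0 : Q (Iio 0) = 0 := by
    refine compoundPoissonLaw_Iio ?_
    rw [Measure.restrict_apply measurableSet_Iio]
    refine measure_mono_null (fun x hx => ?_) hsupp
    exact mem_Iic.2 (le_of_lt (mem_Iio.1 hx.1))
  set L : ℝ → ENNReal := fun s => ENNReal.ofReal (D / s) * levyH M s with hL
  have hL3 : ∀ s, 0 < s → ∀ n : ℕ, L (s / (n + 1 : ℕ)) ≤ ((n + 1 : ℕ) : ENNReal) ^ 3 * L s := by
    intro s hs n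
    have hn : (1:ℝ) ≤ (n + 1 : ℕ) := by exact_mod_cast Nat.le_add_left 1 n
    have h1 := levyH_div_le M (s := s) hn
    have h2 : D / (s / (n + 1 : ℕ)) = (n + 1 : ℕ) * (D / s) := by
      rw [div_div_eq_mul_div]; ring
    simp only [hL]
    rw [h2, ENNReal.ofReal_mul (by positivity), ENNReal.ofReal_natCast]
    rw [ENNReal.ofReal_pow (by positivity), ENNReal.ofReal_natCast] at h1
    calc _ ≤ ((n + 1 : ℕ) : ENNReal) * ENNReal.ofReal (D / s) *
          (((n + 1 : ℕ) : ENNReal) ^ 2 * levyH M s) := by gcongr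
      _ = _ := by ring
  have hQtail := hK' M₂ (by rw [Measure.restrict_apply_univ]; exact measure_Ici_one_le hM) L
    (fun s hs A hA hAs => (Measure.restrict_apply_le _ _).trans (htail s hs A hA hAs)) hL3
  have hP' : ∀ ζ : ℝ, charFun P ζ =
      (∫ y : ℝ, (q y : ℂ) * Complex.exp (ζ * y * Complex.I)) * charFun Q ζ := by
    intro ζ
    rw [hqF, charFun_compoundPoissonLaw, hP, lk_integral_split hsupp hM, Complex.exp_add]
  have hh1 : ENNReal.ofReal c₁ ≤ levyH M 1 := by
    have h1 := hcos 1 (by simp)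
    simp only [abs_one, one_rpow, mul_one, one_mul] at h1
    refine (ENNReal.ofReal_le_ofReal h1).trans ?_
    rw [integral_eq_lintegral_of_nonneg_ae
      (ae_of_all _ fun x => sub_nonneg.2 (Real.cos_le_one _)) (by fun_prop)]
    refine ENNReal.ofReal_toReal_le.trans ?_
    refine (setLIntegral_mono' measurableSet_Ioo fun x hx => ?_).trans
      (setLIntegral_le_lintegral _ _)
    refine ENNReal.ofReal_le_ofReal (le_min ?_ ?_)
    · linarith [Real.cos_nonneg_of_neg_pi_div_two_le_of_le (x := x)
        (by linarith [hx.1, Real.pi_pos]) (by linarith [hx.2, Real.pi_gt_three])]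
    · have := Real.one_sub_sq_div_two_le_cos (x := x)
      nlinarith [sq_nonneg x]
  have hpt : ∀ y, y ≠ 0 → ∫⁻ z, ENNReal.ofReal (q (y - z)) ∂Q ≤ min (ENNReal.ofReal C)
        (ENNReal.ofReal C * (ENNReal.ofReal |y|⁻¹ * levyH M |y|)) := by
    intro y hy
    have hy0 : 0 < |y| := abs_pos.2 hy
    have hb : ∫⁻ z, ENNReal.ofReal (q (y - z)) ∂Q ≤ ENNReal.ofReal B := by
      calc _ ≤ ∫⁻ _, ENNReal.ofReal B ∂Q := lintegral_mono fun z =>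
            ENNReal.ofReal_le_ofReal ((le_abs_self _).trans (hqB _))
        _ = _ := by simp
    have hBC : B ≤ C := by
      have : 0 ≤ 8 * B / c₁ + K' * (8 * D) * (3 * B * π) := by positivity
      linarith
    refine le_min (hb.trans (ENNReal.ofReal_le_ofReal hBC)) ?_
    rcases le_total |y| 1 with h | h
    · refine hb.trans ?_
      have h1 : levyH M 1 ≤ levyH M |y| := levyH_anti M hy0 h
      have h2 : (1:ENNReal) ≤ ENNReal.ofReal |y|⁻¹ := by
        rw [← ENNReal.ofReal_one]
        exact ENNReal.ofReal_le_ofReal (by rw [one_le_inv₀ hy0]; exact h)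
      have h3 : B = (B / c₁) * c₁ := by field_simp
      have h4 : B / c₁ ≤ C := by
        have : 0 ≤ B + 7 * B / c₁ + K' * (8 * D) * (3 * B * π) := by positivity
        rw [hC]
        have e : 8 * B / c₁ = B / c₁ + 7 * B / c₁ := by ring
        linarith
      rw [h3, ENNReal.ofReal_mul (by positivity)]
      calc ENNReal.ofReal (B / c₁) * ENNReal.ofReal c₁
          ≤ ENNReal.ofReal C * (1 * levyH M |y|) := by
            rw [one_mul]
            exact mul_le_mul' (ENNReal.ofReal_le_ofReal h4) (hh1.trans h1)
        _ ≤ _ := by gcongr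
    · have h1 := lintegral_kernel_le hQ0 hqi hq3 hqI hy (hQtail (|y| / 2) (by positivity))
      refine h1.trans ?_
      have h2 : ENNReal.ofReal (8 * B / |y| ^ 3) ≤
          ENNReal.ofReal (8 * B / c₁) * (ENNReal.ofReal |y|⁻¹ * levyH M |y|) := by
        have e : 8 * B / |y| ^ 3 = 8 * B / c₁ * (|y|⁻¹ * (c₁ * (|y| ^ 2)⁻¹)) := by
          field_simp
        rw [e, ENNReal.ofReal_mul (by positivity), ENNReal.ofReal_mul (by positivity)]
        gcongr
        calc ENNReal.ofReal (c₁ * (|y| ^ 2)⁻¹) =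
            ENNReal.ofReal ((|y| ^ 2)⁻¹) * ENNReal.ofReal c₁ := by
              rw [mul_comm, ENNReal.ofReal_mul (by positivity)]
          _ ≤ ENNReal.ofReal ((|y| ^ 2)⁻¹) * (ENNReal.ofReal (|y| ^ 2) * levyH M |y|) := by
              gcongr
              exact hh1.trans (levyH_one_le M h)
          _ = levyH M |y| := by
              rw [← mul_assoc, ← ENNReal.ofReal_mul (by positivity),
                inv_mul_cancel₀ (by positivity), ENNReal.ofReal_one, one_mul]
      have h3 : ENNReal.ofReal K' * L (|y| / 2) * ENNReal.ofReal (3 * B * π) ≤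
          ENNReal.ofReal (K' * (8 * D) * (3 * B * π)) *
            (ENNReal.ofReal |y|⁻¹ * levyH M |y|) := by
        have h4 := hL3 |y| hy0 1
        norm_num at h4
        have h5 : L |y| = ENNReal.ofReal D * (ENNReal.ofReal |y|⁻¹ * levyH M |y|) := by
          simp only [hL]
          rw [div_eq_mul_inv, ENNReal.ofReal_mul hD.le, mul_assoc]
        rw [h5] at h4
        rw [← ENNReal.ofReal_ofNat 8] at h4
        calc ENNReal.ofReal K' * L (|y| / 2) * ENNReal.ofReal (3 * B * π)
            ≤ ENNReal.ofReal K' * (ENNReal.ofReal 8 *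
              (ENNReal.ofReal D * (ENNReal.ofReal |y|⁻¹ * levyH M |y|))) *
              ENNReal.ofReal (3 * B * π) := by
              gcongr
          _ = _ := by
              rw [ENNReal.ofReal_mul (p := K' * (8 * D)) (by positivity),
                ENNReal.ofReal_mul hK'0.le, ENNReal.ofReal_mul (by norm_num : (0:ℝ) ≤ 8)]
              ring
      calc _ ≤ ENNReal.ofReal (8 * B / c₁) * (ENNReal.ofReal |y|⁻¹ * levyH M |y|) +
            ENNReal.ofReal (K' * (8 * D) * (3 * B * π)) *
            (ENNReal.ofReal |y|⁻¹ * levyH M |y|) := add_le_add h2 h3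
        _ = ENNReal.ofReal (8 * B / c₁ + K' * (8 * D) * (3 * B * π)) *
            (ENNReal.ofReal |y|⁻¹ * levyH M |y|) := by
            rw [ENNReal.ofReal_add (by positivity) (by positivity), add_mul]
        _ ≤ _ := by
            gcongr
            rw [hC, add_assoc]
            linarith
  refine Measure.le_iff.2 fun A hA => ?_
  rw [withDensity_apply _ hA]
  refine (le_lintegral_of_charFun_eq hqc hqi hP' hA).trans ?_
  refine lintegral_mono_ae (ae_restrict_of_ae ?_)
  have h0 : ∀ᵐ y : ℝ, y ≠ 0 := by simp [ae_iff]
  filter_upwards [h0] with y hy using hpt y hy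

/-- The function `s ↦ ∫ min(1, s²x²) N(dx)`. -/
def levyV (N : Measure ℝ) (s : ℝ) : ℝ := (levyH N s⁻¹).toReal

section
variable {N : Measure ℝ}

lemma levyH_ne_top (hN : levyH N 1 ≠ ⊤) {r : ℝ} (hr : 0 < r) : levyH N r ≠ ⊤ := by
  rcases le_total 1 r with h | h
  · exact ne_top_of_le_ne_top hN (levyH_anti N one_pos h)
  · have h1 := levyH_div_le N (s := 1) (k := 1 / r) (by rw [le_div_iff₀ hr]; linarith)
    rw [one_div_one_div] at h1
    exact ne_top_of_le_ne_top (ENNReal.mul_ne_top ENNReal.ofReal_ne_top hN) h1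

lemma ofReal_levyV (hN : levyH N 1 ≠ ⊤) {s : ℝ} (hs : 0 < s) :
    ENNReal.ofReal (levyV N s) = levyH N s⁻¹ :=
  ENNReal.ofReal_toReal (levyH_ne_top hN (inv_pos.2 hs))

lemma levyV_nonneg (s : ℝ) : 0 ≤ levyV N s := ENNReal.toReal_nonneg

lemma levyV_mono (hN : levyH N 1 ≠ ⊤) {s s' : ℝ} (hs : 0 < s) (hss : s ≤ s') :
    levyV N s ≤ levyV N s' := by
  have hs' : 0 < s' := hs.trans_le hss
  refine ENNReal.toReal_mono (levyH_ne_top hN (inv_pos.2 hs')) (levyH_anti N (inv_pos.2 hs') ?_)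
  gcongr

lemma levyV_mul_le (hN : levyH N 1 ≠ ⊤) {s k : ℝ} (hs : 0 < s) (hk : 1 ≤ k) :
    levyV N (k * s) ≤ k ^ 2 * levyV N s := by
  have h := levyH_div_le N (s := s⁻¹) hk
  rw [show s⁻¹ / k = (k * s)⁻¹ by rw [mul_inv]; ring, ← ofReal_levyV hN hs,
    ← ofReal_levyV hN (by positivity), ← ENNReal.ofReal_mul (by positivity)] at h
  exact (ENNReal.ofReal_le_ofReal_iff (mul_nonneg (by positivity) (levyV_nonneg s))).1 h

lemma tendsto_levyV_zero (hN : levyH N 1 ≠ ⊤) :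
    Tendsto (levyV N) (nhdsWithin 0 (Ioi 0)) (nhds 0) := by
  have h : Tendsto (fun s => levyH N s⁻¹) (nhdsWithin 0 (Ioi 0)) (nhds (∫⁻ _, 0 ∂N)) := by
    refine tendsto_lintegral_filter_of_dominated_convergence
      (fun x => ENNReal.ofReal (min 1 (x ^ 2 / 1 ^ 2))) ?_ ?_ hN ?_
    · exact Eventually.of_forall fun s => by fun_prop
    · filter_upwards [Ioo_mem_nhdsGT (zero_lt_one' ℝ)] with s hs
      refine ae_of_all _ fun x => ENNReal.ofReal_le_ofReal (min_le_min le_rfl ?_)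
      have := (one_le_inv₀ hs.1).2 hs.2.le
      gcongr
    · refine ae_of_all _ fun x => ?_
      have hc : Continuous fun s : ℝ => ENNReal.ofReal (min 1 (x ^ 2 * s ^ 2)) :=
        ENNReal.continuous_ofReal.comp (by fun_prop)
      have h0 := (hc.tendsto 0).mono_left (nhdsWithin_le_nhds (s := Ioi 0))
      simpa [div_eq_mul_inv] using h0
  rw [lintegral_zero] at h
  exact (ENNReal.tendsto_toReal ENNReal.zero_ne_top).comp h

lemma integrable_min_one_sq (hN : levyH N 1 ≠ ⊤) {s : ℝ} (hs : 0 < s) :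
    Integrable (fun x : ℝ => min 1 ((s * x) ^ 2)) N := by
  refine ⟨by fun_prop, ?_⟩
  rw [hasFiniteIntegral_iff_ofReal (ae_of_all _ fun x => by positivity)]
  have := (levyH_ne_top hN (inv_pos.2 hs)).lt_top
  refine lt_of_eq_of_lt ?_ this
  refine lintegral_congr fun x => ?_
  congr 2
  field_simp

lemma integral_min_one_sq {s : ℝ} (hs : 0 < s) :
    ∫ x : ℝ, min 1 ((s * x) ^ 2) ∂N = levyV N s := by
  rw [integral_eq_lintegral_of_nonneg_ae (ae_of_all _ fun x => by positivity) (by fun_prop), levyV,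
    levyH]
  congr 1
  refine lintegral_congr fun x => ?_
  congr 2
  field_simp

variable (hN0 : N (Iic 0) = 0)
include hN0

lemma ae_pos_of_Iic : ∀ᵐ x ∂N, 0 < x := by
  filter_upwards [measure_eq_zero_iff_ae_notMem.1 hN0] with x hx
  simpa using hx

lemma integrable_of_le_min (hN : levyH N 1 ≠ ⊤) {s k : ℝ} (hs : 0 < s) {f : ℝ → ℝ}
    (hf : AEStronglyMeasurable f N) (hle : ∀ x, 0 < x → |f x| ≤ k * min 1 ((s * x) ^ 2)) :
    Integrable f N :=
  ((integrable_min_one_sq hN hs).const_mul k).mono' hf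
    ((ae_pos_of_Iic hN0).mono fun x hx => hle x hx)

lemma integral_le_levyV (hN : levyH N 1 ≠ ⊤) {s k : ℝ} (hs : 0 < s) {f : ℝ → ℝ}
    (hf : AEStronglyMeasurable f N) (h0 : ∀ x, 0 < x → 0 ≤ f x)
    (hle : ∀ x, 0 < x → f x ≤ k * min 1 ((s * x) ^ 2)) :
    Integrable f N ∧ ∫ x, f x ∂N ≤ k * levyV N s := by
  have hi : Integrable f N := integrable_of_le_min hN0 hN hs hf fun x hx => by
    rw [abs_of_nonneg (h0 x hx)]; exact hle x hx
  refine ⟨hi, ?_⟩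
  rw [← integral_min_one_sq hs, ← integral_const_mul]
  exact integral_mono_ae hi ((integrable_min_one_sq hN hs).const_mul k)
    ((ae_pos_of_Iic hN0).mono fun x hx => hle x hx)

end

lemma sq_mul_exp_neg_le_one {u : ℝ} (hu : 0 ≤ u) : u ^ 2 * Real.exp (-u) ≤ 1 := by
  have h1 := Real.quadratic_le_exp_of_nonneg (x := u / 2) (by positivity)
  have h2 : u ≤ Real.exp (u / 2) := by nlinarith [sq_nonneg (u - 2)]
  have h3 : Real.exp u = Real.exp (u / 2) ^ 2 := by rw [← Real.exp_nat_mul]; congr 1; push_cast; ring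
  rw [Real.exp_neg, ← div_eq_mul_inv, div_le_one (Real.exp_pos _), h3]
  gcongr

lemma sq_mul_exp_neg_le_min {u : ℝ} (hu : 0 ≤ u) : u ^ 2 * Real.exp (-u) ≤ min 1 (u ^ 2) := by
  refine le_min (sq_mul_exp_neg_le_one hu) ?_
  have : Real.exp (-u) ≤ 1 := by rw [Real.exp_le_one_iff]; linarith
  nlinarith [sq_nonneg u]

lemma one_sub_exp_neg_le_min {u : ℝ} (hu : 0 ≤ u) :
    1 - Real.exp (-u) - u * Real.exp (-u) ≤ min 1 (u ^ 2) := by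
  have h0 := Real.exp_pos (-u)
  refine le_min (by nlinarith) ?_
  have := Real.one_sub_le_exp_neg u
  nlinarith

lemma min_le_one_sub_exp_neg {u : ℝ} (hu : 0 ≤ u) :
    min 1 (u ^ 2) ≤ 6 * (1 - Real.exp (-u) - u * Real.exp (-u)) := by
  have h1 := Real.quadratic_le_exp_of_nonneg hu
  have h0 := Real.exp_pos (-u)
  have h2 : Real.exp (-u) * Real.exp u = 1 := by rw [← Real.exp_add]; simp
  rcases le_total u 1 with h | h
  · refine (min_le_right _ _).trans ?_
    have h3 : Real.exp (-1) ≤ Real.exp (-u) := Real.exp_le_exp.2 (by linarith)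
    have h4 : 1 / 3 ≤ Real.exp (-1) := by
      rw [Real.exp_neg, one_div]
      exact inv_anti₀ (Real.exp_pos 1) Real.exp_one_lt_three.le
    have h5 : Real.exp (-u) * (u ^ 2 / 2) ≤ Real.exp (-u) * (Real.exp u - 1 - u) := by
      gcongr; linarith
    nlinarith [sq_nonneg u]
  · refine (min_le_left _ _).trans ?_
    have h3 : Real.exp (-u) * (1 + u + u ^ 2 / 2) ≤ 1 :=
      (mul_le_mul_of_nonneg_left h1 h0.le).trans h2.le
    nlinarith

section
variable {N : Measure ℝ} (hN0 : N (Iic 0) = 0) (hN : levyH N 1 ≠ ⊤)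
include hN0 hN

lemma integrable_sq_mul_exp {s : ℝ} (hs : 0 < s) :
    Integrable (fun x : ℝ => x ^ 2 * Real.exp (-(s * x))) N := by
  refine integrable_of_le_min hN0 hN hs (k := (s ^ 2)⁻¹) (by fun_prop) fun x hx => ?_
  have h := sq_mul_exp_neg_le_min (u := s * x) (by positivity)
  rw [abs_of_nonneg (by positivity)]
  calc x ^ 2 * Real.exp (-(s * x)) = (s ^ 2)⁻¹ * ((s * x) ^ 2 * Real.exp (-(s * x))) := by
        field_simp
    _ ≤ _ := by gcongr

lemma sq_mul_integral_le_levyV {s : ℝ} (hs : 0 < s) :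
    s ^ 2 * ∫ x, x ^ 2 * Real.exp (-(s * x)) ∂N ≤ levyV N s := by
  rw [← integral_const_mul]
  have h := (integral_le_levyV hN0 hN hs (k := 1)
    (f := fun x => s ^ 2 * (x ^ 2 * Real.exp (-(s * x)))) (by fun_prop)
    (fun x hx => by positivity) (fun x hx => ?_)).2
  · simpa using h
  · have h := sq_mul_exp_neg_le_min (u := s * x) (by positivity)
    rw [one_mul]
    refine le_trans (le_of_eq ?_) h
    ring

lemma integral_W_bounds {s : ℝ} (hs : 0 < s) :
    ∫ x, (1 - Real.exp (-(s * x)) - s * x * Real.exp (-(s * x))) ∂N ≤ levyV N s ∧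
    levyV N s ≤ 6 * ∫ x, (1 - Real.exp (-(s * x)) - s * x * Real.exp (-(s * x))) ∂N := by
  have h := integral_le_levyV hN0 hN hs (k := 1)
    (f := fun x => 1 - Real.exp (-(s * x)) - s * x * Real.exp (-(s * x))) (by fun_prop)
    (fun x hx => by
      have h1 := min_le_one_sub_exp_neg (u := s * x) (by positivity)
      have h2 : 0 ≤ min 1 ((s * x) ^ 2) := by positivity
      linarith) (fun x hx => by
      rw [one_mul]; exact one_sub_exp_neg_le_min (by positivity))
  refine ⟨by simpa using h.2, ?_⟩
  rw [← integral_min_one_sq hs, ← integral_const_mul]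
  exact integral_mono_ae (integrable_min_one_sq hN hs) (h.1.const_mul 6)
    ((ae_pos_of_Iic hN0).mono fun x hx => min_le_one_sub_exp_neg (by positivity))

lemma integrable_one_sub_cos (ξ : ℝ) : Integrable (fun x => 1 - Real.cos (ξ * x)) N := by
  refine integrable_of_le_min hN0 hN one_pos (k := 2 + ξ ^ 2) (by fun_prop) fun x hx => ?_
  have h1 := Real.one_sub_sq_div_two_le_cos (x := ξ * x)
  have h2 := Real.neg_one_le_cos (ξ * x)
  rw [abs_of_nonneg (sub_nonneg.2 (Real.cos_le_one _)), one_mul]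
  rcases le_total 1 (x ^ 2) with h | h
  · rw [min_eq_left h]; nlinarith [sq_nonneg ξ]
  · rw [min_eq_right h]; nlinarith [sq_nonneg x, sq_nonneg (ξ * x)]

lemma integral_one_sub_cos_le {ξ : ℝ} (hξ : 0 < ξ) :
    ∫ x, (1 - Real.cos (ξ * x)) ∂N ≤ 2 * levyV N ξ := by
  refine (integral_le_levyV hN0 hN hξ (by fun_prop)
    (fun x _ => sub_nonneg.2 (Real.cos_le_one _)) (fun x hx => ?_)).2
  have h1 := Real.one_sub_sq_div_two_le_cos (x := ξ * x)
  have h2 := Real.neg_one_le_cos (ξ * x)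
  rcases le_total 1 ((ξ * x) ^ 2) with h | h
  · rw [min_eq_left h]; linarith
  · rw [min_eq_right h]; nlinarith [sq_nonneg (ξ * x)]

lemma continuous_integral_cos : Continuous fun ξ : ℝ => ∫ x, (1 - Real.cos (ξ * x)) ∂N := by
  refine continuous_iff_continuousAt.2 fun ξ₀ => ?_
  refine continuousAt_of_dominated (bound := fun x => (2 + (|ξ₀| + 1) ^ 2) * min 1 ((1 * x) ^ 2))
    (Eventually.of_forall fun ξ => by fun_prop) ?_
    ((integrable_min_one_sq hN one_pos).const_mul _) (ae_of_all _ fun x => by fun_prop)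
  filter_upwards [Metric.ball_mem_nhds ξ₀ one_pos] with ξ hξ
  refine ae_of_all _ fun x => ?_
  have hξ' : ξ ^ 2 ≤ (|ξ₀| + 1) ^ 2 := by
    rw [← sq_abs ξ]
    rw [Metric.mem_ball, Real.dist_eq] at hξ
    have := abs_sub_abs_le_abs_sub ξ ξ₀
    gcongr
    linarith
  have h1 := Real.one_sub_sq_div_two_le_cos (x := ξ * x)
  have h2 := Real.neg_one_le_cos (ξ * x)
  rw [Real.norm_eq_abs, abs_of_nonneg (sub_nonneg.2 (Real.cos_le_one _)), one_mul]
  rcases le_total 1 (x ^ 2) with h | h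
  · rw [min_eq_left h]; nlinarith [sq_nonneg ξ]
  · rw [min_eq_right h]
    nlinarith [sq_nonneg x, sq_nonneg (ξ * x), mul_le_mul_of_nonneg_right hξ' (sq_nonneg x)]

end

section
variable {N : Measure ℝ} (hN0 : N (Iic 0) = 0) (hN : levyH N 1 ≠ ⊤) {d : ℝ → ℝ}
  (hd0 : ∀ x, 0 ≤ d x)
  (hd : ∀ A : Set ℝ, MeasurableSet A → A ⊆ Ioi 0 → N A = ∫⁻ x in A, ENNReal.ofReal (d x))
  {C₀ : ℝ} (hC₀ : 1 ≤ C₀) (hmono : ∀ x y : ℝ, 0 < x → x ≤ y → d y ≤ C₀ * d x)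

include hd hmono in
lemma measure_le_of_subset_Ici {s : ℝ} (hs : 0 < s) {A : Set ℝ} (hA : MeasurableSet A)
    (hAs : A ⊆ Ici s) : N A ≤ ENNReal.ofReal (C₀ * d s) * volume A := by
  rw [hd A hA (hAs.trans fun x hx => lt_of_lt_of_le hs hx), ← setLIntegral_const]
  exact setLIntegral_mono' hA fun x hx => ENNReal.ofReal_le_ofReal (hmono s x hs (hAs hx))

include hd hmono hC₀ hd0 in
lemma half_interval_measure_ge {s : ℝ} (hs : 0 < s) :
    ENNReal.ofReal (d s * s / (2 * C₀)) ≤ N (Ioo (s / 2) s) := by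
  have hC : 0 < C₀ := by linarith
  rw [hd _ measurableSet_Ioo fun x hx => lt_trans (by positivity) hx.1]
  calc ENNReal.ofReal (d s * s / (2 * C₀))
      = ∫⁻ _ in Ioo (s / 2) s, ENNReal.ofReal (d s / C₀) := by
        rw [setLIntegral_const, Real.volume_Ioo,
          ← ENNReal.ofReal_mul (div_nonneg (hd0 s) hC.le)]
        congr 1
        field_simp
        ring
    _ ≤ _ := setLIntegral_mono' measurableSet_Ioo fun x hx => ENNReal.ofReal_le_ofReal (by
        rw [div_le_iff₀ hC, mul_comm]
        exact hmono x s (lt_trans (by positivity) hx.1) hx.2.le)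

include hd hmono hC₀ hd0 in
lemma measure_le_levyH {s : ℝ} (hs : 0 < s) {A : Set ℝ} (hA : MeasurableSet A)
    (hAs : A ⊆ Ici s) : N A ≤ ENNReal.ofReal (8 * C₀ ^ 2 / s) * levyH N s * volume A := by
  refine (measure_le_of_subset_Ici hd hmono hs hA hAs).trans ?_
  gcongr
  have hC : 0 < C₀ := by linarith
  have h1 : ENNReal.ofReal (1 / 4) * N (Ioo (s / 2) s) ≤ levyH N s := by
    rw [levyH, ← setLIntegral_const]
    refine (setLIntegral_mono' measurableSet_Ioo fun x hx => ENNReal.ofReal_le_ofReal ?_).trans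
      (setLIntegral_le_lintegral _ _)
    refine le_min (by norm_num) ?_
    rw [le_div_iff₀ (by positivity)]
    nlinarith [hx.1, hx.2]
  have h2 := half_interval_measure_ge hd0 hd hC₀ hmono hs
  have e : C₀ * d s = 8 * C₀ ^ 2 / s * (1 / 4 * (d s * s / (2 * C₀))) := by
    field_simp; ring
  rw [e, ENNReal.ofReal_mul (by positivity), ENNReal.ofReal_mul (by norm_num)]
  gcongr
  exact (mul_le_mul_right h2 _).trans h1

lemma lintegral_sq_mul_exp {s : ℝ} (hs : 0 < s) :
    ∫⁻ x in Ioi (0:ℝ), ENNReal.ofReal (x ^ 2 * Real.exp (-(s * x))) =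
      ENNReal.ofReal (2 / s ^ 3) := by
  have h1 := Real.integral_rpow_mul_exp_neg_mul_Ioi (a := 3) (r := s) (by norm_num) hs
  have hG : Real.Gamma 3 = 2 := by
    have := Real.Gamma_nat_eq_factorial 2
    rw [show (3:ℝ) = ((2:ℕ):ℝ) + 1 by norm_num, this]
    norm_num [Nat.factorial]
  have e : ∀ x ∈ Ioi (0:ℝ), x ^ ((3:ℝ) - 1) * Real.exp (-(s * x)) = x ^ 2 * Real.exp (-(s * x)) := by
    intro x _
    norm_num
  rw [setIntegral_congr_fun measurableSet_Ioi e, hG] at h1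
  have h2 : (1 / s) ^ (3:ℝ) * 2 = 2 / s ^ 3 := by
    rw [show (3:ℝ) = ((3:ℕ):ℝ) by norm_num, Real.rpow_natCast]
    field_simp
  rw [h2] at h1
  have hi : IntegrableOn (fun x => x ^ 2 * Real.exp (-(s * x))) (Ioi 0) := by
    by_contra h
    rw [integral_undef h] at h1
    have : 0 < 2 / s ^ 3 := by positivity
    linarith
  rw [← h1, ofReal_integral_eq_lintegral_ofReal hi (ae_of_all _ fun x => by positivity)]

include hN0 hN hd hmono hC₀ hd0 in
lemma levyPhi_le_cos {s : ℝ} (hs : 0 < s) :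
    s ^ 2 * ∫ x, x ^ 2 * Real.exp (-(s * x)) ∂N ≤
      ((1 + 16 * C₀ ^ 2) * (π ^ 2 / 2)) * ∫ x in Ioo 0 s⁻¹, (1 - Real.cos (s * x)) ∂N := by
  have hC : 0 < C₀ := by linarith
  have hsi : 0 < s⁻¹ := inv_pos.2 hs
  set U := ∫⁻ x in Ioo (0:ℝ) s⁻¹, ENNReal.ofReal (x ^ 2) ∂N with hU
  have hU1 : ENNReal.ofReal (d s⁻¹ * (s⁻¹) ^ 3 / (8 * C₀)) ≤ U := by
    have h2 := half_interval_measure_ge hd0 hd hC₀ hmono hsi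
    calc ENNReal.ofReal (d s⁻¹ * (s⁻¹) ^ 3 / (8 * C₀))
        = ENNReal.ofReal ((s⁻¹) ^ 2 / 4) * ENNReal.ofReal (d s⁻¹ * s⁻¹ / (2 * C₀)) := by
          rw [← ENNReal.ofReal_mul (by positivity)]; congr 1; field_simp; ring
      _ ≤ ENNReal.ofReal ((s⁻¹) ^ 2 / 4) * N (Ioo (s⁻¹ / 2) s⁻¹) := by gcongr
      _ = ∫⁻ _ in Ioo (s⁻¹ / 2) s⁻¹, ENNReal.ofReal ((s⁻¹) ^ 2 / 4) ∂N := by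
          rw [setLIntegral_const]
      _ ≤ ∫⁻ x in Ioo (s⁻¹ / 2) s⁻¹, ENNReal.ofReal (x ^ 2) ∂N :=
          setLIntegral_mono' measurableSet_Ioo fun x hx => ENNReal.ofReal_le_ofReal (by
            nlinarith [hx.1])
      _ ≤ U := lintegral_mono_set (Ioo_subset_Ioo_left (by positivity))
  have htail : ∫⁻ x in Ici s⁻¹, ENNReal.ofReal (x ^ 2 * Real.exp (-(s * x))) ∂N ≤
      ENNReal.ofReal (16 * C₀ ^ 2) * U := by
    have hres : N.restrict (Ici s⁻¹) ≤ ENNReal.ofReal (C₀ * d s⁻¹) • volume.restrict (Ioi 0) := by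
      refine Measure.le_iff.2 fun A hA => ?_
      rw [Measure.restrict_apply hA, Measure.smul_apply, smul_eq_mul, Measure.restrict_apply hA]
      refine (measure_le_of_subset_Ici hd hmono hsi (hA.inter measurableSet_Ici)
        inter_subset_right).trans ?_
      gcongr
    calc _ ≤ ∫⁻ x, ENNReal.ofReal (x ^ 2 * Real.exp (-(s * x)))
          ∂(ENNReal.ofReal (C₀ * d s⁻¹) • volume.restrict (Ioi 0)) := lintegral_mono' hres le_rfl
      _ = ENNReal.ofReal (C₀ * d s⁻¹) * ENNReal.ofReal (2 / s ^ 3) := by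
          rw [lintegral_smul_measure, lintegral_sq_mul_exp hs, smul_eq_mul]
      _ = ENNReal.ofReal (16 * C₀ ^ 2) * ENNReal.ofReal (d s⁻¹ * (s⁻¹) ^ 3 / (8 * C₀)) := by
          rw [← ENNReal.ofReal_mul (mul_nonneg hC.le (hd0 _)), ← ENNReal.ofReal_mul (by positivity)]
          congr 1
          field_simp
          ring
      _ ≤ _ := by gcongr
  have hhead : ∫⁻ x in Ioo (0:ℝ) s⁻¹, ENNReal.ofReal (x ^ 2 * Real.exp (-(s * x))) ∂N ≤ U :=
    setLIntegral_mono' measurableSet_Ioo fun x hx => ENNReal.ofReal_le_ofReal (by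
      have : Real.exp (-(s * x)) ≤ 1 := by
        rw [Real.exp_le_one_iff]
        nlinarith [hx.1]
      nlinarith [sq_nonneg x])
  have hae : N = N.restrict (Ioo 0 s⁻¹ ∪ Ici s⁻¹) := by
    rw [Ioo_union_Ici_eq_Ioi hsi]
    exact (Measure.restrict_eq_self_of_ae_mem (ae_pos_of_Iic hN0)).symm
  have hall : ∫⁻ x, ENNReal.ofReal (x ^ 2 * Real.exp (-(s * x))) ∂N ≤
      ENNReal.ofReal (1 + 16 * C₀ ^ 2) * U := by
    rw [hae]
    refine (lintegral_union_le _ _ _).trans ?_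
    rw [ENNReal.ofReal_add (by norm_num) (by positivity), ENNReal.ofReal_one, add_mul, one_mul]
    exact add_le_add hhead htail
  have hcosi : IntegrableOn (fun x => 1 - Real.cos (s * x)) (Ioo 0 s⁻¹) N :=
    (integrable_one_sub_cos hN0 hN s).integrableOn
  have hUcos : U ≤ ENNReal.ofReal (π ^ 2 / 2 * (s ^ 2)⁻¹) *
      ENNReal.ofReal (∫ x in Ioo 0 s⁻¹, (1 - Real.cos (s * x)) ∂N) := by
    rw [ofReal_integral_eq_lintegral_ofReal hcosi
      (ae_of_all _ fun x => sub_nonneg.2 (Real.cos_le_one _)),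
      ← lintegral_const_mul' _ _ ENNReal.ofReal_ne_top]
    refine setLIntegral_mono' measurableSet_Ioo fun x hx => ?_
    rw [← ENNReal.ofReal_mul (by positivity)]
    refine ENNReal.ofReal_le_ofReal ?_
    have hsx : s * x ≤ 1 := by
      have := mul_le_mul_of_nonneg_left hx.2.le hs.le
      rwa [mul_inv_cancel₀ hs.ne'] at this
    have h1 := Real.cos_le_one_sub_mul_cos_sq (x := s * x) (by
      rw [abs_of_nonneg (mul_nonneg hs.le hx.1.le)]
      linarith [Real.pi_gt_three])
    have hpi : 0 < π := Real.pi_pos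
    have h2 : 2 / π ^ 2 * (s * x) ^ 2 ≤ 1 - Real.cos (s * x) := by linarith
    calc x ^ 2 = π ^ 2 / 2 * (s ^ 2)⁻¹ * (2 / π ^ 2 * (s * x) ^ 2) := by field_simp
      _ ≤ _ := by gcongr
  have hfin := (integrable_sq_mul_exp hN0 hN hs)
  have hnn : 0 ≤ ∫ x in Ioo 0 s⁻¹, (1 - Real.cos (s * x)) ∂N :=
    integral_nonneg fun x => sub_nonneg.2 (Real.cos_le_one _)
  have h3 : ENNReal.ofReal (∫ x, x ^ 2 * Real.exp (-(s * x)) ∂N) ≤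
      ENNReal.ofReal ((1 + 16 * C₀ ^ 2) * (π ^ 2 / 2 * (s ^ 2)⁻¹ *
        ∫ x in Ioo 0 s⁻¹, (1 - Real.cos (s * x)) ∂N)) := by
    rw [ofReal_integral_eq_lintegral_ofReal hfin (ae_of_all _ fun x => by positivity),
      ENNReal.ofReal_mul (by positivity), ENNReal.ofReal_mul (p := π ^ 2 / 2 * (s ^ 2)⁻¹)
        (by positivity)]
    exact hall.trans (by gcongr)
  rw [ENNReal.ofReal_le_ofReal_iff (by positivity)] at h3
  calc s ^ 2 * ∫ x, x ^ 2 * Real.exp (-(s * x)) ∂N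
      ≤ s ^ 2 * ((1 + 16 * C₀ ^ 2) * (π ^ 2 / 2 * (s ^ 2)⁻¹ *
        ∫ x in Ioo 0 s⁻¹, (1 - Real.cos (s * x)) ∂N)) := by gcongr
    _ = _ := by field_simp

end

/-- The function `s ↦ ∫ (1 - e^{-sx} - sx e^{-sx}) N(dx)`, which equals `s φ'(s) - φ(s)`. -/
def levyW (N : Measure ℝ) (s : ℝ) : ℝ :=
  ∫ x, (1 - Real.exp (-(s * x)) - s * x * Real.exp (-(s * x))) ∂N

lemma abs_exp_sub_one_add_le {l x : ℝ} (hl : 0 < l) (hl1 : l ≤ 1) (hx : 0 < x) :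
    |Real.exp (-(l * x)) - 1 + l * x * (if x < 1 then 1 else 0)| ≤ min 1 (x ^ 2) := by
  have hu : 0 < l * x := by positivity
  have h0 := Real.exp_pos (-(l * x))
  have h1 : Real.exp (-(l * x)) ≤ 1 := by rw [Real.exp_le_one_iff]; linarith
  have h2 := Real.one_sub_le_exp_neg (l * x)
  split_ifs with hx1
  · rw [min_eq_right (by nlinarith), abs_of_nonneg (by linarith)]
    have h3 : Real.exp (-(l * x)) * (1 + l * x) ≤ 1 := by
      have h4 := Real.add_one_le_exp (l * x)
      calc Real.exp (-(l * x)) * (1 + l * x) ≤ Real.exp (-(l * x)) * Real.exp (l * x) := by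
            gcongr; linarith
        _ = 1 := by rw [← Real.exp_add]; simp
    have h5 : l * x ≤ x := by nlinarith
    have h6 : (l * x) ^ 2 ≤ x ^ 2 := by gcongr
    nlinarith
  · rw [min_eq_left (by nlinarith), mul_zero, add_zero, abs_of_nonpos (by linarith)]
    linarith

lemma abs_sub_mul_exp_le {s l x : ℝ} (hs : 0 < s) (hl : s / 2 ≤ l) (hl' : l ≤ 2 * s) (hx : 0 < x) :
    |x * (if x < 1 then 1 else 0) - x * Real.exp (-(l * x))| ≤
      (2 * s + 2 / s) * min 1 ((1 * x) ^ 2) := by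
  have hl0 : 0 < l := by linarith
  have hu : 0 < l * x := by positivity
  have h0 := Real.exp_pos (-(l * x))
  have h1 : Real.exp (-(l * x)) ≤ 1 := by rw [Real.exp_le_one_iff]; linarith
  have h2 := Real.one_sub_le_exp_neg (l * x)
  have h7 : 0 < 2 / s := by positivity
  rw [one_mul]
  split_ifs with hx1
  · rw [min_eq_right (by nlinarith), abs_of_nonneg (by nlinarith)]
    have h5 : x - x * Real.exp (-(l * x)) ≤ l * x ^ 2 := by nlinarith
    nlinarith [sq_nonneg x]
  · rw [min_eq_left (by nlinarith), mul_zero, zero_sub, abs_neg, abs_of_nonneg (by positivity)]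
    have h3 : l * x * Real.exp (-(l * x)) ≤ 1 := by
      have h4 := Real.add_one_le_exp (l * x)
      calc l * x * Real.exp (-(l * x)) ≤ Real.exp (l * x) * Real.exp (-(l * x)) := by
            gcongr; linarith
        _ = 1 := by rw [← Real.exp_add]; simp
    have h4 : s / 2 * (x * Real.exp (-(l * x))) ≤ 1 := by
      refine le_trans ?_ h3
      rw [mul_assoc]
      gcongr
    have h5 : x * Real.exp (-(l * x)) ≤ 2 / s := by
      rw [le_div_iff₀ hs]; linarith
    linarith

section
variable {N : Measure ℝ} (hN0 : N (Iic 0) = 0) (hN : levyH N 1 ≠ ⊤)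
include hN0 hN

lemma integrable_sub_mul_exp {s : ℝ} (hs : 0 < s) :
    Integrable (fun x : ℝ => x * (if x < 1 then 1 else 0) - x * Real.exp (-(s * x))) N := by
  refine integrable_of_le_min hN0 hN one_pos (Measurable.aestronglyMeasurable ?_) fun x hx =>
    abs_sub_mul_exp_le hs (by linarith) (by linarith) hx
  refine Measurable.sub (measurable_id.mul ?_) (by fun_prop)
  exact Measurable.ite measurableSet_Iio measurable_const measurable_const

lemma integrable_levyW {s : ℝ} (hs : 0 < s) :
    Integrable (fun x => 1 - Real.exp (-(s * x)) - s * x * Real.exp (-(s * x))) N := by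
  refine (integral_le_levyV hN0 hN hs (k := 1) (by fun_prop)
    (fun x hx => ?_) (fun x hx => ?_)).1
  · have h1 := min_le_one_sub_exp_neg (u := s * x) (by positivity)
    have h2 : 0 ≤ min 1 ((s * x) ^ 2) := by positivity
    linarith
  · rw [one_mul]; exact one_sub_exp_neg_le_min (by positivity)

lemma integrable_exp_sub_one_add {s : ℝ} (hs : 0 < s) :
    Integrable (fun x : ℝ => Real.exp (-(s * x)) - 1 + s * x * (if x < 1 then 1 else 0)) N := by
  have h := ((integrable_sub_mul_exp hN0 hN hs).const_mul s).sub (integrable_levyW hN0 hN hs)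
  refine h.congr (ae_of_all _ fun x => ?_)
  simp only [Pi.sub_apply]
  ring

lemma hasDerivAt_integral_exp {s : ℝ} (hs : 0 < s) :
    HasDerivAt
      (fun l => ∫ x, (Real.exp (-(l * x)) - 1 + l * x * (if x < 1 then 1 else 0)) ∂N)
      (∫ x, (x * (if x < 1 then 1 else 0) - x * Real.exp (-(s * x))) ∂N) s := by
  have hb : Metric.ball s (s / 2) ∈ nhds s := Metric.ball_mem_nhds s (by positivity)
  have hball : ∀ l ∈ Metric.ball s (s / 2), s / 2 ≤ l ∧ l ≤ 2 * s := by
    intro l hl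
    rw [Metric.mem_ball, Real.dist_eq, abs_lt] at hl
    constructor <;> linarith [hl.1, hl.2]
  refine (hasDerivAt_integral_of_dominated_loc_of_deriv_le
    (F := fun l x => Real.exp (-(l * x)) - 1 + l * x * (if x < 1 then 1 else 0))
    (F' := fun l x => x * (if x < 1 then 1 else 0) - x * Real.exp (-(l * x)))
    (bound := fun x => (2 * s + 2 / s) * min 1 ((1 * x) ^ 2)) hb ?_
    (integrable_exp_sub_one_add hN0 hN hs) (integrable_sub_mul_exp hN0 hN hs).1 ?_
    ((integrable_min_one_sq hN one_pos).const_mul _) ?_).2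
  · filter_upwards [hb] with l hl
    exact (integrable_exp_sub_one_add hN0 hN (by linarith [(hball l hl).1])).1
  · filter_upwards [ae_pos_of_Iic hN0] with x hx l hl
    exact abs_sub_mul_exp_le hs (hball l hl).1 (hball l hl).2 hx
  · refine ae_of_all _ fun x l _ => ?_
    have h1 : HasDerivAt (fun l : ℝ => -(l * x)) (-x) l := by
      simpa using ((hasDerivAt_id' l).mul_const x).fun_neg
    have h2 := (h1.exp.sub_const 1).fun_add
      (((hasDerivAt_id' l).mul_const x).mul_const (if x < 1 then (1:ℝ) else 0))
    exact h2.congr_deriv (by ring)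

lemma tendsto_integral_exp_zero :
    Tendsto (fun l => ∫ x, (Real.exp (-(l * x)) - 1 + l * x * (if x < 1 then 1 else 0)) ∂N)
      (nhdsWithin 0 (Ioi 0)) (nhds 0) := by
  have hI : ∀ᶠ l : ℝ in nhdsWithin 0 (Ioi 0), l ∈ Ioc (0:ℝ) 1 :=
    Ioc_mem_nhdsGT (zero_lt_one' ℝ)
  have h := tendsto_integral_filter_of_dominated_convergence (μ := N)
    (l := nhdsWithin (0:ℝ) (Ioi 0))
    (F := fun l x => Real.exp (-(l * x)) - 1 + l * x * (if x < 1 then 1 else 0))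
    (f := fun _ => (0:ℝ)) (fun x => min 1 ((1 * x) ^ 2)) ?_ ?_
    (integrable_min_one_sq hN one_pos) ?_
  · simpa using h
  · filter_upwards [hI] with l hl
    exact (integrable_exp_sub_one_add hN0 hN hl.1).1
  · filter_upwards [hI] with l hl
    filter_upwards [ae_pos_of_Iic hN0] with x hx
    rw [one_mul]
    exact abs_exp_sub_one_add_le hl.1 hl.2 hx
  · refine ae_of_all _ fun x => ?_
    have hc : Continuous fun l : ℝ =>
        Real.exp (-(l * x)) - 1 + l * x * (if x < 1 then 1 else 0) := by fun_prop
    have h0 := (hc.tendsto 0).mono_left (nhdsWithin_le_nhds (s := Ioi 0))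
    simpa using h0

lemma continuousOn_integral_sq_mul_exp :
    ContinuousOn (fun s => ∫ x, x ^ 2 * Real.exp (-(s * x)) ∂N) (Ioi 0) := by
  intro s hs
  have hs' : 0 < s := hs
  refine ContinuousAt.continuousWithinAt ?_
  refine continuousAt_of_dominated (bound := fun x => x ^ 2 * Real.exp (-(s / 2 * x)))
    (Eventually.of_forall fun ξ => by fun_prop) ?_
    (integrable_sq_mul_exp hN0 hN (by positivity)) (ae_of_all _ fun x => by fun_prop)
  filter_upwards [lt_mem_nhds (show s / 2 < s by linarith)] with l hl
  filter_upwards [ae_pos_of_Iic hN0] with x hx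
  rw [Real.norm_eq_abs, abs_of_nonneg (by positivity)]
  gcongr

end

/-- The data of a Laplace exponent without Gaussian part and with unbounded variation. -/
structure IsLaplaceExp (N : Measure ℝ) (b : ℝ) (φ φ' φ'' : ℝ → ℝ) : Prop where
  null : N (Iic 0) = 0
  fin : levyH N 1 ≠ ⊤
  eq : ∀ l : ℝ, 0 < l → φ l = -(b * l) +
    ∫ x, (Real.exp (-(l * x)) - 1 + l * x * (if x < 1 then 1 else 0)) ∂N
  hasDeriv : ∀ x : ℝ, 0 < x → HasDerivAt φ (φ' x) x
  hasDeriv2 : ∀ x : ℝ, 0 < x → HasDerivAt φ' (φ'' x) x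
  eq2 : ∀ l : ℝ, 0 < l → φ'' l = ∫ x, x ^ 2 * Real.exp (-(l * x)) ∂N
  unbdd : ∫⁻ x in Ioo (0:ℝ) 1, ENNReal.ofReal x ∂N = ⊤

namespace IsLaplaceExp
variable {N : Measure ℝ} {b : ℝ} {φ φ' φ'' : ℝ → ℝ} (h : IsLaplaceExp N b φ φ' φ'')
include h

lemma deriv_eq {s : ℝ} (hs : 0 < s) :
    φ' s = -b + ∫ x, (x * (if x < 1 then 1 else 0) - x * Real.exp (-(s * x))) ∂N := by
  have h1 : HasDerivAt (fun l : ℝ => -(b * l)) (-b) s := by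
    simpa using ((hasDerivAt_id' s).const_mul b).fun_neg
  refine (h.hasDeriv s hs).unique ((h1.add (hasDerivAt_integral_exp h.null h.fin hs)).congr_of_eventuallyEq ?_)
  filter_upwards [lt_mem_nhds hs] with l hl
  exact h.eq l hl

lemma mul_deriv_sub {s : ℝ} (hs : 0 < s) : s * φ' s - φ s = levyW N s := by
  rw [h.deriv_eq hs, h.eq s hs, mul_add, ← integral_const_mul]
  have h1 := integral_sub ((integrable_sub_mul_exp h.null h.fin hs).const_mul s)
    (integrable_exp_sub_one_add h.null h.fin hs)
  have h2 : levyW N s = ∫ x, (s * (x * (if x < 1 then 1 else 0) - x * Real.exp (-(s * x))) -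
      (Real.exp (-(s * x)) - 1 + s * x * (if x < 1 then 1 else 0))) ∂N :=
    integral_congr_ae (ae_of_all _ fun x => by simp only; ring)
  rw [h2, h1]
  ring

lemma deriv2_antitone {s m : ℝ} (hs : 0 < s) (hm : s ≤ m) : φ'' m ≤ φ'' s := by
  rw [h.eq2 s hs, h.eq2 m (hs.trans_le hm)]
  refine integral_mono_ae (integrable_sq_mul_exp h.null h.fin (hs.trans_le hm))
    (integrable_sq_mul_exp h.null h.fin hs) ?_
  filter_upwards [ae_pos_of_Iic h.null] with x hx
  gcongr

lemma deriv2_pos {s : ℝ} (hs : 0 < s) : 0 < φ'' s := by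
  rw [h.eq2 s hs, integral_pos_iff_support_of_nonneg (fun x => by positivity)
    (integrable_sq_mul_exp h.null h.fin hs)]
  rw [pos_iff_ne_zero]
  intro h0
  have h1 : N (Ioo 0 1) = 0 := by
    refine measure_mono_null (fun x hx => ?_) h0
    have := hx.1
    rw [Function.mem_support]
    positivity
  have h2 := h.unbdd
  rw [Measure.restrict_eq_zero.2 h1] at h2
  simp at h2

lemma bigPhi_pos {s : ℝ} (hs : 0 < s) : 0 < bigPhi φ'' s :=
  mul_pos (by positivity) (h.deriv2_pos hs)

lemma bigPhi_le_levyV {s : ℝ} (hs : 0 < s) : bigPhi φ'' s ≤ levyV N s := by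
  rw [bigPhi, h.eq2 s hs]
  exact sq_mul_integral_le_levyV h.null h.fin hs

lemma continuousOn_bigPhi : ContinuousOn (bigPhi φ'') (Ioi 0) := by
  have h1 := (continuousOn_integral_sq_mul_exp h.null h.fin)
  refine ContinuousOn.congr (f := fun s => s ^ 2 * ∫ x, x ^ 2 * Real.exp (-(s * x)) ∂N)
    ((continuousOn_pow 2).mul h1) fun s hs => ?_
  rw [bigPhi, h.eq2 s hs]

lemma levyW_le {s : ℝ} (hs : 0 < s) : levyW N s ≤ levyV N s :=
  (integral_W_bounds h.null h.fin hs).1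

lemma levyV_le {s : ℝ} (hs : 0 < s) : levyV N s ≤ 6 * levyW N s :=
  (integral_W_bounds h.null h.fin hs).2

lemma hasDerivAt_levyW {s : ℝ} (hs : 0 < s) : HasDerivAt (levyW N) (bigPhi φ'' s / s) s := by
  have h1 := ((hasDerivAt_id s).mul (h.hasDeriv2 s hs)).sub (h.hasDeriv s hs)
  have h2 : 1 * φ' s + id s * φ'' s - φ' s = bigPhi φ'' s / s := by
    simp only [bigPhi, id]
    field_simp
    ring
  rw [h2] at h1
  refine h1.congr_of_eventuallyEq ?_
  filter_upwards [lt_mem_nhds hs] with l hl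
  exact (h.mul_deriv_sub hl).symm

lemma tendsto_zero : Tendsto φ (nhdsWithin 0 (Ioi 0)) (nhds 0) := by
  have h1 : Tendsto (fun l : ℝ => -(b * l)) (nhdsWithin 0 (Ioi 0)) (nhds 0) := by
    have : Continuous fun l : ℝ => -(b * l) := by fun_prop
    simpa using (this.tendsto 0).mono_left (nhdsWithin_le_nhds (s := Ioi 0))
  have h2 := h1.add (tendsto_integral_exp_zero h.null h.fin)
  rw [add_zero] at h2
  refine h2.congr' ?_
  filter_upwards [self_mem_nhdsWithin] with l hl
  exact (h.eq l hl).symm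

lemma exists_deriv_pos : ∃ s : ℝ, 0 < s ∧ 0 < φ' s := by
  by_contra! hneg
  set K := ∫ x, x ^ 2 * Real.exp (-(1 * x)) ∂N with hK
  have hKi := integrable_sq_mul_exp h.null h.fin one_pos
  have hind : ∀ s : ℝ, 1 ≤ s → ∫⁻ x in Ioo (0:ℝ) 1,
      ENNReal.ofReal (x * (1 - Real.exp (-(s * x)))) ∂N ≤ ENNReal.ofReal (b + K) := by
    intro s hs
    have hs0 : 0 < s := by linarith
    have h1 := hneg s hs0
    rw [h.deriv_eq hs0] at h1
    have hi := (integrable_sub_mul_exp h.null h.fin hs0).add hKi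
    have hpt : ∀ x, 0 < x → (Ioo (0:ℝ) 1).indicator (fun x => x * (1 - Real.exp (-(s * x)))) x ≤
        x * (if x < 1 then 1 else 0) - x * Real.exp (-(s * x)) + x ^ 2 * Real.exp (-(1 * x)) := by
      intro x hx
      by_cases hx1 : x < 1
      · rw [indicator_of_mem (show x ∈ Ioo (0:ℝ) 1 from ⟨hx, hx1⟩), if_pos hx1]
        have : 0 ≤ x ^ 2 * Real.exp (-(1 * x)) := by positivity
        linarith
      · rw [indicator_of_notMem (fun hh => hx1 hh.2), if_neg hx1]
        have h3 : x * Real.exp (-(s * x)) ≤ x ^ 2 * Real.exp (-(1 * x)) := by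
          gcongr
          nlinarith
        linarith
    have hpt0 : ∀ᵐ x ∂N, 0 ≤ x * (if x < 1 then 1 else 0) - x * Real.exp (-(s * x)) +
        x ^ 2 * Real.exp (-(1 * x)) := by
      filter_upwards [ae_pos_of_Iic h.null] with x hx
      refine le_trans (indicator_nonneg (fun y hy => ?_) x) (hpt x hx)
      have : Real.exp (-(s * y)) ≤ 1 := by
        rw [Real.exp_le_one_iff]; nlinarith [hy.1]
      nlinarith [hy.1]
    rw [← lintegral_indicator measurableSet_Ioo]
    calc _ ≤ ∫⁻ x, ENNReal.ofReal (x * (if x < 1 then 1 else 0) - x * Real.exp (-(s * x)) +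
          x ^ 2 * Real.exp (-(1 * x))) ∂N := by
          refine lintegral_mono_ae ?_
          filter_upwards [ae_pos_of_Iic h.null] with x hx
          refine le_trans ?_ (ENNReal.ofReal_le_ofReal (hpt x hx))
          by_cases hxm : x ∈ Ioo (0:ℝ) 1 <;> simp [hxm]
      _ = ENNReal.ofReal (∫ x, (x * (if x < 1 then 1 else 0) - x * Real.exp (-(s * x)) +
          x ^ 2 * Real.exp (-(1 * x))) ∂N) :=
          (ofReal_integral_eq_lintegral_ofReal hi hpt0).symm
      _ ≤ _ := by
          refine ENNReal.ofReal_le_ofReal ?_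
          rw [integral_add (integrable_sub_mul_exp h.null h.fin hs0) hKi]
          linarith
  have hlim : Tendsto (fun n : ℕ => ∫⁻ x in Ioo (0:ℝ) 1,
      ENNReal.ofReal (x * (1 - Real.exp (-(((n:ℝ) + 1) * x)))) ∂N) atTop
      (nhds (∫⁻ x in Ioo (0:ℝ) 1, ENNReal.ofReal x ∂N)) := by
    refine lintegral_tendsto_of_tendsto_of_monotone (fun n => by fun_prop) ?_ ?_
    · refine (ae_restrict_mem measurableSet_Ioo).mono fun x hx => ?_
      intro n m hnm
      have hx0 := hx.1
      refine ENNReal.ofReal_le_ofReal ?_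
      gcongr
    · refine (ae_restrict_mem measurableSet_Ioo).mono fun x hx => ?_
      have hx0 := hx.1
      have h1 : Tendsto (fun n : ℕ => ((n:ℝ) + 1) * x) atTop atTop :=
        (tendsto_atTop_add_const_right _ 1 tendsto_natCast_atTop_atTop).atTop_mul_const hx0
      have h2 := Real.tendsto_exp_neg_atTop_nhds_zero.comp h1
      have h3 := (h2.const_sub 1).const_mul x
      rw [sub_zero, mul_one] at h3
      exact ENNReal.tendsto_ofReal h3
  have hle := le_of_tendsto' hlim fun n => hind ((n:ℝ) + 1) (by
    have : (0:ℝ) ≤ n := Nat.cast_nonneg n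
    linarith)
  rw [h.unbdd] at hle
  exact absurd hle (by simp)

lemma deriv_mono {s m : ℝ} (hs : 0 < s) (hm : s ≤ m) : φ' s ≤ φ' m := by
  have hmono : MonotoneOn φ' (Ioi 0) := by
    refine monotoneOn_of_deriv_nonneg (convex_Ioi 0)
      (fun x hx => (h.hasDeriv2 x hx).continuousAt.continuousWithinAt)
      (fun x hx => ?_) fun x hx => ?_
    · rw [interior_Ioi] at hx
      exact (h.hasDeriv2 x hx).differentiableAt.differentiableWithinAt
    · rw [interior_Ioi] at hx
      rw [(h.hasDeriv2 x hx).deriv]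
      exact (h.deriv2_pos hx).le
  exact hmono hs (hs.trans_le hm) hm

lemma mul_deriv2_le (hpos : ∀ s, 0 < s → 0 < φ' s) {l : ℝ} (hl : 0 < l) :
    l * φ'' l ≤ φ' l := by
  have key : ∀ s ∈ Ioo 0 l, (l - s) * φ'' l ≤ φ' l := by
    intro s hs
    obtain ⟨ξ, hξ, he⟩ := exists_hasDerivAt_eq_slope φ' φ'' hs.2
      (fun x hx => (h.hasDeriv2 x (hs.1.trans_le hx.1)).continuousAt.continuousWithinAt)
      (fun x hx => h.hasDeriv2 x (hs.1.trans hx.1))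
    have h1 := h.deriv2_antitone (hs.1.trans hξ.1) hξ.2.le
    have h2 : 0 < l - s := by linarith [hs.2]
    rw [eq_div_iff h2.ne'] at he
    nlinarith [hpos s hs.1]
  have hc : Continuous fun s : ℝ => (l - s) * φ'' l := by fun_prop
  have ht := (hc.tendsto 0).mono_left (nhdsWithin_le_nhds (s := Ioi 0))
  rw [sub_zero] at ht
  exact le_of_tendsto ht (Filter.mem_of_superset (Ioo_mem_nhdsGT hl) key)

lemma levyW_le_of_pos (hpos : ∀ s, 0 < s → 0 < φ' s) {l : ℝ} (hl : 0 < l) :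
    levyW N l ≤ φ l := by
  have hd : ∀ x, 0 < x → HasDerivAt (fun x => φ x - levyW N x) (φ' x - bigPhi φ'' x / x) x :=
    fun x hx => (h.hasDeriv x hx).sub (h.hasDerivAt_levyW hx)
  have hmono : MonotoneOn (fun x => φ x - levyW N x) (Ioi 0) := by
    refine monotoneOn_of_deriv_nonneg (convex_Ioi 0)
      (fun x hx => (hd x hx).continuousAt.continuousWithinAt)
      (fun x hx => ?_) fun x hx => ?_
    · rw [interior_Ioi] at hx
      exact (hd x hx).differentiableAt.differentiableWithinAt
    · rw [interior_Ioi] at hx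
      have hx0 : 0 < x := hx
      rw [(hd x hx).deriv, bigPhi]
      have := h.mul_deriv2_le hpos hx0
      have e : x ^ 2 * φ'' x / x = x * φ'' x := by field_simp
      rw [e]
      linarith
  have ht := h.tendsto_zero.sub (tendsto_levyV_zero h.fin)
  rw [sub_zero] at ht
  have hG : (0:ℝ) ≤ φ l - levyW N l := by
    refine le_of_tendsto ht ?_
    filter_upwards [Ioo_mem_nhdsGT hl] with s hs
    refine le_trans ?_ (hmono hs.1 hl hs.2.le)
    have := h.levyW_le hs.1
    simp only
    linarith
  linarith

lemma levyW_le_abs {θ₁ x₀ : ℝ} (hθ₁ : θ₁ = sInf {s : ℝ | 0 < s ∧ 0 < φ' s})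
    (hx₀ : 0 < θ₁ → x₀ ≤ θ₁) {l : ℝ} (hl : 0 < l) (hlx : l ≤ x₀) : levyW N l ≤ |φ l| := by
  have hbdd : BddBelow {s : ℝ | 0 < s ∧ 0 < φ' s} := ⟨0, fun s hs => hs.1.le⟩
  rcases lt_or_ge 0 θ₁ with hpos | hneg
  · have hlt : ∀ s, 0 < s → s < θ₁ → φ' s ≤ 0 := by
      intro s hs hsθ
      by_contra! hc
      exact absurd (csInf_le hbdd ⟨hs, hc⟩) (by rw [← hθ₁]; linarith)
    have hle : φ' l ≤ 0 := by
      rcases (hlx.trans (hx₀ hpos)).lt_or_eq with hl' | hl'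
      · exact hlt l hl hl'
      · have ht := (h.hasDeriv2 l hl).continuousAt.tendsto.mono_left
          (nhdsWithin_le_nhds (s := Iio l))
        refine le_of_tendsto ht ?_
        filter_upwards [Ioo_mem_nhdsLT hl] with s hs
        exact hlt s hs.1 (hl' ▸ hs.2)
    have h1 := h.mul_deriv_sub hl
    have h2 := neg_le_abs (φ l)
    nlinarith
  · have hp : ∀ s, 0 < s → 0 < φ' s := by
      intro s hs
      obtain ⟨m, hm, hms⟩ := exists_lt_of_csInf_lt (s := {s : ℝ | 0 < s ∧ 0 < φ' s})
        h.exists_deriv_pos (hθ₁ ▸ hneg.trans_lt hs)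
      exact hm.2.trans_le (h.deriv_mono hm.1 hms.le)
    exact (h.levyW_le_of_pos hp hl).trans (le_abs_self _)

end IsLaplaceExp

/-- The running supremum of `F` over `(0, r]`. -/
def runSup (F : ℝ → ℝ) (r : ℝ) : ℝ := sSup (F '' Ioc (0:ℝ) r)

/-- The generalized inverse of the running supremum. -/
def runInv (F : ℝ → ℝ) (v : ℝ) : ℝ := sSup {r : ℝ | 0 < r ∧ runSup F r = v}

lemma exists_runSup_eq {F : ℝ → ℝ} (hF : ContinuousOn F (Ioi 0))
    (h0 : Tendsto F (nhdsWithin 0 (Ioi 0)) (nhds 0)) (hinf : Tendsto F atTop atTop) {v : ℝ}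
    (hv : 0 < v) : ∃ r : ℝ, 0 < r ∧ runSup F r = v := by
  obtain ⟨ε, hε, hlt⟩ := mem_nhdsGT_iff_exists_Ioo_subset.1 (h0.eventually (gt_mem_nhds hv))
  have hε0 : 0 < ε := hε
  set e := ε / 2 with he
  have he0 : 0 < e := by positivity
  have hsub : Ici e ⊆ Ioi 0 := fun x hx => he0.trans_le hx
  have hcl : IsClosed (Ici e ∩ F ⁻¹' Ici v) :=
    (hF.mono hsub).preimage_isClosed_of_isClosed isClosed_Ici isClosed_Ici
  have hne : (Ici e ∩ F ⁻¹' Ici v).Nonempty := by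
    obtain ⟨x, hx1, hx2⟩ := ((eventually_ge_atTop e).and (hinf.eventually_ge_atTop v)).exists
    exact ⟨x, hx1, hx2⟩
  have hbdd : BddBelow (Ici e ∩ F ⁻¹' Ici v) := ⟨e, fun x hx => hx.1⟩
  set r := sInf (Ici e ∩ F ⁻¹' Ici v) with hr
  have hrm : r ∈ Ici e ∩ F ⁻¹' Ici v := hcl.csInf_mem hne hbdd
  have hr0 : 0 < r := he0.trans_le hrm.1
  have hbelow : ∀ s, 0 < s → s < r → F s < v := by
    intro s hs hsr
    rcases lt_or_ge s e with h | h
    · exact hlt ⟨hs, by linarith⟩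
    · by_contra! hc
      exact absurd (csInf_le hbdd ⟨h, hc⟩) (not_le.2 hsr)
  have hle : F r ≤ v := by
    have ht := (hF.continuousAt (Ioi_mem_nhds hr0)).tendsto.mono_left
      (nhdsWithin_le_nhds (s := Iio r))
    refine le_of_tendsto ht ?_
    filter_upwards [Ioo_mem_nhdsLT hr0] with s hs
    exact (hbelow s hs.1 hs.2).le
  refine ⟨r, hr0, IsGreatest.csSup_eq ⟨⟨r, ⟨hr0, le_rfl⟩, le_antisymm hle hrm.2⟩, ?_⟩⟩
  rintro _ ⟨s, hs, rfl⟩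
  rcases hs.2.lt_or_eq with h | h
  · exact (hbelow s hs.1 h).le
  · exact h ▸ hle

/-- A continuous function on the half-line controlled by a monotone one that vanishes at `0`. -/
structure Controlled (V F : ℝ → ℝ) (k : ℝ) : Prop where
  cont : ContinuousOn F (Ioi 0)
  nonneg : ∀ s, 0 < s → 0 ≤ F s
  le : ∀ s, 0 < s → F s ≤ k * V s
  mono : ∀ s s', 0 < s → s ≤ s' → V s ≤ V s'
  zero : Tendsto V (nhdsWithin 0 (Ioi 0)) (nhds 0)
  pos : 0 ≤ k

namespace Controlled
variable {V F : ℝ → ℝ} {k : ℝ} (h : Controlled V F k)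
include h

lemma le_of_le {s r : ℝ} (hs : 0 < s) (hr : s ≤ r) : F s ≤ k * V r :=
  (h.le s hs).trans (mul_le_mul_of_nonneg_left (h.mono s r hs hr) h.pos)

lemma bddAbove (r : ℝ) : BddAbove (F '' Ioc (0:ℝ) r) := by
  refine ⟨k * V r, ?_⟩
  rintro _ ⟨s, hs, rfl⟩
  exact h.le_of_le hs.1 hs.2

lemma le_runSup {s r : ℝ} (hs : 0 < s) (hr : s ≤ r) : F s ≤ runSup F r :=
  le_csSup (h.bddAbove r) ⟨s, ⟨hs, hr⟩, rfl⟩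

lemma runSup_le {r : ℝ} (hr : 0 < r) : runSup F r ≤ k * V r := by
  refine csSup_le ⟨F r, r, ⟨hr, le_rfl⟩, rfl⟩ ?_
  rintro _ ⟨s, hs, rfl⟩
  exact h.le_of_le hs.1 hs.2

lemma tendsto_zero : Tendsto F (nhdsWithin 0 (Ioi 0)) (nhds 0) := by
  have h1 := h.zero.const_mul k
  rw [mul_zero] at h1
  refine tendsto_of_tendsto_of_tendsto_of_le_of_le' tendsto_const_nhds h1 ?_ ?_
  · filter_upwards [self_mem_nhdsWithin] with s hs using h.nonneg s hs
  · filter_upwards [self_mem_nhdsWithin] with s hs using h.le s hs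

lemma level_nonempty (hinf : Tendsto F atTop atTop) {v : ℝ} (hv : 0 < v) :
    {r : ℝ | 0 < r ∧ runSup F r = v}.Nonempty :=
  exists_runSup_eq h.cont h.tendsto_zero hinf hv

lemma level_bddAbove (hinf : Tendsto F atTop atTop) (v : ℝ) :
    BddAbove {r : ℝ | 0 < r ∧ runSup F r = v} := by
  obtain ⟨m, hm⟩ := (hinf.eventually_gt_atTop v).exists_forall_of_atTop
  refine ⟨m, fun r hr => ?_⟩
  by_contra! hc
  have h1 := h.le_runSup hr.1 le_rfl
  have h2 := hm r hc.le
  rw [hr.2] at h1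
  linarith

end Controlled

/-- Lower scaling of order `α` of `Φ` and comparability with `V`, beyond `x₁`. -/
def Good (V Φ : ℝ → ℝ) (α x₁ c₁ : ℝ) : Prop :=
  ∀ s, x₁ < s → (∀ u, 1 ≤ u → c₁ * u ^ α * Φ s ≤ Φ (u * s)) ∧ c₁ * V s ≤ Φ s

lemma Good.mul_rpow_le {V Φ : ℝ → ℝ} {α x₁ c₁ : ℝ} (hg : Good V Φ α x₁ c₁) (hx₁ : 0 ≤ x₁)
    {s ξ : ℝ} (hs : x₁ < s) (hξ : s ≤ ξ) : c₁ * (ξ / s) ^ α * Φ s ≤ Φ ξ := by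
  have hs0 : 0 < s := hx₁.trans_lt hs
  have := (hg s hs).1 (ξ / s) ((one_le_div hs0).2 hξ)
  rwa [div_mul_cancel₀ _ hs0.ne'] at this

lemma Good.tendsto {V Φ : ℝ → ℝ} {α x₁ c₁ : ℝ} (hg : Good V Φ α x₁ c₁) (hx₁ : 0 ≤ x₁)
    (hα : 0 < α) (hc₁ : 0 < c₁) (hΦ : ∀ s, 0 < s → 0 < Φ s) : Tendsto Φ atTop atTop := by
  have hm : 0 < x₁ + 1 := by linarith
  have h1 : Tendsto (fun ξ : ℝ => c₁ * Φ (x₁ + 1) * (ξ / (x₁ + 1)) ^ α) atTop atTop :=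
    Tendsto.const_mul_atTop (mul_pos hc₁ (hΦ _ hm))
      ((tendsto_rpow_atTop hα).comp (tendsto_id.atTop_div_const hm))
  refine tendsto_atTop_mono' _ ?_ h1
  filter_upwards [eventually_ge_atTop (x₁ + 1)] with ξ hξ
  have := hg.mul_rpow_le hx₁ (lt_add_one x₁) hξ
  linarith

lemma scale_bounds {V Φ R : ℝ → ℝ} {α x₁ c₁ c' B v : ℝ} (hΦ : Controlled V Φ 1)
    (hR : Controlled V R 2) (hΦ0 : ∀ s, 0 < s → 0 < Φ s) (hα : 0 < α) (hx₁ : 0 ≤ x₁)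
    (hc₁ : 0 < c₁) (hc' : 0 < c') (hg : Good V Φ α x₁ c₁)
    (hV : ∀ s, 0 < s → V (2 * s) ≤ 4 * V s) (hRΦ : ∀ s, 0 < s → c' * Φ s ≤ R s)
    (hB : 1 ≤ B) (hB' : 1 ≤ c' * c₁ ^ 2 * B ^ α) (hv : 0 < v)
    (hvx : 0 < x₁ → 2 * V x₁ < v) :
    0 < runInv R v ∧ c₁ * c' * V (runInv R v) ≤ 4 * v ∧
      (∀ ξ, runInv R v ≤ ξ → c₁ ^ 2 / 2 * v * (ξ / runInv R v) ^ α ≤ Φ ξ) ∧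
      runInv R v ≤ 2 * B * runInv Φ v := by
  have hΦt := hg.tendsto hx₁ hα hc₁ hΦ0
  have hRt : Tendsto R atTop atTop := by
    refine tendsto_atTop_mono' _ ?_ (hΦt.const_mul_atTop hc')
    filter_upwards [eventually_gt_atTop 0] with s hs using hRΦ s hs
  have hbR := hR.level_bddAbove hRt v
  have hbΦ := hΦ.level_bddAbove hΦt v
  have hneR := hR.level_nonempty hRt hv
  obtain ⟨q, hq0, hq⟩ := hΦ.level_nonempty hΦt hv
  have hlarge : ∀ r, 0 < r → v ≤ 2 * V r → x₁ < r := by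
    intro r hr hvr
    by_contra! hc
    have := hvx (hr.trans_le hc)
    have h2 := hR.mono r x₁ hr hc
    linarith
  have hVr : ∀ r, 0 < r ∧ runSup R r = v → v ≤ 2 * V r := fun r hr => hr.2 ▸ hR.runSup_le hr.1
  set S := runInv R v with hS
  have hle : ∀ r, 0 < r ∧ runSup R r = v → r ≤ S := fun r hr => le_csSup hbR hr
  obtain ⟨r₀, hr₀⟩ := hneR
  have hS0 : 0 < S := hr₀.1.trans_le (hle _ hr₀)
  have hVS : v ≤ 2 * V S := by
    have := hR.mono r₀ S hr₀.1 (hle _ hr₀)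
    linarith [hVr _ hr₀]
  have hSx := hlarge S hS0 hVS
  obtain ⟨r, hr, hrS⟩ := exists_lt_of_lt_csSup ⟨r₀, hr₀⟩ (show S / 2 < S by linarith)
  have hrx := hlarge r hr.1 (hVr r hr)
  have hRr : R r ≤ v := hr.2 ▸ hR.le_runSup hr.1 le_rfl
  have hΦr := hRΦ r hr.1
  have hVq : v ≤ V q := by
    have := hΦ.runSup_le hq0
    rw [hq] at this
    linarith
  refine ⟨hS0, ?_, ?_, ?_⟩
  · have h1 : V S ≤ 4 * V r := (hR.mono S (2 * r) hS0 (by linarith)).trans (hV r hr.1)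
    have h2 := (hg r hrx).2
    have h3 : c₁ * c' * V S ≤ c₁ * c' * (4 * V r) := by gcongr
    have h4 : c' * (c₁ * V r) ≤ c' * Φ r := by gcongr
    nlinarith
  · intro ξ hξ
    refine le_trans ?_ (hg.mul_rpow_le hx₁ hSx hξ)
    have h2 := (hg S hSx).2
    have h3 : (0:ℝ) ≤ (ξ / S) ^ α := by
      have : 0 ≤ ξ / S := div_nonneg (hS0.le.trans hξ) hS0.le
      positivity
    have h5 : c₁ / 2 * v ≤ Φ S := by nlinarith
    calc c₁ ^ 2 / 2 * v * (ξ / S) ^ α = c₁ * (ξ / S) ^ α * (c₁ / 2 * v) := by ring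
      _ ≤ _ := by gcongr
  · have hqx : x₁ < q := hlarge q hq0 (by linarith)
    have hqle : q ≤ runInv Φ v := le_csSup hbΦ ⟨hq0, hq⟩
    have hrq : r ≤ B * q := by
      by_contra! hc
      have hqr : q ≤ r := by nlinarith
      have h1 := hg.mul_rpow_le hx₁ hqx hqr
      have h2 := (hg q hqx).2
      have h3 : B ^ α < (r / q) ^ α := by
        refine Real.rpow_lt_rpow (by linarith) ?_ hα
        rwa [lt_div_iff₀ hq0]
      have h4 : c₁ * v ≤ Φ q := by nlinarith
      have h5 : v < v := by
        calc v ≤ (c' * c₁ ^ 2 * B ^ α) * v := by nlinarith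
          _ < (c' * c₁ ^ 2 * (r / q) ^ α) * v := by gcongr
          _ = c' * (c₁ * (r / q) ^ α * (c₁ * v)) := by ring
          _ ≤ c' * (c₁ * (r / q) ^ α * Φ q) := by
              have : 0 ≤ (r / q) ^ α := Real.rpow_nonneg (div_nonneg hr.1.le hq0.le) _
              gcongr
          _ ≤ c' * Φ r := by gcongr
          _ ≤ v := hΦr.trans hRr
      exact lt_irrefl _ h5
    have : B * q ≤ B * runInv Φ v := by gcongr
    linarith

namespace IsLaplaceExp
variable {N : Measure ℝ} {b : ℝ} {φ φ' φ'' : ℝ → ℝ} (h : IsLaplaceExp N b φ φ' φ'')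
include h

lemma controlled_bigPhi : Controlled (levyV N) (bigPhi φ'') 1 where
  cont := h.continuousOn_bigPhi
  nonneg s hs := (h.bigPhi_pos hs).le
  le s hs := by rw [one_mul]; exact h.bigPhi_le_levyV hs
  mono _ _ hs hss := levyV_mono h.fin hs hss
  zero := tendsto_levyV_zero h.fin
  pos := zero_le_one

lemma controlled_cos : Controlled (levyV N) (fun ξ => ∫ x, (1 - Real.cos (ξ * x)) ∂N) 2 where
  cont := (continuous_integral_cos h.null h.fin).continuousOn
  nonneg _ _ := integral_nonneg fun _ => sub_nonneg.2 (Real.cos_le_one _)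
  le _ hs := integral_one_sub_cos_le h.null h.fin hs
  mono _ _ hs hss := levyV_mono h.fin hs hss
  zero := tendsto_levyV_zero h.fin
  pos := zero_le_two

variable {α c x₀ : ℝ} (hα : 0 < α) (hc : 0 < c) (hx₀ : 0 ≤ x₀) (hscal : WLSC φ'' (α - 2) c x₀)
include hscal hx₀

lemma bigPhi_scaling {x u : ℝ} (hx : x₀ < x) (hu : 1 ≤ u) :
    c * u ^ α * bigPhi φ'' x ≤ bigPhi φ'' (u * x) := by
  have h1 := hscal u hu x hx
  have hu0 : 0 < u := by linarith
  have e : u ^ α = u ^ 2 * u ^ (α - 2) := by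
    rw [← Real.rpow_natCast u 2, ← Real.rpow_add hu0]
    congr 1
    push_cast
    ring
  calc c * u ^ α * bigPhi φ'' x = (u * x) ^ 2 * (c * u ^ (α - 2) * φ'' x) := by
        rw [e, bigPhi]; ring
    _ ≤ _ := by rw [bigPhi]; gcongr

include hα hc

lemma levyW_le_add {m s : ℝ} (hm : x₀ < m) (hs : m ≤ s) :
    levyW N s ≤ levyW N m + bigPhi φ'' s / (c * α) := by
  have hm0 : 0 < m := hx₀.trans_lt hm
  have hs0 : 0 < s := hm0.trans_le hs
  set K := bigPhi φ'' s / (c * α) with hK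
  have hΦs := h.bigPhi_pos hs0
  have hK0 : 0 < K := by positivity
  have hd : ∀ x, 0 < x → HasDerivAt (fun x => K * (x / s) ^ α - levyW N x)
      (K * (1 / s * α * (x / s) ^ (α - 1)) - bigPhi φ'' x / x) x := by
    intro x hx
    have h1 := ((hasDerivAt_id' x).div_const s).rpow_const (p := α)
      (Or.inl (div_pos hx hs0).ne')
    exact (h1.const_mul K).sub (h.hasDerivAt_levyW hx)
  have hmono : MonotoneOn (fun x => K * (x / s) ^ α - levyW N x) (Icc m s) := by
    refine monotoneOn_of_deriv_nonneg (convex_Icc m s)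
      (fun x hx => (hd x (hm0.trans_le hx.1)).continuousAt.continuousWithinAt)
      (fun x hx => ?_) fun x hx => ?_
    · rw [interior_Icc] at hx
      exact (hd x (hm0.trans hx.1)).differentiableAt.differentiableWithinAt
    · rw [interior_Icc] at hx
      have hx0 : 0 < x := hm0.trans hx.1
      rw [(hd x hx0).deriv, sub_nonneg, div_le_iff₀ hx0]
      have h1 := h.bigPhi_scaling hx₀ hscal (hm.trans hx.1) ((one_le_div hx0).2 hx.2.le)
      rw [div_mul_cancel₀ _ hx0.ne', Real.div_rpow hs0.le hx0.le] at h1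
      rw [Real.rpow_sub_one (div_pos hx0 hs0).ne', Real.div_rpow hx0.le hs0.le, hK]
      have hsa : 0 < s ^ α := Real.rpow_pos_of_pos hs0 _
      have hxa : 0 < x ^ α := Real.rpow_pos_of_pos hx0 _
      have e : bigPhi φ'' s / (c * α) * (1 / s * α * (x ^ α / s ^ α / (x / s))) * x =
          bigPhi φ'' s * x ^ α / (c * s ^ α) := by
        field_simp
      rw [e, le_div_iff₀ (by positivity)]
      calc bigPhi φ'' x * (c * s ^ α) = (c * (s ^ α / x ^ α) * bigPhi φ'' x) * x ^ α := by
            field_simp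
        _ ≤ _ := by gcongr
  have h1 := hmono ⟨le_rfl, hs⟩ ⟨hs, le_rfl⟩ hs
  simp only [div_self hs0.ne', Real.one_rpow, mul_one] at h1
  have h2 : 0 ≤ K * (m / s) ^ α := by positivity
  linarith

lemma good_zero (hx : x₀ = 0) : ∃ c₁, 0 < c₁ ∧ Good (levyV N) (bigPhi φ'') α 0 c₁ := by
  subst hx
  refine ⟨min c (c * α / 6), lt_min hc (by positivity), fun s hs => ⟨fun u hu => ?_, ?_⟩⟩
  · refine le_trans ?_ (h.bigPhi_scaling le_rfl hscal hs hu)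
    have := (h.bigPhi_pos hs).le
    gcongr
    exact min_le_left _ _
  · have h1 : levyW N s ≤ 0 + bigPhi φ'' s / (c * α) := by
      refine ge_of_tendsto ((tendsto_levyV_zero h.fin).add_const (bigPhi φ'' s / (c * α))) ?_
      filter_upwards [Ioo_mem_nhdsGT hs] with m hm
      have := h.levyW_le_add hα hc le_rfl hscal hm.1 hm.2.le
      linarith [h.levyW_le hm.1]
    have h2 := h.levyV_le hs
    calc min c (c * α / 6) * levyV N s ≤ c * α / 6 * levyV N s := by
          have := levyV_nonneg (N := N) s
          gcongr
          exact min_le_right _ _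
      _ ≤ c * α / 6 * (6 * (bigPhi φ'' s / (c * α))) := by gcongr; linarith
      _ = _ := by field_simp

lemma good_of_pos {x₁ : ℝ} (hx₁ : 0 < x₁) :
    ∃ c₁, 0 < c₁ ∧ Good (levyV N) (bigPhi φ'') α x₁ c₁ := by
  set m := x₀ + x₁ with hm
  have hxm : x₀ < m := by linarith
  have hm0 : 0 < m := by linarith
  have hxm1 : x₁ ≤ m := by linarith
  set a := x₁ ^ 2 * φ'' m with ha
  have ha0 : 0 < a := mul_pos (by positivity) (h.deriv2_pos hm0)
  have haΦ : ∀ s, x₁ < s → s ≤ m → a ≤ bigPhi φ'' s := by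
    intro s hs hsm
    have := h.deriv2_antitone (hx₁.trans hs) hsm
    have h2 := h.deriv2_pos hm0
    rw [ha, bigPhi]
    gcongr
  have ham : a ≤ bigPhi φ'' m := by
    have h2 := h.deriv2_pos hm0
    rw [ha, bigPhi]
    gcongr
  have hVm : a ≤ levyV N m := ham.trans (h.bigPhi_le_levyV hm0)
  have hVm0 : 0 < levyV N m := ha0.trans_le hVm
  set q := a / levyV N m with hq
  have hq0 : 0 < q := by positivity
  have hq1 : q ≤ 1 := (div_le_one hVm0).2 hVm
  have hqV : q * levyV N m = a := div_mul_cancel₀ _ hVm0.ne'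
  set w := (x₁ / m) ^ α with hw
  have hw0 : 0 < w := by positivity
  have hw1 : w ≤ 1 := Real.rpow_le_one (by positivity) ((div_le_one hm0).2 hxm1) hα.le
  set L := 6 * levyV N m / (c * a) + 6 / (c * α) with hL
  have hL0 : 0 < L := by positivity
  refine ⟨min (min c 1 * w * q) L⁻¹, lt_min (by positivity) (by positivity), fun s hs => ?_⟩
  have hs0 : 0 < s := hx₁.trans hs
  have hΦs := h.bigPhi_pos hs0
  constructor
  · intro u hu
    have hu0 : 0 < u := by linarith
    have hua : 0 < u ^ α := Real.rpow_pos_of_pos hu0 _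
    have hstep : min (min c 1 * w * q) L⁻¹ * u ^ α * bigPhi φ'' s ≤
        min c 1 * w * q * u ^ α * bigPhi φ'' s := by
      gcongr
      exact min_le_left _ _
    refine hstep.trans ?_
    rcases le_total m s with hms | hsm
    · refine le_trans ?_ (h.bigPhi_scaling hx₀ hscal (hxm.trans_le hms) hu)
      gcongr
      calc min c 1 * w * q ≤ c * 1 * 1 := by
            gcongr
            exact min_le_left _ _
        _ = c := by ring
    · have hsV : q * bigPhi φ'' s ≤ a := by
        rw [← hqV]
        have := (h.bigPhi_le_levyV hs0).trans (levyV_mono h.fin hs0 hsm)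
        gcongr
      have huw : u ^ α * w = (u * x₁ / m) ^ α := by
        rw [hw, ← Real.mul_rpow hu0.le (by positivity), mul_div_assoc]
      have hus : u * x₁ ≤ u * s := by gcongr
      rcases le_total m (u * s) with hms | hsm'
      · have h1 := h.bigPhi_scaling hx₀ hscal hxm ((one_le_div hm0).2 hms)
        rw [div_mul_cancel₀ _ hm0.ne'] at h1
        refine le_trans ?_ h1
        calc min c 1 * w * q * u ^ α * bigPhi φ'' s
            = min c 1 * (u ^ α * w) * (q * bigPhi φ'' s) := by ring
          _ ≤ c * (u * s / m) ^ α * bigPhi φ'' m := by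
              rw [huw]
              have := hsV.trans ham
              gcongr
              exact min_le_left _ _
      · refine le_trans ?_ (haΦ (u * s) (by nlinarith) hsm')
        have h3 : u ^ α * w ≤ 1 := by
          rw [huw]
          exact Real.rpow_le_one (by positivity) ((div_le_one hm0).2 (hus.trans hsm')) hα.le
        calc min c 1 * w * q * u ^ α * bigPhi φ'' s
            = min c 1 * (u ^ α * w) * (q * bigPhi φ'' s) := by ring
          _ ≤ 1 * 1 * a := by
              gcongr
              exact min_le_right _ _
          _ = a := by ring
  · have hV0 := levyV_nonneg (N := N) s
    rcases le_total m s with hms | hsm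
    · have h1 := h.levyW_le_add hα hc hx₀ hscal hxm hms
      have h2 := h.levyV_le hs0
      have h3 := h.levyW_le hm0
      have h4 : c * a ≤ bigPhi φ'' s := by
        have h5 := h.bigPhi_scaling hx₀ hscal hxm ((one_le_div hm0).2 hms)
        rw [div_mul_cancel₀ _ hm0.ne'] at h5
        refine le_trans ?_ h5
        have h6 : 1 ≤ (s / m) ^ α := Real.one_le_rpow ((one_le_div hm0).2 hms) hα.le
        calc c * a = c * 1 * a := by ring
          _ ≤ _ := by gcongr
      have h7 : levyV N s ≤ L * bigPhi φ'' s := by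
        have h8 : 6 * levyV N m ≤ 6 * levyV N m / (c * a) * bigPhi φ'' s := by
          rw [div_mul_eq_mul_div, le_div_iff₀ (by positivity)]
          gcongr
        calc levyV N s ≤ 6 * (levyV N m + bigPhi φ'' s / (c * α)) := by linarith
          _ = 6 * levyV N m + 6 / (c * α) * bigPhi φ'' s := by ring
          _ ≤ _ := by rw [hL, add_mul]; linarith
      calc min (min c 1 * w * q) L⁻¹ * levyV N s ≤ L⁻¹ * levyV N s := by
            gcongr
            exact min_le_right _ _
        _ ≤ L⁻¹ * (L * bigPhi φ'' s) := by gcongr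
        _ = _ := by field_simp
    · calc min (min c 1 * w * q) L⁻¹ * levyV N s ≤ 1 * 1 * q * levyV N m := by
            have := levyV_mono h.fin hs0 hsm
            gcongr
            refine (min_le_left _ _).trans ?_
            gcongr
            exact min_le_right _ _
        _ = a := by rw [one_mul, one_mul, hqV]
        _ ≤ _ := haΦ s hs hsm

end IsLaplaceExp

/-- The image of `t N` under multiplication by `S`. -/
def scaledMeasure (N : Measure ℝ) (t S : ℝ) : Measure ℝ := ENNReal.ofReal t • N.map (· * S)

section
variable (N : Measure ℝ) (t : ℝ) {S : ℝ} (hS : 0 < S)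
include hS

lemma scaledMeasure_apply (A : Set ℝ) :
    scaledMeasure N t S A = ENNReal.ofReal t * N ((· * S) ⁻¹' A) := by
  rw [scaledMeasure, Measure.smul_apply, smul_eq_mul,
    (measurableEmbedding_mulRight₀ hS.ne').map_apply]

lemma levyH_scaledMeasure (r : ℝ) :
    levyH (scaledMeasure N t S) r = ENNReal.ofReal t * levyH N (r / S) := by
  rw [levyH, scaledMeasure, lintegral_smul_measure, smul_eq_mul,
    (measurableEmbedding_mulRight₀ hS.ne').lintegral_map, levyH]
  congr 1
  refine lintegral_congr fun x => ?_
  congr 2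
  field_simp

lemma integral_scaledMeasure {E : Type*} [NormedAddCommGroup E] [NormedSpace ℝ E] (ht : 0 ≤ t)
    (f : ℝ → E) : ∫ x, f x ∂(scaledMeasure N t S) = t • ∫ x, f (x * S) ∂N := by
  rw [scaledMeasure, integral_smul_measure, ENNReal.toReal_ofReal ht,
    (measurableEmbedding_mulRight₀ hS.ne').integral_map]

lemma setIntegral_scaledMeasure (ht : 0 ≤ t) (f : ℝ → ℝ) :
    ∫ x in Ioo 0 1, f x ∂(scaledMeasure N t S) = t * ∫ x in Ioo 0 S⁻¹, f (x * S) ∂N := by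
  have e : (· * S) ⁻¹' Ioo (0:ℝ) 1 = Ioo 0 S⁻¹ := by
    rw [Set.preimage_mul_const_Ioo₀ _ _ hS]
    simp
  rw [scaledMeasure, Measure.restrict_smul, integral_smul_measure, ENNReal.toReal_ofReal ht,
    (measurableEmbedding_mulRight₀ hS.ne').setIntegral_map, e, smul_eq_mul]

end

/-- A bound by a density, transported along an affine change of variables. -/
lemma le_withDensity_of_map_affine {P : Measure ℝ} {S β : ℝ} (hS : 0 < S) {Γ : ℝ → ENNReal}
    (h : P.map (fun x => (x - β) * S) ≤ volume.withDensity Γ) :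
    P ≤ volume.withDensity fun y => ENNReal.ofReal S * Γ ((y - β) * S) := by
  have he : MeasurableEmbedding fun x : ℝ => (x - β) * S :=
    (measurableEmbedding_mulRight₀ hS.ne').comp (MeasurableEquiv.subRight β).measurableEmbedding
  have hvol : volume = ENNReal.ofReal S • volume.map fun x : ℝ => (x - β) * S := by
    have h1 : volume.map (fun x : ℝ => (x - β) * S) = volume.map (· * S) := by
      have h2 := Measure.map_map (μ := (volume : Measure ℝ)) (g := (· * S)) (f := (· - β))
        (by fun_prop) (by fun_prop)
      rw [(measurePreserving_sub_right volume β).map_eq] at h2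
      exact h2.symm
    rw [h1]
    have h3 := Real.smul_map_volume_mul_right hS.ne'
    rw [abs_of_pos hS] at h3
    exact h3.symm
  refine Measure.le_iff.2 fun A hA => ?_
  have hB : MeasurableSet ((fun x : ℝ => (x - β) * S) '' A) := he.measurableSet_image.2 hA
  have h4 := h ((fun x : ℝ => (x - β) * S) '' A)
  rw [he.map_apply, he.injective.preimage_image, withDensity_apply _ hB] at h4
  rw [withDensity_apply _ hA]
  refine h4.trans (le_of_eq ?_)
  rw [hvol, Measure.restrict_smul, lintegral_smul_measure, he.restrict_map, he.lintegral_map,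
    he.injective.preimage_image, smul_eq_mul, ← hvol,
    lintegral_const_mul' _ _ ENNReal.ofReal_ne_top]

section
variable {N : Measure ℝ} (hN0 : N (Iic 0) = 0) (hN : levyH N 1 ≠ ⊤)
include hN0 hN

lemma integrable_lk (ζ : ℝ) :
    Integrable (fun x : ℝ => Complex.exp (Complex.I * ζ * x) - 1 -
      Complex.I * ζ * x * (if x < 1 then (1:ℂ) else 0)) N := by
  have hm : Measurable fun x : ℝ => Complex.exp (Complex.I * ζ * x) - 1 -
      Complex.I * ζ * x * (if x < 1 then (1:ℂ) else 0) := by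
    refine Measurable.sub (by fun_prop) (Measurable.mul (by fun_prop) ?_)
    exact Measurable.ite measurableSet_Iio measurable_const measurable_const
  refine ((integrable_min_one_sq hN one_pos).const_mul (3 * ζ ^ 2 + 2)).mono'
    hm.aestronglyMeasurable ?_
  filter_upwards [ae_pos_of_Iic hN0] with x hx
  rw [one_mul]
  split_ifs with h
  · rw [min_eq_right (by nlinarith), mul_one]
    have h1 := norm_cexp_sub_one_sub_le (ζ * x)
    push_cast at h1
    rw [← mul_assoc] at h1
    nlinarith [sq_nonneg x]
  · rw [min_eq_left (by nlinarith), mul_zero, sub_zero]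
    have h1 := norm_sub_le (Complex.exp (Complex.I * ζ * x)) 1
    rw [norm_cexp_I_mul, norm_one] at h1
    nlinarith [sq_nonneg ζ]

lemma integrable_truncation {ρ : ℝ} (hρ : 0 < ρ) :
    Integrable (fun s : ℝ => s * ((if s < ρ then (1:ℝ) else 0) - (if s < 1 then (1:ℝ) else 0)))
      N := by
  have hm : Measurable fun s : ℝ =>
      s * ((if s < ρ then (1:ℝ) else 0) - (if s < 1 then (1:ℝ) else 0)) := by
    refine measurable_id.mul (Measurable.sub ?_ ?_) <;>
    exact Measurable.ite measurableSet_Iio measurable_const measurable_const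
  refine integrable_of_le_min hN0 hN one_pos (k := (1 + ρ) * (1 + (ρ ^ 2)⁻¹))
    hm.aestronglyMeasurable fun x hx => ?_
  have hi : 0 < (ρ ^ 2)⁻¹ := by positivity
  have key : ∀ m : ℝ, x ≤ 1 + ρ → 1 ≤ (1 + (ρ ^ 2)⁻¹) * min 1 (x ^ 2) →
      x ≤ (1 + ρ) * (1 + (ρ ^ 2)⁻¹) * min 1 ((1 * x) ^ 2) := by
    intro _ h1 h2
    rw [one_mul, mul_assoc]
    nlinarith
  have hmin : ρ ≤ x ∨ 1 ≤ x → 1 ≤ (1 + (ρ ^ 2)⁻¹) * min 1 (x ^ 2) := by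
    intro h
    rcases le_total 1 (x ^ 2) with h1 | h1
    · rw [min_eq_left h1]; linarith
    · rw [min_eq_right h1]
      rcases h with h | h
      · have h2 : ρ ^ 2 ≤ x ^ 2 := by gcongr
        have h3 : (ρ ^ 2)⁻¹ * ρ ^ 2 = 1 := inv_mul_cancel₀ (by positivity)
        nlinarith
      · nlinarith
  have h0 : 0 ≤ (1 + ρ) * (1 + (ρ ^ 2)⁻¹) * min 1 ((1 * x) ^ 2) := by positivity
  by_cases h1 : x < ρ <;> by_cases h2 : x < 1
  · simpa [h1, h2] using h0
  · simp only [h1, h2, if_true, if_false, sub_zero, mul_one, abs_of_pos hx]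
    exact key 0 (by linarith) (hmin (Or.inr (not_lt.1 h2)))
  · simp only [h1, h2, if_true, if_false, zero_sub, mul_neg, mul_one, abs_neg, abs_of_pos hx]
    exact key 0 (by linarith) (hmin (Or.inl (not_lt.1 h1)))
  · simpa [h1, h2] using h0

lemma lk_change_truncation {ρ : ℝ} (hρ : 0 < ρ) (ζ : ℝ) :
    ∫ x : ℝ, (Complex.exp (Complex.I * ζ * x) - 1 -
        Complex.I * ζ * x * (if x < ρ then (1:ℂ) else 0)) ∂N =
      ∫ x : ℝ, (Complex.exp (Complex.I * ζ * x) - 1 -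
        Complex.I * ζ * x * (if x < 1 then (1:ℂ) else 0)) ∂N -
      Complex.I * ζ * ((∫ s : ℝ, s * ((if s < ρ then (1:ℝ) else 0) -
        (if s < 1 then (1:ℝ) else 0)) ∂N : ℝ) : ℂ) := by
  have h : Integrable (fun s : ℝ => Complex.I * ζ * ((s * ((if s < ρ then (1:ℝ) else 0) -
      (if s < 1 then (1:ℝ) else 0)) : ℝ) : ℂ)) N :=
    ((integrable_truncation hN0 hN hρ).ofReal).const_mul _
  rw [← integral_complex_ofReal, ← integral_const_mul]
  refine Eq.trans ?_ (integral_sub (integrable_lk hN0 hN ζ) h)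
  refine integral_congr_ae (ae_of_all _ fun x => ?_)
  simp only
  split_ifs <;> push_cast <;> ring

end

/-- A density bound on an infinitely divisible law, at any scale `S` at which the Lévy measure is
controlled, with a constant depending only on the constants of the control. -/
lemma exists_scaled_density_const {N : Measure ℝ} (hN0 : N (Iic 0) = 0) (hN : levyH N 1 ≠ ⊤)
    {d : ℝ → ℝ} (hd0 : ∀ x, 0 ≤ d x)
    (hd : ∀ A : Set ℝ, MeasurableSet A → A ⊆ Ioi 0 → N A = ∫⁻ x in A, ENNReal.ofReal (d x))
    {C₀ : ℝ} (hC₀ : 1 ≤ C₀) (hmono : ∀ x y : ℝ, 0 < x → x ≤ y → d y ≤ C₀ * d x)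
    {α c₁ C₁ : ℝ} (hα : 0 < α) (hc₁ : 0 < c₁) (hC₁ : 1 ≤ C₁) :
    ∃ C : ℝ, 0 < C ∧ ∀ t S : ℝ, 0 < t → 0 < S → t * levyV N S ≤ C₁ →
      (∀ ξ, S ≤ ξ → c₁ * (ξ / S) ^ α ≤ t * (ξ ^ 2 * ∫ x, x ^ 2 * Real.exp (-(ξ * x)) ∂N)) →
      ∀ (P : Measure ℝ) [IsProbabilityMeasure P] (b β : ℝ),
      (∀ ξ : ℝ, ∫ x : ℝ, Complex.exp (Complex.I * ξ * x) ∂P = Complex.exp (t * (Complex.I * b * ξ +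
        ∫ x : ℝ, (Complex.exp (Complex.I * ξ * x) - 1 -
          Complex.I * ξ * x * (if x < 1 then (1:ℂ) else 0)) ∂N))) →
      β = t * (b + ∫ s : ℝ, s * ((if s < S⁻¹ then (1:ℝ) else 0) -
        (if s < 1 then (1:ℝ) else 0)) ∂N) →
      P ≤ volume.withDensity fun y => min (ENNReal.ofReal (C * S))
        (ENNReal.ofReal (C * t) * (ENNReal.ofReal |y - β|⁻¹ * levyH N |y - β|)) := by
  set κ := (1 + 16 * C₀ ^ 2) * (π ^ 2 / 2) with hκ
  have hπ : 0 < π := Real.pi_pos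
  have hκ0 : 0 < κ := by positivity
  obtain ⟨C, hC, hmain⟩ := exists_density_const (α := α) (c₁ := c₁ / κ) (C₁ := C₁)
    (D := 8 * C₀ ^ 2) hα (by positivity) hC₁ (by positivity)
  refine ⟨C, hC, fun t S ht hS hV hΦ P _ b β hP hβ => ?_⟩
  have hSi : 0 < S⁻¹ := inv_pos.2 hS
  set M := scaledMeasure N t S with hM
  have haff : Measurable fun x : ℝ => (x - β) * S := by fun_prop
  have hprob : IsProbabilityMeasure (P.map fun x => (x - β) * S) :=
    Measure.isProbabilityMeasure_map haff.aemeasurable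
  have h1 : M (Iic 0) = 0 := by
    rw [hM, scaledMeasure_apply N t hS, Set.preimage_mul_const_Iic₀ _ hS, zero_div, hN0, mul_zero]
  have h2 : levyH M 1 ≤ ENNReal.ofReal C₁ := by
    rw [hM, levyH_scaledMeasure N t hS, one_div, ← ofReal_levyV hN hS, ← ENNReal.ofReal_mul ht.le]
    exact ENNReal.ofReal_le_ofReal hV
  have h3 : ∀ s, 0 < s → ∀ A, MeasurableSet A → A ⊆ Ici s →
      M A ≤ ENNReal.ofReal (8 * C₀ ^ 2 / s) * levyH M s * volume A := by
    intro s hs A hA hAs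
    have hsub : (· * S) ⁻¹' A ⊆ Ici (s / S) := by
      intro x hx
      rw [mem_Ici, div_le_iff₀ hS]
      exact hAs hx
    have h4 := measure_le_levyH hd0 hd hC₀ hmono (div_pos hs hS)
      (hA.preimage (by fun_prop : Measurable fun x : ℝ => x * S)) hsub
    rw [Real.volume_preimage_mul_right hS.ne', abs_of_pos hSi] at h4
    rw [hM, scaledMeasure_apply N t hS, levyH_scaledMeasure N t hS]
    have e : ENNReal.ofReal (8 * C₀ ^ 2 / (s / S)) * ENNReal.ofReal S⁻¹ =
        ENNReal.ofReal (8 * C₀ ^ 2 / s) := by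
      rw [← ENNReal.ofReal_mul (by positivity)]
      congr 1
      field_simp
    calc ENNReal.ofReal t * N ((· * S) ⁻¹' A) ≤ ENNReal.ofReal t *
          (ENNReal.ofReal (8 * C₀ ^ 2 / (s / S)) * levyH N (s / S) *
            (ENNReal.ofReal S⁻¹ * volume A)) := by gcongr
      _ = (ENNReal.ofReal (8 * C₀ ^ 2 / (s / S)) * ENNReal.ofReal S⁻¹) *
            (ENNReal.ofReal t * levyH N (s / S)) * volume A := by ring
      _ = _ := by rw [e]
  have h4 : ∀ ζ : ℝ, 1 ≤ |ζ| →
      c₁ / κ * |ζ| ^ α ≤ ∫ x in Ioo (0:ℝ) 1, (1 - Real.cos (ζ * x)) ∂M := by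
    intro ζ hζ
    have hζ0 : 0 < |ζ| := by linarith
    have hξ : S ≤ |ζ| * S := by nlinarith
    rw [hM, setIntegral_scaledMeasure N t hS ht.le]
    have h5 := hΦ (|ζ| * S) hξ
    rw [mul_div_cancel_right₀ _ hS.ne'] at h5
    have h6 := levyPhi_le_cos hN0 hN hd0 hd hC₀ hmono (s := |ζ| * S) (by positivity)
    have h7 : ∫ x in Ioo 0 (|ζ| * S)⁻¹, (1 - Real.cos (|ζ| * S * x)) ∂N ≤
        ∫ x in Ioo 0 S⁻¹, (1 - Real.cos (ζ * (x * S))) ∂N := by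
      have e : ∀ x, Real.cos (|ζ| * S * x) = Real.cos (ζ * (x * S)) := by
        intro x
        rw [← Real.cos_abs (ζ * (x * S)), ← Real.cos_abs (|ζ| * S * x)]
        congr 1
        simp only [abs_mul, abs_abs]
        ring
      simp only [e]
      refine setIntegral_mono_set ?_ (ae_of_all _ fun x => sub_nonneg.2 (Real.cos_le_one _))
        (Ioo_subset_Ioo_right ?_).eventuallyLE
      · have := (integrable_one_sub_cos hN0 hN (ζ * S)).integrableOn (s := Ioo 0 S⁻¹)
        refine this.congr_fun (fun x _ => ?_) measurableSet_Ioo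
        simp only
        congr 2
        ring
      · gcongr
    rw [← hκ] at h6
    rw [div_mul_eq_mul_div, div_le_iff₀ hκ0]
    calc c₁ * |ζ| ^ α ≤ t * (κ * ∫ x in Ioo 0 (|ζ| * S)⁻¹, (1 - Real.cos (|ζ| * S * x)) ∂N) :=
          h5.trans (by gcongr)
      _ ≤ t * (κ * ∫ x in Ioo 0 S⁻¹, (1 - Real.cos (ζ * (x * S))) ∂N) := by gcongr
      _ = _ := by ring
  have h5 : ∀ ζ : ℝ, charFun (P.map fun x => (x - β) * S) ζ =
      Complex.exp (∫ x : ℝ, (Complex.exp (Complex.I * ζ * x) - 1 -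
        Complex.I * ζ * x * (if x < 1 then (1:ℂ) else 0)) ∂M) := by
    intro ζ
    rw [charFun_apply_real, integral_map haff.aemeasurable (by fun_prop), hM,
      integral_scaledMeasure N t hS ht.le]
    have e1 : ∀ x : ℝ, Complex.exp ((ζ:ℂ) * (((x - β) * S : ℝ) : ℂ) * Complex.I) =
        Complex.exp (-(Complex.I * ζ * S * β)) *
          Complex.exp (Complex.I * ((ζ * S : ℝ) : ℂ) * x) := by
      intro x
      rw [← Complex.exp_add]
      congr 1
      push_cast
      ring
    simp only [e1]
    rw [integral_const_mul, hP, ← Complex.exp_add]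
    have e2 : ∀ x : ℝ, Complex.exp (Complex.I * ζ * ((x * S : ℝ) : ℂ)) - 1 -
        Complex.I * ζ * ((x * S : ℝ) : ℂ) * (if x * S < 1 then (1:ℂ) else 0) =
        Complex.exp (Complex.I * ((ζ * S : ℝ) : ℂ) * x) - 1 -
        Complex.I * ((ζ * S : ℝ) : ℂ) * x * (if x < S⁻¹ then (1:ℂ) else 0) := by
      intro x
      have : x * S < 1 ↔ x < S⁻¹ := by rw [inv_eq_one_div, lt_div_iff₀ hS]
      simp only [this]
      push_cast
      congr 2
      · congr 1; ring
      · ring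
    simp only [e2]
    rw [lk_change_truncation hN0 hN hSi, hβ, Complex.real_smul]
    congr 1
    push_cast
    ring
  refine (le_withDensity_of_map_affine hS (hmain M h1 h2 h3 h4 _ h5)).trans (le_of_eq ?_)
  congr 1
  funext y
  rw [mul_min, ← ENNReal.ofReal_mul hS.le, mul_comm S C, hM, levyH_scaledMeasure N t hS, abs_mul,
    abs_of_pos hS, mul_div_cancel_right₀ _ hS.ne', mul_inv,
    ENNReal.ofReal_mul (p := |y - β|⁻¹) (by positivity), ENNReal.ofReal_mul (q := t) hC.le]
  congr 1
  have e : ENNReal.ofReal S * ENNReal.ofReal S⁻¹ = 1 := by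
    rw [← ENNReal.ofReal_mul hS.le, mul_inv_cancel₀ hS.ne', ENNReal.ofReal_one]
  calc ENNReal.ofReal S * (ENNReal.ofReal C * (ENNReal.ofReal |y - β|⁻¹ * ENNReal.ofReal S⁻¹ *
        (ENNReal.ofReal t * levyH N |y - β|)))
      = (ENNReal.ofReal S * ENNReal.ofReal S⁻¹) * (ENNReal.ofReal C * ENNReal.ofReal t *
        (ENNReal.ofReal |y - β|⁻¹ * levyH N |y - β|)) := by ring
    _ = _ := by rw [e, one_mul]

/-- A finite measure dominated by a measure with density `G` has a real density below `G`. -/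
lemma exists_real_density_le {P : Measure ℝ} [IsFiniteMeasure P] {G : ℝ → ENNReal}
    (h : P ≤ volume.withDensity G) :
    ∃ q : ℝ → ℝ, P = volume.withDensity (fun x => ENNReal.ofReal (q x)) ∧
      ∀ x, ENNReal.ofReal (q x) ≤ G x := by
  classical
  have hac : P ≪ volume :=
    (Measure.absolutelyContinuous_of_le h).trans (withDensity_absolutelyContinuous _ _)
  have hle : P.rnDeriv volume ≤ᵐ[volume] G := by
    refine ae_le_of_forall_setLIntegral_le_of_sigmaFinite (Measure.measurable_rnDeriv _ _)
      fun s hs _ => ?_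
    rw [← withDensity_apply _ hs, Measure.withDensity_rnDeriv_eq _ _ hac, ← withDensity_apply _ hs]
    exact h s
  refine ⟨fun x => if P.rnDeriv volume x ≤ G x then (P.rnDeriv volume x).toReal else 0, ?_,
    fun x => ?_⟩
  · conv_lhs => rw [← Measure.withDensity_rnDeriv_eq _ _ hac]
    refine withDensity_congr_ae ?_
    filter_upwards [hle, Measure.rnDeriv_lt_top P volume] with x h1 h2
    rw [if_pos h1, ENNReal.ofReal_toReal h2.ne]
  · simp only
    split_ifs with h1
    · exact ENNReal.ofReal_toReal_le.trans h1
    · simp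

lemma psiStar_zero_eq {ν : Measure ℝ} (hC : ∃ V k, Controlled V
      (fun ξ => ∫ x in Ioi (0:ℝ), (1 - Real.cos (ξ * x)) ∂ν) k) {r : ℝ} (hr : 0 < r) :
    psiStar 0 ν r = runSup (fun ξ => ∫ x in Ioi (0:ℝ), (1 - Real.cos (ξ * x)) ∂ν) r := by
  obtain ⟨V, k, h⟩ := hC
  set F := fun ξ : ℝ => ∫ x in Ioi (0:ℝ), (1 - Real.cos (ξ * x)) ∂ν with hF
  have hre : rePsi 0 ν = F := by
    funext ξ
    simp [rePsi, hF]
  have habs : ∀ z, F z = F |z| := by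
    intro z
    simp only [hF]
    refine integral_congr_ae (ae_of_all _ fun x => ?_)
    simp only
    rcases abs_choice z with e | e <;> rw [e]
    rw [neg_mul, Real.cos_neg]
  have h0 : F 0 = 0 := by simp [hF]
  have hle : ∀ z, |z| ≤ r → F z ≤ runSup F r := by
    intro z hz
    rcases eq_or_ne z 0 with rfl | hz0
    · rw [h0]
      exact (h.nonneg r hr).trans (h.le_runSup hr le_rfl)
    · rw [habs]
      exact h.le_runSup (abs_pos.2 hz0) hz
  rw [psiStar, hre]
  refine le_antisymm (csSup_le ⟨F 0, 0, by simp [hr.le], rfl⟩ ?_) ?_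
  · rintro _ ⟨z, hz, rfl⟩
    exact hle z hz
  · refine csSup_le_csSup ⟨runSup F r, ?_⟩ ⟨F r, r, ⟨hr, le_rfl⟩, rfl⟩ (image_mono fun z hz => ?_)
    · rintro _ ⟨z, hz, rfl⟩
      exact hle z hz
    · rw [mem_ofPred_eq, abs_of_pos hz.1]
      exact hz.2

lemma psiInv_zero_eq {ν : Measure ℝ} (hC : ∃ V k, Controlled V
      (fun ξ => ∫ x in Ioi (0:ℝ), (1 - Real.cos (ξ * x)) ∂ν) k) (v : ℝ) :
    psiInv 0 ν v = runInv (fun ξ => ∫ x in Ioi (0:ℝ), (1 - Real.cos (ξ * x)) ∂ν) v := by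
  rw [psiInv, runInv]
  congr 1
  ext r
  refine and_congr_right fun hr => ?_
  rw [psiStar_zero_eq hC hr]

lemma isLaplaceExp_restrict {ν : Measure ℝ}
    (hint : ∫⁻ x in Ioi (0:ℝ), ENNReal.ofReal (min 1 (x ^ 2)) ∂ν ≠ ⊤)
    {b : ℝ} {φ φ' φ'' : ℝ → ℝ}
    (hφ : ∀ l : ℝ, 0 ≤ l → φ l = (0:ℝ) ^ 2 * l ^ 2 - b * l +
      ∫ x in Ioi (0:ℝ), (Real.exp (-(l * x)) - 1 + l * x * (if x < 1 then 1 else 0)) ∂ν)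
    (hD1 : ∀ x : ℝ, 0 < x → HasDerivAt φ (φ' x) x)
    (hD2 : ∀ x : ℝ, 0 < x → HasDerivAt φ' (φ'' x) x)
    (hφ'' : ∀ l : ℝ, 0 < l →
      φ'' l = 2 * (0:ℝ) ^ 2 + ∫ x in Ioi (0:ℝ), x ^ 2 * Real.exp (-(l * x)) ∂ν)
    (hUV : ∫⁻ x in Ioo (0:ℝ) 1, ENNReal.ofReal x ∂ν = ⊤) :
    IsLaplaceExp (ν.restrict (Ioi 0)) b φ φ' φ'' where
  null := by
    rw [Measure.restrict_apply measurableSet_Iic, Iic_inter_Ioi, Ioc_self, measure_empty]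
  fin := by simpa [levyH] using hint
  eq l hl := by rw [hφ l hl.le]; ring
  hasDeriv := hD1
  hasDeriv2 := hD2
  eq2 l hl := by rw [hφ'' l hl]; ring
  unbdd := by
    rwa [Measure.restrict_restrict measurableSet_Ioo,
      inter_eq_left.2 (Ioo_subset_Ioi_self : Ioo (0:ℝ) 1 ⊆ Ioi 0)]

lemma IsLaplaceExp.exists_levyH_le_etaFn {N : Measure ℝ} {b : ℝ} {φ φ' φ'' : ℝ → ℝ}
    (h : IsLaplaceExp N b φ φ' φ'') {θ₁ x₀ x₁ α c₁ : ℝ}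
    (hθ₁ : θ₁ = sInf {s : ℝ | 0 < s ∧ 0 < φ' s}) (hx₀θ₁ : 0 < θ₁ → x₀ ≤ θ₁) (hx₀ : 0 ≤ x₀)
    (hx₁ : x₁ ≤ x₀) (hc₁ : 0 < c₁) (hg : Good (levyV N) (bigPhi φ'') α x₁ c₁) :
    ∃ K : ℝ, 0 < K ∧ ∀ s : ℝ, 0 ≤ s →
      ENNReal.ofReal s⁻¹ * levyH N s ≤ ENNReal.ofReal K * etaFn φ φ'' x₀ s := by
  have hΦ := h.controlled_bigPhi
  set A := bigPhiStar φ'' x₀ / |φ x₀| with hA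
  have hA0 : 0 < x₀ → 0 < A := by
    intro hx
    have h1 := h.levyW_le_abs hθ₁ hx₀θ₁ hx le_rfl
    have h2 := h.levyV_le hx
    have h3 := h.bigPhi_le_levyV hx
    have h4 := h.bigPhi_pos hx
    exact div_pos (h4.trans_le (hΦ.le_runSup hx le_rfl)) (by linarith)
  obtain ⟨a, ha, haA⟩ : ∃ a : ℝ, 0 < a ∧ (0 < x₀ → a ≤ A) := by
    rcases hx₀.eq_or_lt with hx | hx
    · exact ⟨1, one_pos, fun h' => absurd h' (by rw [← hx]; exact lt_irrefl _)⟩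
    · exact ⟨A, hA0 hx, fun _ => le_rfl⟩
  have key : ∀ s : ℝ, 0 < s → ENNReal.ofReal s⁻¹ * levyH N s =
      ENNReal.ofReal (s⁻¹ * levyV N s⁻¹) := by
    intro s hs
    rw [ENNReal.ofReal_mul (inv_pos.2 hs).le, ofReal_levyV h.fin (inv_pos.2 hs), inv_inv]
  refine ⟨c₁⁻¹ + 6 * a⁻¹, by positivity, fun s hs => ?_⟩
  rcases hs.eq_or_lt with rfl | hs
  · have hK : 0 < c₁⁻¹ + 6 * a⁻¹ := by positivity
    rw [etaFn, if_pos le_rfl, ENNReal.mul_top (ENNReal.ofReal_pos.2 hK).ne']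
    exact le_top
  have hsi : 0 < s⁻¹ := inv_pos.2 hs
  have hV0 := levyV_nonneg (N := N) s⁻¹
  rw [key s hs, etaFn, if_neg (not_le.2 hs)]
  split_ifs with hxs
  · rw [← ENNReal.ofReal_mul (by positivity)]
    refine ENNReal.ofReal_le_ofReal ?_
    have h1 : x₁ < s⁻¹ := by
      refine hx₁.trans_lt ?_
      rwa [inv_eq_one_div, lt_div_iff₀ hs]
    have h2 := (hg _ h1).2.trans (hΦ.le_runSup hsi le_rfl)
    have h3 : levyV N s⁻¹ ≤ c₁⁻¹ * bigPhiStar φ'' s⁻¹ := by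
      rw [inv_mul_eq_div, le_div_iff₀ hc₁, mul_comm]
      exact h2
    have h4 : 0 ≤ bigPhiStar φ'' s⁻¹ := le_trans (by positivity) h2
    calc s⁻¹ * levyV N s⁻¹ ≤ s⁻¹ * (c₁⁻¹ * bigPhiStar φ'' s⁻¹) := by gcongr
      _ = c₁⁻¹ * (s⁻¹ * bigPhiStar φ'' s⁻¹) := by ring
      _ ≤ _ := by
        gcongr
        have : 0 < a⁻¹ := inv_pos.2 ha
        linarith
  · rw [← ENNReal.ofReal_mul (by positivity)]
    refine ENNReal.ofReal_le_ofReal ?_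
    have hx : 0 < x₀ := by
      rcases hx₀.eq_or_lt with hx | hx
      · rw [← hx] at hxs; simp at hxs
      · exact hx
    have h1 : s⁻¹ ≤ x₀ := by
      rw [inv_eq_one_div, div_le_iff₀ hs]
      exact not_lt.1 hxs
    have h2 := h.levyW_le_abs hθ₁ hx₀θ₁ hsi h1
    have h3 := h.levyV_le hsi
    have h4 : 1 ≤ a⁻¹ * A := by
      rw [inv_mul_eq_div, one_le_div ha]
      exact haA hx
    have hA' := hA0 hx
    have hci : 0 < c₁⁻¹ := inv_pos.2 hc₁
    calc s⁻¹ * levyV N s⁻¹ ≤ s⁻¹ * (6 * |φ s⁻¹|) := by gcongr; linarith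
      _ = 6 * 1 * (s⁻¹ * |φ s⁻¹|) := by ring
      _ ≤ 6 * (a⁻¹ * A) * (s⁻¹ * |φ s⁻¹|) := by gcongr
      _ = 6 * a⁻¹ * (A * s⁻¹ * |φ s⁻¹|) := by ring
      _ ≤ _ := by
        gcongr
        linarith

/-- Theorem 2. -/
theorem statement14
    (ν : Measure ℝ) [SigmaFinite ν]
    (hint : ∫⁻ x in Ioi (0:ℝ), ENNReal.ofReal (min 1 (x ^ 2)) ∂ν ≠ ⊤)
    (σ b : ℝ) (hσ : 0 ≤ σ)
    (φ φ' φ'' : ℝ → ℝ)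
    (hφ : ∀ l : ℝ, 0 ≤ l → φ l = σ ^ 2 * l ^ 2 - b * l +
      ∫ x in Ioi (0:ℝ), (Real.exp (-(l * x)) - 1 + l * x * (if x < 1 then 1 else 0)) ∂ν)
    (hD1 : ∀ x : ℝ, 0 < x → HasDerivAt φ (φ' x) x)
    (hD2 : ∀ x : ℝ, 0 < x → HasDerivAt φ' (φ'' x) x)
    (hφ'' : ∀ l : ℝ, 0 < l → φ'' l = 2 * σ ^ 2 + ∫ x in Ioi (0:ℝ), x ^ 2 * Real.exp (-(l * x)) ∂ν)
    (hUV : 0 < σ ∨ ∫⁻ x in Ioo (0:ℝ) 1, ENNReal.ofReal x ∂ν = ⊤)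
    (θ₀ θ₁ : ℝ)
    (hθ₀ : IsGreatest {s : ℝ | 0 ≤ s ∧ φ s = 0} θ₀)
    (hθ₁ : θ₁ = sInf {s : ℝ | 0 < s ∧ 0 < φ' s})
    (μ : ℝ → Measure ℝ)
    (hprob : ∀ t : ℝ, 0 < t → IsProbabilityMeasure (μ t))
    (hchar : ∀ t : ℝ, 0 < t → ∀ ξ : ℝ,
      ∫ x : ℝ, Complex.exp (Complex.I * (ξ : ℂ) * (x : ℂ)) ∂(μ t) =
        Complex.exp (-(t : ℂ) * charExp σ b ν ξ))
    (νd : ℝ → ℝ) (hνd0 : ∀ x : ℝ, 0 ≤ νd x)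
    (hνdens : ∀ s : Set ℝ, MeasurableSet s →
      ν (s ∩ Ioi 0) = ∫⁻ x in s ∩ Ioi (0:ℝ), ENNReal.ofReal (νd x))
    (hνmono : ∃ C₀ : ℝ, 1 ≤ C₀ ∧ ∀ x y : ℝ, 0 < x → x ≤ y → νd y ≤ C₀ * νd x)
    (hσ0 : σ = 0)
    (α c x₀ : ℝ) (hα : 0 < α) (hc : c ∈ Ioc (0:ℝ) 1) (hx₀ : 0 ≤ x₀)
    (hx₀θ₁ : 0 < θ₁ → x₀ ≤ θ₁)
    (hscal : WLSC φ'' (α - 2) c x₀) :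
    ∃ p : ℝ → ℝ → ℝ,
      (∀ t : ℝ, 0 < t → μ t = volume.withDensity (fun x => ENNReal.ofReal (p t x))) ∧
      ∃ C : ℝ, 0 < C ∧ ∀ t : ℝ, 0 < t → t * bigPhi φ'' x₀ < 1 → ∀ x : ℝ,
        ENNReal.ofReal (p t (x + t * brFn b ν (1 / psiInv σ ν (1 / t)))) ≤
          ENNReal.ofReal C *
            min (ENNReal.ofReal (bigPhiInv φ'' (1 / t)))
              (ENNReal.ofReal t * etaFn φ φ'' x₀ |x|) := by
  subst hσ0
  obtain ⟨C₀, hC₀, hmono⟩ := hνmono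
  set N := ν.restrict (Ioi 0) with hN
  have h : IsLaplaceExp N b φ φ' φ'' :=
    isLaplaceExp_restrict hint hφ hD1 hD2 hφ'' (hUV.resolve_left (lt_irrefl 0))
  have hd : ∀ A : Set ℝ, MeasurableSet A → A ⊆ Ioi 0 →
      N A = ∫⁻ x in A, ENNReal.ofReal (νd x) := by
    intro A hA hA0
    have := hνdens A hA
    rwa [inter_eq_left.2 hA0, ← Measure.restrict_eq_self ν hA0] at this
  have hchar' : ∀ t : ℝ, 0 < t → ∀ ξ : ℝ, ∫ x : ℝ, Complex.exp (Complex.I * ξ * x) ∂(μ t) =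
      Complex.exp (t * (Complex.I * b * ξ + ∫ x : ℝ, (Complex.exp (Complex.I * ξ * x) - 1 -
        Complex.I * ξ * x * (if x < 1 then (1:ℂ) else 0)) ∂N)) := by
    intro t ht ξ
    rw [hchar t ht ξ, charExp]
    congr 1
    push_cast
    ring
  set R := fun ξ : ℝ => ∫ x, (1 - Real.cos (ξ * x)) ∂N with hR
  have hΦ := h.controlled_bigPhi
  have hRc : Controlled (levyV N) R 2 := h.controlled_cos
  have hpsi : ∀ v, psiInv 0 ν v = runInv R v := psiInv_zero_eq ⟨_, _, hRc⟩
  set κ := (1 + 16 * C₀ ^ 2) * (π ^ 2 / 2) with hκ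
  have hκ0 : 0 < κ := by positivity
  have hRΦ : ∀ s, 0 < s → κ⁻¹ * bigPhi φ'' s ≤ R s := by
    intro s hs
    rw [inv_mul_eq_div, div_le_iff₀ hκ0, bigPhi, h.eq2 s hs, mul_comm _ κ]
    refine (levyPhi_le_cos h.null h.fin hνd0 hd hC₀ hmono hs).trans ?_
    refine mul_le_mul_of_nonneg_left ?_ hκ0.le
    exact setIntegral_le_integral (integrable_one_sub_cos h.null h.fin s)
      (ae_of_all _ fun x => sub_nonneg.2 (Real.cos_le_one _))
  have hV : ∀ s, 0 < s → levyV N (2 * s) ≤ 4 * levyV N s := by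
    intro s hs
    have := levyV_mul_le (N := N) h.fin hs (one_le_two)
    norm_num at this
    exact this
  obtain ⟨x₁, c₁, hx₁, hx₁₀, hc₁, hg, hx₁V⟩ : ∃ x₁ c₁ : ℝ, 0 ≤ x₁ ∧ x₁ ≤ x₀ ∧ 0 < c₁ ∧
      Good (levyV N) (bigPhi φ'') α x₁ c₁ ∧ (0 < x₁ → 2 * levyV N x₁ ≤ bigPhi φ'' x₀) := by
    rcases hx₀.eq_or_lt with hx | hx
    · obtain ⟨c₁, hc₁, hg⟩ := h.good_zero hα hc.1 hx₀ hscal hx.symm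
      exact ⟨0, c₁, le_rfl, hx₀, hc₁, hg, fun h0 => absurd h0 (lt_irrefl _)⟩
    · have h0 := (tendsto_levyV_zero h.fin).eventually
        (gt_mem_nhds (half_pos (h.bigPhi_pos hx)))
      obtain ⟨x₁, h1, h2⟩ := (h0.and (Ioo_mem_nhdsGT hx)).exists
      obtain ⟨c₁, hc₁, hg⟩ := h.good_of_pos hα hc.1 hx₀ hscal h2.1
      exact ⟨x₁, c₁, h2.1.le, h2.2.le, hc₁, hg, fun _ => by linarith⟩
  obtain ⟨K, hK, hη⟩ := h.exists_levyH_le_etaFn hθ₁ hx₀θ₁ hx₀ hx₁₀ hc₁ hg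
  obtain ⟨B, hB, hB'⟩ : ∃ B : ℝ, 1 ≤ B ∧ 1 ≤ κ⁻¹ * c₁ ^ 2 * B ^ α := by
    have h1 := (tendsto_rpow_atTop hα).const_mul_atTop
      (show 0 < κ⁻¹ * c₁ ^ 2 by positivity)
    obtain ⟨B, h2, h3⟩ := ((eventually_ge_atTop 1).and (h1.eventually_ge_atTop 1)).exists
    exact ⟨B, h2, h3⟩
  obtain ⟨C, hC, hmain⟩ := exists_scaled_density_const h.null h.fin hνd0 hd hC₀ hmono hα
    (c₁ := c₁ ^ 2 / 2) (by positivity) (le_max_left 1 (4 / (c₁ * κ⁻¹)))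
  have hex : ∀ t : ℝ, ∃ q : ℝ → ℝ, 0 < t →
      (μ t = volume.withDensity (fun x => ENNReal.ofReal (q x)) ∧
      (t * bigPhi φ'' x₀ < 1 → ∀ x : ℝ,
        ENNReal.ofReal (q (x + t * brFn b ν (1 / psiInv 0 ν (1 / t)))) ≤
          ENNReal.ofReal (C * (2 * B + K)) *
            min (ENNReal.ofReal (bigPhiInv φ'' (1 / t)))
              (ENNReal.ofReal t * etaFn φ φ'' x₀ |x|))) := by
    intro t
    by_cases ht : 0 < t
    swap
    · exact ⟨0, fun h' => absurd h' ht⟩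
    have := hprob t ht
    by_cases hadm : t * bigPhi φ'' x₀ < 1
    · have hvx : 0 < x₁ → 2 * levyV N x₁ < 1 / t := by
        intro hx
        rw [lt_div_iff₀ ht, mul_comm]
        refine lt_of_le_of_lt ?_ hadm
        exact mul_le_mul_of_nonneg_left (hx₁V hx) ht.le
      obtain ⟨hS, hS1, hS2, hS3⟩ := scale_bounds hΦ hRc (fun s hs => h.bigPhi_pos hs) hα hx₁ hc₁
        (inv_pos.2 hκ0) hg hV hRΦ hB hB' (one_div_pos.2 ht) hvx
      rw [hpsi]
      set S := runInv R (1 / t) with hSdef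
      have hb1 : t * levyV N S ≤ max 1 (4 / (c₁ * κ⁻¹)) := by
        refine le_trans ?_ (le_max_right _ _)
        rw [le_div_iff₀ (by positivity)]
        calc t * levyV N S * (c₁ * κ⁻¹) = t * (c₁ * κ⁻¹ * levyV N S) := by ring
          _ ≤ t * (4 * (1 / t)) := by gcongr
          _ = 4 := by field_simp
      have hb2 : ∀ ξ, S ≤ ξ → c₁ ^ 2 / 2 * (ξ / S) ^ α ≤
          t * (ξ ^ 2 * ∫ x, x ^ 2 * Real.exp (-(ξ * x)) ∂N) := by
        intro ξ hξ
        have h1 := hS2 ξ hξ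
        rw [bigPhi, h.eq2 ξ (hS.trans_le hξ)] at h1
        calc c₁ ^ 2 / 2 * (ξ / S) ^ α = t * (c₁ ^ 2 / 2 * (1 / t) * (ξ / S) ^ α) := by
              field_simp
          _ ≤ _ := by gcongr
      obtain ⟨q, hq, hqle⟩ := exists_real_density_le
        (hmain t S ht hS hb1 hb2 (μ t) b (t * brFn b ν (1 / S)) (hchar' t ht)
          (by rw [brFn, one_div]))
      refine ⟨q, fun _ => ⟨hq, fun _ x => (hqle _).trans ?_⟩⟩
      rw [add_sub_cancel_right, mul_min]
      refine min_le_min ?_ ?_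
      · rw [← ENNReal.ofReal_mul (by positivity)]
        refine ENNReal.ofReal_le_ofReal ?_
        have hinv : 0 ≤ bigPhiInv φ'' (1 / t) := by
          by_contra! hneg
          have : 2 * B * bigPhiInv φ'' (1 / t) < 0 := mul_neg_of_pos_of_neg (by linarith) hneg
          exact absurd (hS.trans_le hS3) (not_lt.2 this.le)
        calc C * S ≤ C * (2 * B * bigPhiInv φ'' (1 / t)) := by
              gcongr
              exact hS3
          _ = C * (2 * B) * bigPhiInv φ'' (1 / t) := by ring
          _ ≤ _ := by
            gcongr
            linarith
      · calc ENNReal.ofReal (C * t) * (ENNReal.ofReal |x|⁻¹ * levyH N |x|)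
            ≤ ENNReal.ofReal (C * t) * (ENNReal.ofReal K * etaFn φ φ'' x₀ |x|) := by
              exact mul_le_mul_right (hη _ (abs_nonneg x)) _
          _ = ENNReal.ofReal (C * K) * (ENNReal.ofReal t * etaFn φ φ'' x₀ |x|) := by
              rw [ENNReal.ofReal_mul hC.le, ENNReal.ofReal_mul hC.le]
              ring
          _ ≤ _ := by
              gcongr
              linarith
    · have hS : 0 < x₁ + 1 := by linarith
      have hΦS := h.bigPhi_pos hS
      obtain ⟨C', hC', hmain'⟩ := exists_scaled_density_const h.null h.fin hνd0 hd hC₀ hmono hα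
        (c₁ := t * (c₁ * bigPhi φ'' (x₁ + 1))) (by positivity)
        (le_max_left 1 (t * levyV N (x₁ + 1)))
      have hb2 : ∀ ξ, x₁ + 1 ≤ ξ →
          t * (c₁ * bigPhi φ'' (x₁ + 1)) * (ξ / (x₁ + 1)) ^ α ≤
          t * (ξ ^ 2 * ∫ x, x ^ 2 * Real.exp (-(ξ * x)) ∂N) := by
        intro ξ hξ
        have h1 := hg.mul_rpow_le hx₁ (lt_add_one x₁) hξ
        rw [bigPhi.eq_def φ'' ξ, h.eq2 ξ (hS.trans_le hξ)] at h1
        rw [mul_assoc]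
        refine mul_le_mul_of_nonneg_left ?_ ht.le
        linarith
      obtain ⟨q, hq, -⟩ := exists_real_density_le
        (hmain' t (x₁ + 1) ht hS (le_max_right _ _) hb2 (μ t) b _ (hchar' t ht) rfl)
      exact ⟨q, fun _ => ⟨hq, fun h' => absurd h' hadm⟩⟩
  choose p hp using hex
  exact ⟨p, fun t ht => (hp t ht).1, C * (2 * B + K), by positivity, fun t ht => (hp t ht).2⟩

end
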